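/- A behaviour of simple base is regular if and only if it is shuffle-regular: A is regular iff all positive-ended chronicles of designs of the incarnations |A| and |A⊥| are visitable and the sets of visitable paths V_A and V_{A⊥} are stable under reversible shuffle. -/

import Mathlib

namespace Ludics

abbrev Address := List ℕ

/-- An action of Ludics: the daimon, or a proper action given by a polarity
(`true` = positive), a focus address and a ramification. -/
inductive Action where
  | daimon : Action
  | proper (pos : Bool) (focus : Address) (ram : Finset ℕ) : Action
deriving DecidableEq

namespace Action

def isPositive : Action → Bool
  | daimon => true
  | proper pos _ _ => pos

def focus? : Action → Option Address
  | daimon => none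
  | proper _ ξ _ => some ξ

/-- Reverse the polarity of an action. -/
def dual : Action → Action
  | daimon => daimon
  | proper pos ξ I => proper (!pos) ξ I

/-- `a.justifiesB b` : the focus of `b` is one of the addresses created by `a`. -/
def justifiesB : Action → Action → Bool
  | proper _ ξ I, proper _ ζ _ => decide (∃ i ∈ I, ζ = ξ ++ [i])
  | _, _ => false

def justifies (a b : Action) : Prop := a.justifiesB b = true

end Action

/-- A sequent of a base: an optional left address (at most one) and a finite
set of right addresses. -/
structure Sequent where
  left : Option Address
  right : Finset Address

abbrev Base := List Sequent

def Base.isPositive (β : Base) : Prop := ∃ σ ∈ β, σ.left = none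

/-- An action is initial w.r.t. a base if its focus belongs to the base
(on the side corresponding to its polarity). -/
def Initial (β : Base) (a : Action) : Prop :=
  ∃ pol ξ I, a = .proper pol ξ I ∧
    ∃ σ ∈ β, (pol = true ∧ ξ ∈ σ.right) ∨ (pol = false ∧ σ.left = some ξ)

/-- A sequent "owns" an action when its focus is hereditarily justified by an
address of the sequent (i.e. extends an address of the sequent). -/
def Sequent.owns (σ : Sequent) (a : Action) : Prop :=
  ∃ ξ, a.focus? = some ξ ∧
    ((∃ γ, σ.left = some γ ∧ γ <+: ξ) ∨ (∃ δ ∈ σ.right, δ <+: ξ))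

def Sequent.addresses (σ : Sequent) : Set Address :=
  (match σ.left with | some γ => {γ} | none => ∅) ∪ ↑σ.right

def Base.addresses (β : Base) : Set Address :=
  {a | ∃ σ ∈ β, a ∈ σ.addresses}

/-- The dual base: each sequent `Γ ⊢ Δ` gives sequents `⊢ Γ` and `δ ⊢` for δ ∈ Δ. -/
noncomputable def Sequent.dualSequents (σ : Sequent) : List Sequent :=
  (match σ.left with
    | some γ => [⟨none, ({γ} : Finset Address)⟩]
    | none => []) ++
    σ.right.toList.map fun δ => ⟨some δ, (∅ : Finset Address)⟩

noncomputable def Base.dual (β : Base) : Base := (β.map Sequent.dualSequents).flatten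

/-- View of a sequence, computed on the reversed sequence (most recent action
first), with fuel. -/
def viewRevAux : ℕ → List Action → List Action
  | 0, _ => []
  | _ + 1, [] => []
  | n + 1, a :: w =>
    if a.isPositive then a :: viewRevAux n w
    else a :: viewRevAux n (w.dropWhile fun b => !(b.justifiesB a))

def viewRev (s : List Action) : List Action := viewRevAux s.length s

/-- The view `⌜s⌝` of a sequence of actions. -/
def view (s : List Action) : List Action := (viewRev s.reverse).reverse

/-- `p` is a path based on `β`. -/
structure IsPath (β : Base) (p : List Action) : Prop where
  alternating : p.Chain' fun a b => a.isPositive ≠ b.isPositive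
  justified : ∀ w a, w ++ [a] <+: p → a ≠ Action.daimon →
    Initial β a ∨ ∃ b ∈ w, b.justifies a
  negJump : ∀ w a b, w ++ [a] <+: p → a.isPositive = true → b ∈ w →
    b.justifies a → b ∈ view w
  posJump : ∀ w a, w ++ [a] <+: p → a.isPositive = true → a ≠ Action.daimon →
    ∀ σ ∈ β, (∃ f, a.focus? = some f ∧ f ∈ σ.right) →
      (w = [] ∧ σ.left = none) ∨
      ∃ w' b, w = w' ++ [b] ∧ b.isPositive = false ∧ σ.owns b
  linearity : (p.filterMap Action.focus?).Nodup
  daimonLast : ∀ w, w ++ [Action.daimon] <+: p → w ++ [Action.daimon] = p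
  daimonFirst : p.head? = some Action.daimon → β.isPositive
  totality : β.isPositive → ∃ a t, p = a :: t ∧
    (a = Action.daimon ∨ (a.isPositive = true ∧ Initial β a))

/-- A chronicle: a non-empty path where each non-initial negative action is
justified by the immediately preceding action. -/
def IsChronicle (β : Base) (c : List Action) : Prop :=
  IsPath β c ∧ c ≠ [] ∧
    ∀ w a b, w ++ [a, b] <+: c → b.isPositive = false →
      Initial β b ∨ a.justifies b

/-- The dual of a positive-ended sequence: reverse all polarities, removing a
final daimon if present and appending one otherwise. -/
def dualSeq (p : List Action) : List Action :=
  if p.getLast? = some Action.daimon then p.dropLast.map Action.dual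
  else p.map Action.dual ++ [Action.daimon]

/-- Positive-ended (possibly empty) sequence. -/
def PosEnded (p : List Action) : Prop :=
  p = [] ∨ ∃ a, p.getLast? = some a ∧ a.isPositive = true

/-- A (non-empty) negative-starting, positive-ended block. -/
def NegBlock (b : List Action) : Prop :=
  b ≠ [] ∧ (∀ a, b.head? = some a → a.isPositive = false) ∧
    ∀ a, b.getLast? = some a → a.isPositive = true

def EndsWithDaimon (p : List Action) : Prop := p.getLast? = some Action.daimon

/-- Basic shuffle of two positive-ended negative paths: interleaving by
positive-ended negative blocks; if the last `p`-block ends with the daimon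
then the last `q`-block is empty. -/
def ShuffleNeg (p q r : List Action) : Prop :=
  ∃ ps qs : List (List Action),
    ps.length = qs.length ∧
    (∀ b ∈ ps, b = [] ∨ NegBlock b) ∧
    (∀ b ∈ qs, b = [] ∨ NegBlock b) ∧
    ps.flatten = p ∧ qs.flatten = q ∧
    (List.zipWith (· ++ ·) ps qs).flatten = r ∧
    (EndsWithDaimon (ps.getLast?.getD []) → qs.getLast?.getD [] = [])

/-- The shuffle `r ∈ p ⧢ q`, including the extensions to two daimon-ended
paths and to paths with a common positive-ended prefix. -/
inductive Shuffle : List Action → List Action → List Action → Prop where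
  | base {p q r} : ShuffleNeg p q r → Shuffle p q r
  | daiLeft {p q r} {κ₁ κ₂ : Action} :
      Shuffle (p ++ [κ₁, Action.daimon]) q r →
      Shuffle (p ++ [κ₁, Action.daimon]) (q ++ [κ₂, Action.daimon]) r
  | daiRight {p q r} {κ₁ κ₂ : Action} :
      Shuffle p (q ++ [κ₂, Action.daimon]) r →
      Shuffle (p ++ [κ₁, Action.daimon]) (q ++ [κ₂, Action.daimon]) r
  | pre {s p q r} : s ≠ [] → PosEnded s → Shuffle p q r →
      Shuffle (s ++ p) (s ++ q) (s ++ r)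

/-- Shuffle closure of a set of (positive-ended) paths. -/
inductive ShuffleClosure (P : Set (List Action)) : List Action → Prop where
  | mem {p} : p ∈ P → ShuffleClosure P p
  | shuffle {p q r} : ShuffleClosure P p → ShuffleClosure P q →
      Shuffle p q r → ShuffleClosure P r

/-- Coherence of chronicles: comparability and propagation. -/
def Coherent (c₁ c₂ : List Action) : Prop :=
  (∀ w κ₁ κ₂, w ++ [κ₁] <+: c₁ → w ++ [κ₂] <+: c₂ →
      κ₁ = κ₂ ∨ (κ₁.isPositive = false ∧ κ₂.isPositive = false)) ∧
  (∀ w ξ₁ I₁ w₁ σ₁ ξ₂ I₂ w₂ σ₂,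
      w ++ Action.proper false ξ₁ I₁ :: w₁ ++ [σ₁] <+: c₁ →
      w ++ Action.proper false ξ₂ I₂ :: w₂ ++ [σ₂] <+: c₂ →
      ξ₁ ≠ ξ₂ → ∀ f, σ₁.focus? = some f → σ₂.focus? ≠ some f)

/-- A design, as a prefix-closed clique of chronicles. -/
structure IsDesign (β : Base) (D : Set (List Action)) : Prop where
  chron : ∀ c ∈ D, IsChronicle β c
  prefixClosed : ∀ c ∈ D, ∀ d, d <+: c → d ≠ [] → d ∈ D
  coherent : ∀ c ∈ D, ∀ d ∈ D, Coherent c d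
  maxPos : ∀ c ∈ D, (∀ κ, c ++ [κ] ∉ D) →
    ∃ a, c.getLast? = some a ∧ a.isPositive = true
  posNonempty : β.isPositive → D.Nonempty

/-- A net of designs, abusively seen as its set of chronicles. -/
structure IsNet (β : Base) (R : Set (List Action)) : Prop where
  chron : ∀ c ∈ R, IsChronicle β c
  prefixClosed : ∀ c ∈ R, ∀ d, d <+: c → d ≠ [] → d ∈ R

/-- `p` is a path of the design/net `D`: each view of each non-empty prefix of
`p` is a chronicle of `D`. -/
def PathOf (β : Base) (D : Set (List Action)) (p : List Action) : Prop :=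
  IsPath β p ∧ ∀ q, q <+: p → q ≠ [] → view q ∈ D

/-- Whose turn it is in normalization: `dpos` says whether the design `D` owns
the first (positive) move; afterwards `D` moves exactly after negative actions. -/
def TurnD (dpos : Prop) (s : List Action) : Prop :=
  match s.getLast? with
  | none => dpos
  | some a => a.isPositive = false

/-- Interaction (normalization) between a design `D` and a counter-net `R`,
described by its visited sequence `s` (seen from `D`): it converges from
state `s` if the design to move plays the daimon, or it plays a proper
positive action accepted (in dual form) by the other one, and the interaction
converges from the extended state. -/
inductive Conv (D R : Set (List Action)) (dpos : Prop) : List Action → Prop where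
  | daiD {s} : TurnD dpos s → view (s ++ [Action.daimon]) ∈ D → Conv D R dpos s
  | daiR {s} : ¬ TurnD dpos s →
      view (s.map Action.dual ++ [Action.daimon]) ∈ R → Conv D R dpos s
  | stepD {s κ} : TurnD dpos s → κ.isPositive = true → κ ≠ Action.daimon →
      view (s ++ [κ]) ∈ D → view ((s ++ [κ]).map Action.dual) ∈ R →
      Conv D R dpos (s ++ [κ]) → Conv D R dpos s
  | stepR {s κ} : ¬ TurnD dpos s → κ.isPositive = false →
      view ((s ++ [κ]).map Action.dual) ∈ R → view (s ++ [κ]) ∈ D →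
      Conv D R dpos (s ++ [κ]) → Conv D R dpos s

/-- The simple base `⊢ ξ` (positive) or `ξ ⊢` (negative). -/
def simpleBase (ξ : Address) (pos : Bool) : Base :=
  if pos then [⟨none, {ξ}⟩] else [⟨some ξ, ∅⟩]

/-- The orthogonal of a set of designs on a simple base. -/
def orthSet (ξ : Address) (pos : Bool) (A : Set (Set (List Action))) :
    Set (Set (List Action)) :=
  {E | IsDesign (simpleBase ξ !pos) E ∧
    ∀ D ∈ A, if pos then Conv D E True [] else Conv E D True []}

def biorth (ξ : Address) (pos : Bool) (A : Set (Set (List Action))) :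
    Set (Set (List Action)) :=
  orthSet ξ (!pos) (orthSet ξ pos A)

/-- A behaviour: a bi-orthogonally closed set of designs on a simple base. -/
structure Behaviour (ξ : Address) (pos : Bool) where
  designs : Set (Set (List Action))
  isDesign : ∀ D ∈ designs, IsDesign (simpleBase ξ pos) D
  closed : designs = biorth ξ pos designs

/-- Visitable paths of a set of designs: traces of convergent normalizations
with the orthogonal, characterized as the dual pairs of paths. -/
def VisitableSet (ξ : Address) (pos : Bool) (S : Set (Set (List Action)))
    (p : List Action) : Prop :=
  ∃ D ∈ S, ∃ E ∈ orthSet ξ pos S,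
    PathOf (simpleBase ξ pos) D p ∧ PathOf (simpleBase ξ !pos) E (dualSeq p)

def Visitable {ξ : Address} {pos : Bool} (A : Behaviour ξ pos)
    (p : List Action) : Prop :=
  VisitableSet ξ pos A.designs p

/-- Material (incarnated) design of a behaviour: inclusion-minimal. -/
def Material {ξ : Address} {pos : Bool} (A : Behaviour ξ pos)
    (D : Set (List Action)) : Prop :=
  D ∈ A.designs ∧ ∀ E ∈ A.designs, E ⊆ D → E = D

/-- Completion of a design: add daimon-ended chronicles after every missing
negative action. -/
def completion (β : Base) (D : Set (List Action)) : Set (List Action) :=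
  D ∪ {c' | ∃ c ∈ D, ∃ ξ I,
    (c' = c ++ [Action.proper false ξ I] ∨
      c' = c ++ [Action.proper false ξ I, Action.daimon]) ∧
    IsChronicle β (c ++ [Action.proper false ξ I, Action.daimon]) ∧
    c ++ [Action.proper false ξ I] ∉ D}

def DaiDesign : Set (List Action) := {[Action.daimon]}

def firstAction (D : Set (List Action)) (κ : Action) : Prop :=
  ∃ c ∈ D, c.head? = some κ

/-- Directory of a set of positive designs on `⊢ ξ`. -/
def directory (ξ : Address) (A : Set (Set (List Action))) : Set (Finset ℕ) :=
  {I | ∃ D ∈ A, firstAction D (Action.proper true ξ I)}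

/-- Alien positive behaviours: ramifications of first actions pairwise disjoint. -/
def Alien (ξ : Address) (A B : Behaviour ξ true) : Prop :=
  ∀ I ∈ directory ξ A.designs, ∀ J ∈ directory ξ B.designs, Disjoint I J

/-- Extension of the first action of a design by a set `J`. -/
def extDesign (ξ : Address) (J : Finset ℕ) (D : Set (List Action)) :
    Set (List Action) :=
  {c | ∃ I t, (Action.proper true ξ I :: t) ∈ D ∧
      c = Action.proper true ξ (I ∪ J) :: t}

/-- The extension `A_[B]` of a set of designs along another. -/
def extended (ξ : Address) (A B : Set (Set (List Action))) :
    Set (Set (List Action)) :=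
  insert DaiDesign
    {D' | ∃ D ∈ A, (∃ I, firstAction D (Action.proper true ξ I)) ∧
      ∃ E ∈ B, ∃ J, firstAction E (Action.proper true ξ J) ∧
        D' = extDesign ξ J D}

/-- The extension `P_[Q]` of a set of paths along another. -/
def extPaths (ξ : Address) (P Q : Set (List Action)) : Set (List Action) :=
  insert [Action.daimon]
    {p | ∃ I t, (Action.proper true ξ I :: t) ∈ P ∧
      ∃ q ∈ Q, ∃ J, q.head? = some (Action.proper true ξ J) ∧
        p = Action.proper true ξ (I ∪ J) :: t}

/-- Prefixing a (negative) design by the positive action `(+, ξ, {i})`. -/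
def shiftD (ξ : Address) (i : ℕ) (D : Set (List Action)) : Set (List Action) :=
  insert [Action.proper true ξ {i}]
    {c | ∃ d ∈ D, c = Action.proper true ξ {i} :: d}

/-- `C = ↑N` : the positive shift of the negative behaviour `N`. -/
def IsShiftOf (ξ : Address) (i : ℕ) (C : Behaviour ξ true)
    (N : Behaviour (ξ ++ [i]) false) : Prop :=
  C.designs = biorth ξ true (shiftD ξ i '' N.designs)

/-- `C = ⊕ₖ F k`. -/
def IsSumOf {ξ : Address} {ι : Type} (C : Behaviour ξ true)
    (F : ι → Behaviour ξ true) : Prop :=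
  C.designs = biorth ξ true (⋃ k, (F k).designs)

/-- Pairwise disjoint family of positive behaviours (disjoint directories). -/
def PairwiseDisjointFam {ξ : Address} {ι : Type}
    (F : ι → Behaviour ξ true) : Prop :=
  ∀ k l, k ≠ l → ∀ I ∈ directory ξ (F k).designs,
    I ∉ directory ξ (F l).designs

open Classical in
/-- Tensor of two positive designs on `⊢ ξ`. -/
noncomputable def tensorD (ξ : Address) (D E : Set (List Action)) :
    Set (List Action) :=
  if D = DaiDesign ∨ E = DaiDesign then DaiDesign
  else {c | ∃ I J, firstAction D (Action.proper true ξ I) ∧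
      firstAction E (Action.proper true ξ J) ∧
      ∃ t, ((Action.proper true ξ I :: t) ∈ D ∨
            (Action.proper true ξ J :: t) ∈ E) ∧
        c = Action.proper true ξ (I ∪ J) :: t}

/-- `C = A ⊗ B`. -/
def IsTensorOf {ξ : Address} (C A B : Behaviour ξ true) : Prop :=
  C.designs = biorth ξ true
    {G | ∃ D ∈ A.designs, ∃ E ∈ B.designs, G = tensorD ξ D E}

/-- Hereditary chains of justifiers inside a sequence `p`. -/
inductive JustChain (β : Base) (p : List Action) : List Action → Prop where
  | init {κ} : κ ∈ p → Initial β κ → JustChain β p [κ]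
  | cons {s κ κ'} : JustChain β p (s ++ [κ]) → κ' ∈ p → κ.justifies κ' →
      JustChain β p (s ++ [κ, κ'])

/-- Trivial chronicle for a behaviour: hereditary-justifier sequence of an
action of a chronicle of a material design. -/
def TrivialChronicle {ξ : Address} {pos : Bool} (A : Behaviour ξ pos)
    (s : List Action) : Prop :=
  ∃ D, Material A D ∧ ∃ c ∈ D, JustChain (simpleBase ξ pos) c s

/-- Regular path for a behaviour: reversible path whose justifier chains are
trivial chronicles for the behaviour. -/
def RegularPath {ξ : Address} {pos : Bool} (A : Behaviour ξ pos)
    (p : List Action) : Prop :=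
  IsPath (simpleBase ξ pos) p ∧ IsPath (simpleBase ξ !pos) (dualSeq p) ∧
  ∀ κ ∈ p, κ ≠ Action.daimon →
    ∃ s, JustChain (simpleBase ξ pos) p s ∧ s.getLast? = some κ ∧
      TrivialChronicle A s

/-- Regular behaviour: every regular path is visitable. -/
def Regular {ξ : Address} {pos : Bool} (A : Behaviour ξ pos) : Prop :=
  ∀ p, RegularPath A p → Visitable A p

/-- Proper actions occurring in a design. -/
def properActs (D : Set (List Action)) : Set Action :=
  {a | a ≠ Action.daimon ∧ ∃ c ∈ D, a ∈ c}

/-- Essentially finite behaviour: finitely many material designs, all finite. -/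
def EssFinite {ξ : Address} {pos : Bool} (A : Behaviour ξ pos) : Prop :=
  {D | Material A D}.Finite ∧ ∀ D, Material A D → (properActs D).Finite

/-- A slice of a design. -/
def IsSlice (D S : Set (List Action)) : Prop :=
  S ⊆ D ∧ (∀ c ∈ S, ∀ d, d <+: c → d ≠ [] → d ∈ S) ∧
  ∀ w ξ I₁ I₂, w ++ [Action.proper false ξ I₁] ∈ S →
    w ++ [Action.proper false ξ I₂] ∈ S → I₁ = I₂

/-- Uniformly bounded behaviour: slice sizes of material designs uniformly
bounded. -/
def UnifBounded {ξ : Address} {pos : Bool} (A : Behaviour ξ pos) : Prop :=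
  ∃ N : ℕ, ∀ D, Material A D → ∀ S, IsSlice D S →
    (properActs S).Finite ∧ (properActs S).ncard < N

def oneDesign (ξ : Address) : Set (List Action) :=
  {[Action.proper true ξ ∅]}

mutual
  /-- The class `C∞⁺` of positive behaviours: `0`, `1`, or a (possibly
  infinite) nonempty sum of finite tensors of shifts of `C∞⁻` elements. -/
  inductive CInf : (ξ : Address) → Behaviour ξ true → Prop where
    | zero {ξ} (A : Behaviour ξ true) :
        A.designs = {DaiDesign} → CInf ξ A
    | one {ξ} (A : Behaviour ξ true) :
        A.designs = biorth ξ true {oneDesign ξ} → CInf ξ A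
    | sum {ξ} {ι : Type} (F : ι → Behaviour ξ true) (C : Behaviour ξ true) :
        Nonempty ι → (∀ k, CInfTS ξ (F k)) → PairwiseDisjointFam F →
        IsSumOf C F → CInf ξ C
  /-- Finite tensors of positive shifts of duals of `C∞⁺` elements. -/
  inductive CInfTS : (ξ : Address) → Behaviour ξ true → Prop where
    | shift {ξ} {i : ℕ} (C : Behaviour ξ true) (N : Behaviour (ξ ++ [i]) false)
        (P : Behaviour (ξ ++ [i]) true) :
        CInf (ξ ++ [i]) P → N.designs = orthSet (ξ ++ [i]) true P.designs →
        IsShiftOf ξ i C N → CInfTS ξ C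
    | tensor {ξ} (A B C : Behaviour ξ true) :
        CInfTS ξ A → CInfTS ξ B → Alien ξ A B → IsTensorOf C A B →
        CInfTS ξ C
end

mutual
  /-- The class `C_f⁺`: as `C∞⁺` but with finite sums only. -/
  inductive CFin : (ξ : Address) → Behaviour ξ true → Prop where
    | zero {ξ} (A : Behaviour ξ true) :
        A.designs = {DaiDesign} → CFin ξ A
    | one {ξ} (A : Behaviour ξ true) :
        A.designs = biorth ξ true {oneDesign ξ} → CFin ξ A
    | sum {ξ} {ι : Type} (F : ι → Behaviour ξ true) (C : Behaviour ξ true) :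
        Nonempty ι → Finite ι → (∀ k, CFinTS ξ (F k)) → PairwiseDisjointFam F →
        IsSumOf C F → CFin ξ C
  inductive CFinTS : (ξ : Address) → Behaviour ξ true → Prop where
    | shift {ξ} {i : ℕ} (C : Behaviour ξ true) (N : Behaviour (ξ ++ [i]) false)
        (P : Behaviour (ξ ++ [i]) true) :
        CFin (ξ ++ [i]) P → N.designs = orthSet (ξ ++ [i]) true P.designs →
        IsShiftOf ξ i C N → CFinTS ξ C
    | tensor {ξ} (A B C : Behaviour ξ true) :
        CFinTS ξ A → CFinTS ξ B → Alien ξ A B → IsTensorOf C A B →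
        CFinTS ξ C
end

/-- The class `C∞⁻` : duals of `C∞⁺` elements. -/
def CInfN (ξ : Address) (B : Behaviour ξ false) : Prop :=
  ∃ A : Behaviour ξ true, CInf ξ A ∧ B.designs = orthSet ξ true A.designs

def CFinN (ξ : Address) (B : Behaviour ξ false) : Prop :=
  ∃ A : Behaviour ξ true, CFin ξ A ∧ B.designs = orthSet ξ true A.designs

set_option autoImplicit false

/-! ### Views -/

theorem viewRevAux_succ (w : List Action) : ∀ n, w.length ≤ n →
    viewRevAux (n+1) w = viewRevAux n w := by
  induction h : w.length using Nat.strong_induction_on generalizing w with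
  | _ m ih =>
    intro n hn
    cases w with
    | nil => cases n <;> rfl
    | cons a w =>
      subst h
      cases n with
      | zero => simp at hn
      | succ n =>
        simp only [List.length_cons, Nat.add_le_add_iff_right] at hn
        have hd : (w.dropWhile fun b => !(b.justifiesB a)).length ≤ w.length :=
          (List.dropWhile_suffix _).length_le
        rw [viewRevAux, viewRevAux]
        rw [ih w.length (by simp) w rfl n hn]
        rw [ih _ (by simpa using Nat.lt_succ_of_le hd) _ rfl n (by omega)]

theorem viewRevAux_eq (w : List Action) (n : ℕ) (h : w.length ≤ n) :
    viewRevAux n w = viewRev w := by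
  induction n with
  | zero => simp at h; subst h; rfl
  | succ n ih =>
    rcases Nat.lt_or_ge w.length (n+1) with h1 | h1
    · rw [viewRevAux_succ w n (by omega), ih (by omega)]
    · have : w.length = n+1 := by omega
      rw [viewRev, this]

theorem view_nil : view [] = [] := rfl

theorem view_pos {w : List Action} {a : Action} (h : a.isPositive = true) :
    view (w ++ [a]) = view w ++ [a] := by
  simp [view, viewRev, viewRevAux, h]

theorem dropWhile_split {a b : Action} {w1 w2 : List Action} (hb : b.justifies a)
    (h2 : ∀ c ∈ w2, ¬ c.justifies a) :
    (w2.reverse ++ b :: w1).dropWhile (fun b => !(b.justifiesB a)) = b :: w1 := by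
  rw [List.dropWhile_append_of_pos]
  · rw [List.dropWhile_cons_of_neg]
    simpa [Action.justifies] using hb
  · intro c hc
    have := h2 c (by simpa using hc)
    simpa [Action.justifies] using this

theorem view_neg {w1 w2 : List Action} {a b : Action} (h : a.isPositive = false)
    (hb : b.justifies a) (h2 : ∀ c ∈ w2, ¬ c.justifies a) :
    view (w1 ++ b :: w2 ++ [a]) = view (w1 ++ [b]) ++ [a] := by
  have e : (w1 ++ b :: w2 ++ [a]).reverse = a :: (w2.reverse ++ b :: w1.reverse) := by simp
  rw [view, e, viewRev, List.length_cons, viewRevAux]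
  rw [if_neg (by simp [h]), dropWhile_split hb h2, viewRevAux_eq _ _ (by simp)]
  simp [view]

theorem view_neg_none {w : List Action} {a : Action} (h : a.isPositive = false)
    (h2 : ∀ c ∈ w, ¬ c.justifies a) : view (w ++ [a]) = [a] := by
  have e : (w ++ [a]).reverse = a :: w.reverse := by simp
  rw [view, e, viewRev, List.length_cons, viewRevAux]
  rw [if_neg (by simp [h])]
  have : w.reverse.dropWhile (fun b => !(b.justifiesB a)) = [] := by
    rw [List.dropWhile_eq_nil_iff]
    intro c hc
    have := h2 c (by simpa using hc)
    simpa [Action.justifies] using this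
  rw [this, viewRevAux_eq _ _ (by simp)]
  rfl

/-- split at the last justifier -/
theorem exists_split (a : Action) (w : List Action) :
    (∀ c ∈ w, ¬ c.justifies a) ∨
    ∃ w1 b w2, w = w1 ++ b :: w2 ∧ b.justifies a ∧ ∀ c ∈ w2, ¬ c.justifies a := by
  induction w with
  | nil => left; simp
  | cons x w ih =>
    rcases ih with h | ⟨w1, b, w2, rfl, hb, h2⟩
    · by_cases hx : x.justifies a
      · exact Or.inr ⟨[], x, w, rfl, hx, h⟩
      · left; intro c hc
        rcases List.mem_cons.1 hc with rfl | hc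
        · exact hx
        · exact h c hc
    · exact Or.inr ⟨x :: w1, b, w2, rfl, hb, h2⟩

/-- the general shape of views -/
theorem view_shape (w : List Action) (a : Action) : ∃ w', w' <+: w ∧ view (w ++ [a]) = view w' ++ [a] := by
  cases ha : a.isPositive with
  | true => exact ⟨w, List.prefix_rfl, view_pos ha⟩
  | false =>
    rcases exists_split a w with h | ⟨w1, b, w2, rfl, hb, h2⟩
    · exact ⟨[], List.nil_prefix, by rw [view_neg_none ha h]; rfl⟩
    · exact ⟨w1 ++ [b], ⟨w2, by simp⟩, view_neg ha hb h2⟩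

theorem prefix_length_lt {w' w : List Action} {a : Action} (h : w' <+: w) :
    w'.length < (w ++ [a]).length := by
  have := h.length_le; simp; omega

theorem view_subset (w : List Action) : ∀ x ∈ view w, x ∈ w := by
  induction h : w.length using Nat.strong_induction_on generalizing w with
  | _ m ih =>
    intro x hx
    rcases List.eq_nil_or_concat w with rfl | ⟨w, a, rfl⟩
    · simp [view_nil] at hx
    · rw [List.concat_eq_append] at *
      obtain ⟨w', hw', e⟩ := view_shape w a
      rw [e] at hx
      rcases List.mem_append.1 hx with hx | hx
      · exact List.mem_append_left _ (hw'.subset (ih _ (h ▸ prefix_length_lt hw') w' rfl x hx))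
      · exact List.mem_append_right _ hx

theorem view_prefix (w : List Action) : ∀ d, d <+: view w → ∃ q, q <+: w ∧ d = view q := by
  induction h : w.length using Nat.strong_induction_on generalizing w with
  | _ m ih =>
    intro d hd
    rcases List.eq_nil_or_concat w with rfl | ⟨w, a, rfl⟩
    · exact ⟨[], List.prefix_rfl, by simpa [view_nil] using hd⟩
    · rw [List.concat_eq_append] at *
      obtain ⟨w', hw', e⟩ := view_shape w a
      have hd0 := hd
      rw [e] at hd
      rcases List.prefix_concat_iff.1 hd with rfl | hd
      · exact ⟨_, List.prefix_rfl, e.symm⟩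
      · obtain ⟨q, hq, rfl⟩ := ih _ (h ▸ prefix_length_lt hw') w' rfl d hd
        exact ⟨q, (hq.trans hw').trans (List.prefix_append _ _), rfl⟩

theorem mem_view_last (w : List Action) (a : Action) : a ∈ view (w ++ [a]) := by
  obtain ⟨w', -, e⟩ := view_shape w a
  rw [e]; simp

theorem view_eq_nil {w : List Action} (h : view w = []) : w = [] := by
  rcases List.eq_nil_or_concat w with rfl | ⟨w, a, rfl⟩
  · rfl
  · rw [List.concat_eq_append] at *
    have := mem_view_last w a
    rw [h] at this; simp at this

/-! ### Dual -/

@[simp] theorem dual_dual (a : Action) : a.dual.dual = a := by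
  cases a <;> simp [Action.dual]

theorem dual_inj {a b : Action} (h : a.dual = b.dual) : a = b := by
  rw [← dual_dual a, h, dual_dual]

@[simp] theorem map_dual_dual (l : List Action) : (l.map Action.dual).map Action.dual = l := by
  simp [List.map_map, Function.comp_def]

@[simp] theorem dual_focus (a : Action) : a.dual.focus? = a.focus? := by cases a <;> rfl

theorem dual_pos {a : Action} (h : a ≠ .daimon) : a.dual.isPositive = !a.isPositive := by
  cases a
  · exact absurd rfl h
  · rfl

@[simp] theorem dual_ne_daimon {a : Action} : a.dual = .daimon ↔ a = .daimon := by
  cases a <;> simp [Action.dual]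

@[simp] theorem dual_justifies {a b : Action} : a.dual.justifies b.dual ↔ a.justifies b := by
  cases a <;> cases b <;> simp [Action.dual, Action.justifies, Action.justifiesB]

theorem justifies_iff {a b : Action} : b.justifies a ↔
    ∃ f i, b.focus? = some f ∧ a.focus? = some (f ++ [i]) ∧ ∃ p I, b = .proper p f I ∧ i ∈ I := by
  cases a <;> cases b <;> simp [Action.justifies, Action.justifiesB, Action.focus?]
  grind

theorem justifies_focus {a b c : Action} (hb : b.justifies a) (hc : c.justifies a) :
    b.focus? = c.focus? := by
  obtain ⟨f, i, h1, h2, -⟩ := justifies_iff.1 hb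
  obtain ⟨f', i', h1', h2', -⟩ := justifies_iff.1 hc
  rw [h2] at h2'
  have : f = f' := by
    have := Option.some.inj h2'
    exact (List.append_inj' this rfl).1
  rw [h1, h1', this]

theorem justifies_focus' {a a' b c : Action} (hb : b.justifies a) (hc : c.justifies a')
    (h : a.focus? = a'.focus?) : b.focus? = c.focus? := by
  obtain ⟨f, i, h1, h2, -⟩ := justifies_iff.1 hb
  obtain ⟨f', i', h1', h2', -⟩ := justifies_iff.1 hc
  rw [h2, h2'] at h
  have : f = f' := by
    have := Option.some.inj h
    exact (List.append_inj' this rfl).1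
  rw [h1, h1', this]

theorem justifies_ne_focus {a b : Action} (hb : b.justifies a) : b.focus? ≠ a.focus? := by
  obtain ⟨f, i, h1, h2, -⟩ := justifies_iff.1 hb
  rw [h1, h2]
  intro h
  have := congrArg List.length (Option.some.inj h)
  simp at this

theorem justifies_ne_daimon {a b : Action} (hb : b.justifies a) : a ≠ .daimon ∧ b ≠ .daimon := by
  obtain ⟨f, i, h1, h2, -⟩ := justifies_iff.1 hb
  constructor <;> rintro rfl <;> simp_all [Action.focus?]

theorem neg_ne_daimon {a : Action} (h : a.isPositive = false) : a ≠ .daimon := by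
  rintro rfl; simp [Action.isPositive] at h

theorem focus_none {a : Action} : a.focus? = none ↔ a = .daimon := by
  cases a <;> simp [Action.focus?]

theorem initial_iff {ξ : Address} {pos : Bool} {a : Action} :
    Initial (simpleBase ξ pos) a ↔ a.isPositive = pos ∧ a.focus? = some ξ := by
  unfold Initial simpleBase
  cases a with
  | daimon => simp [Action.focus?]
  | proper p f I =>
    cases pos <;> cases p <;> simp [Action.focus?, Action.isPositive]

theorem base_pos {ξ : Address} {pos : Bool} :
    (simpleBase ξ pos).isPositive ↔ pos = true := by
  cases pos <;> simp [simpleBase, Base.isPositive]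



theorem take_snoc {u : List Action} {n : ℕ} {a : Action} (h : u[n]? = some a) :
    u.take (n+1) = u.take n ++ [a] := by
  rw [List.take_add_one, h]; rfl

theorem pre_of_get {u : List Action} {n : ℕ} {a : Action} (h : u[n]? = some a) :
    u.take n ++ [a] <+: u := by
  rw [← take_snoc h]; exact List.take_prefix _ _

theorem get_of_pre {w u : List Action} {a : Action} (h : w ++ [a] <+: u) :
    w = u.take w.length ∧ u[w.length]? = some a := by
  obtain ⟨t, rfl⟩ := h
  simp

theorem get_lt {u : List Action} {n : ℕ} {a : Action} (h : u[n]? = some a) : n < u.length :=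
  (List.getElem?_eq_some_iff.1 h).1

theorem get_mem {u : List Action} {n : ℕ} {a : Action} (h : u[n]? = some a) : a ∈ u :=
  List.mem_of_getElem? h

theorem get_take {u : List Action} {n m : ℕ} {a : Action} : (u.take m)[n]? = some a ↔
    n < m ∧ u[n]? = some a := by
  rw [List.getElem?_take]; split <;> simp_all

theorem take_take' {u : List Action} {n m : ℕ} (h : n ≤ m) : (u.take m).take n = u.take n := by
  rw [List.take_take, min_eq_left h]

/-- A daimon-free reversible play. -/
structure G (ξ : Address) (pos : Bool) (u : List Action) : Prop where
  nod : ∀ a ∈ u, a ≠ .daimon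
  alt : ∀ (n : ℕ) (a b : Action), u[n]? = some a → u[n+1]? = some b → a.isPositive ≠ b.isPositive
  head : ∀ a : Action, u[0]? = some a → a.isPositive = pos ∧ a.focus? = some ξ
  just : ∀ (n : ℕ) (a : Action), u[n]? = some a → 0 < n → ∃ (j : ℕ) (b : Action), j < n ∧ u[j]? = some b ∧ b.justifies a
  lin : ∀ (i j : ℕ) (a b : Action), u[i]? = some a → u[j]? = some b → a.focus? = b.focus? → i = j
  pvis : ∀ (n : ℕ) (a : Action) (j : ℕ) (b : Action), u[n]? = some a → a.isPositive = true → j < n → u[j]? = some b →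
    b.justifies a → b ∈ view (u.take n)
  ovis : ∀ (n : ℕ) (a : Action) (j : ℕ) (b : Action), u[n]? = some a → a.isPositive = false → j < n → u[j]? = some b →
    b.justifies a → b.dual ∈ view ((u.take n).map Action.dual)

def Pol (u : List Action) : Prop :=
  ∀ a ∈ u, ∀ b ∈ u, b.justifies a → b.isPositive ≠ a.isPositive

theorem get_map_dual {u : List Action} {n : ℕ} {a : Action} :
    (u.map Action.dual)[n]? = some a ↔ u[n]? = some a.dual := by
  rw [List.getElem?_map]
  cases h : u[n]? with
  | none => simp
  | some b =>
    simp only [Option.map_some, Option.some.injEq]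
    constructor
    · rintro rfl; simp
    · rintro rfl; simp

theorem G.dual {ξ pos u} (h : G ξ pos u) : G ξ (!pos) (u.map Action.dual) where
  nod := by
    intro a ha
    obtain ⟨b, hb, rfl⟩ := List.mem_map.1 ha
    simpa using h.nod b hb
  alt := by
    intro n a b ha hb
    rw [get_map_dual] at ha hb
    have := h.alt n _ _ ha hb
    have h1 := h.nod _ (get_mem ha)
    have h2 := h.nod _ (get_mem hb)
    rw [dual_pos (by simpa using h1), dual_pos (by simpa using h2)] at this
    simpa using this
  head := by
    intro a ha
    rw [get_map_dual] at ha
    have := h.head _ ha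
    have h1 := h.nod _ (get_mem ha)
    rw [dual_pos (by simpa using h1)] at this
    simp at this ⊢
    grind
  just := by
    intro n a ha hn
    rw [get_map_dual] at ha
    obtain ⟨j, b, hj, hb, hba⟩ := h.just n _ ha hn
    exact ⟨j, b.dual, hj, get_map_dual.2 (by simpa using hb), by
      rw [← dual_justifies]; simpa using hba⟩
  lin := by
    intro i j a b ha hb hab
    rw [get_map_dual] at ha hb
    exact h.lin i j _ _ ha hb (by simpa using hab)
  pvis := by
    intro n a j b ha hp hj hb hba
    rw [get_map_dual] at ha hb
    have h1 := h.nod _ (get_mem ha)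
    have := h.ovis n _ j _ ha (by rw [dual_pos (by simpa using h1)]; simp [hp]) hj hb (by simpa using hba)
    simpa [List.map_take] using this
  ovis := by
    intro n a j b ha hp hj hb hba
    rw [get_map_dual] at ha hb
    have h1 := h.nod _ (get_mem ha)
    have := h.pvis n _ j _ ha (by rw [dual_pos (by simpa using h1)]; simp [hp]) hj hb (by simpa using hba)
    rw [← List.map_take, map_dual_dual]; exact this

theorem Pol.dual {u} (h : Pol u) : Pol (u.map Action.dual) := by
  intro a ha b hb hba
  obtain ⟨a, ha', rfl⟩ := List.mem_map.1 ha
  obtain ⟨b, hb', rfl⟩ := List.mem_map.1 hb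
  rw [dual_justifies] at hba
  have := h a ha' b hb' hba
  have h1 := justifies_ne_daimon hba
  rw [dual_pos h1.1, dual_pos h1.2]
  simpa using this

theorem G.take {ξ pos u} (h : G ξ pos u) (m : ℕ) : G ξ pos (u.take m) where
  nod a ha := h.nod a (List.mem_of_mem_take ha)
  alt n a b ha hb := h.alt n a b (get_take.1 ha).2 (get_take.1 hb).2
  head a ha := h.head a (get_take.1 ha).2
  just n a ha hn := by
    rw [get_take] at ha
    obtain ⟨j, b, hj, hb, hba⟩ := h.just n a ha.2 hn
    exact ⟨j, b, hj, get_take.2 ⟨by omega, hb⟩, hba⟩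
  lin i j a b ha hb := h.lin i j a b (get_take.1 ha).2 (get_take.1 hb).2
  pvis n a j b ha hp hj hb hba := by
    rw [take_take' (get_take.1 ha).1.le]
    exact h.pvis n a j b (get_take.1 ha).2 hp hj (get_take.1 hb).2 hba
  ovis n a j b ha hp hj hb hba := by
    rw [take_take' (get_take.1 ha).1.le]
    exact h.ovis n a j b (get_take.1 ha).2 hp hj (get_take.1 hb).2 hba

theorem Pol.mono {u v} (h : Pol u) (hv : ∀ a ∈ v, a ∈ u) : Pol v :=
  fun a ha b hb => h a (hv a ha) b (hv b hb)

theorem G.foc {ξ pos u} (h : G ξ pos u) : ∀ (n : ℕ) (a : Action), u[n]? = some a → ∃ l, a.focus? = some (ξ ++ l) := by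
  intro n
  induction n using Nat.strong_induction_on with
  | _ n ih =>
    intro a ha
    rcases Nat.eq_zero_or_pos n with rfl | hn
    · exact ⟨[], by simpa using (h.head a ha).2⟩
    · obtain ⟨j, b, hj, hb, hba⟩ := h.just n a ha hn
      obtain ⟨l, hl⟩ := ih j hj b hb
      obtain ⟨f, i, h1, h2, -⟩ := justifies_iff.1 hba
      rw [hl] at h1
      exact ⟨l ++ [i], by rw [h2, ← Option.some.inj h1, List.append_assoc]⟩

theorem G.foc_mem {ξ pos u} (h : G ξ pos u) {a} (ha : a ∈ u) : ∃ l, a.focus? = some (ξ ++ l) := by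
  obtain ⟨n, hn⟩ := List.mem_iff_getElem?.1 ha
  exact h.foc n a hn

theorem G.linm {ξ pos u} (h : G ξ pos u) {a b} (ha : a ∈ u) (hb : b ∈ u)
    (hab : a.focus? = b.focus?) : a = b := by
  obtain ⟨n, hn⟩ := List.mem_iff_getElem?.1 ha
  obtain ⟨m, hm⟩ := List.mem_iff_getElem?.1 hb
  have := h.lin n m a b hn hm hab
  subst this
  rw [hn] at hm; exact Option.some.inj hm

/-- nothing in a play justifies an action of focus `ξ` -/
theorem G.not_just {ξ pos u} (h : G ξ pos u) {a b} (hb : b ∈ u) (ha : a.focus? = some ξ) :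
    ¬ b.justifies a := by
  intro hba
  obtain ⟨f, i, h1, h2, -⟩ := justifies_iff.1 hba
  obtain ⟨l, hl⟩ := h.foc_mem hb
  rw [hl] at h1; rw [ha] at h2
  have := congrArg List.length (Option.some.inj h2)
  have := congrArg List.length (Option.some.inj h1)
  simp at *
  omega

theorem split_at {u : List Action} {j n : ℕ} {b : Action} (hj : j < n) (hb : u[j]? = some b) :
    ∃ w2, u.take n = u.take j ++ b :: w2 ∧ ∀ c ∈ w2, ∃ i, j < i ∧ i < n ∧ u[i]? = some c := by
  refine ⟨(u.take n).drop (j+1), ?_, ?_⟩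
  · conv_lhs => rw [← List.take_append_drop j (u.take n)]
    rw [take_take' hj.le]
    congr 1
    have : (u.take n)[j]? = some b := get_take.2 ⟨hj, hb⟩
    obtain ⟨h1, h2⟩ := List.getElem?_eq_some_iff.1 this
    rw [List.drop_eq_getElem_cons h1, h2]
  · intro c hc
    obtain ⟨i, hi⟩ := List.mem_iff_getElem?.1 hc
    rw [List.getElem?_drop, get_take] at hi
    exact ⟨j+1+i, by omega, hi.1, hi.2⟩

theorem G.view_neg {ξ pos u} (h : G ξ pos u) {n j a b} (ha : u[n]? = some a)
    (hn : a.isPositive = false) (hj : j < n) (hb : u[j]? = some b) (hba : b.justifies a) :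
    view (u.take (n+1)) = view (u.take (j+1)) ++ [a] := by
  obtain ⟨w2, e, h2⟩ := split_at hj hb
  rw [take_snoc ha, e, take_snoc hb]
  refine Ludics.view_neg hn hba ?_
  intro c hc hca
  obtain ⟨i, hi, -, hic⟩ := h2 c hc
  have := h.lin i j c b hic hb (justifies_focus hca hba)
  omega

theorem view_pos' {u : List Action} {n a} (ha : u[n]? = some a)
    (hn : a.isPositive = true) : view (u.take (n+1)) = view (u.take n) ++ [a] := by
  rw [take_snoc ha, view_pos hn]

def dview (u : List Action) : List Action := view (u.map Action.dual)

theorem G.dview_pos {ξ pos u} (h : G ξ pos u) {n j a b} (ha : u[n]? = some a)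
    (hn : a.isPositive = true) (hj : j < n) (hb : u[j]? = some b) (hba : b.justifies a) :
    dview (u.take (n+1)) = dview (u.take (j+1)) ++ [a.dual] := by
  have := h.dual.view_neg (n := n) (j := j) (a := a.dual) (b := b.dual)
    (get_map_dual.2 (by simpa using ha))
    (by rw [dual_pos (h.nod _ (get_mem ha))]; simp [hn]) hj
    (get_map_dual.2 (by simpa using hb)) (by simpa using hba)
  simpa [dview, List.map_take] using this

theorem dview_neg {u : List Action} {n a} (ha : u[n]? = some a)
    (hn : a.isPositive = false) : dview (u.take (n+1)) = dview (u.take n) ++ [a.dual] := by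
  rw [dview, take_snoc ha, List.map_append, List.map_singleton, view_pos]; rfl
  rw [dual_pos (neg_ne_daimon hn)]; simp [hn]

theorem get_snoc {u : List Action} {n : ℕ} {a x : Action} : (u ++ [a])[n]? = some x ↔
    u[n]? = some x ∨ (n = u.length ∧ x = a) := by
  rw [List.getElem?_append]
  split
  · constructor
    · exact Or.inl
    · rintro (h | ⟨h, -⟩)
      · exact h
      · omega
  · have : u[n]? = none := by simp; omega
    rw [this]
    cases hh : n - u.length with
    | zero => simp; grind
    | succ k => simp; omega

theorem take_append_le {u : List Action} {n : ℕ} {a : Action} (h : n ≤ u.length) :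
    (u ++ [a]).take n = u.take n := List.take_append_of_le_length h

theorem G.snoc {ξ pos u} (h : G ξ pos u) {a} (hd : a ≠ .daimon)
    (h0 : u = [] → a.isPositive = pos ∧ a.focus? = some ξ)
    (hj : u ≠ [] → ∃ b ∈ u, b.justifies a)
    (halt : ∀ b, u.getLast? = some b → b.isPositive ≠ a.isPositive)
    (hl : ∀ b ∈ u, b.focus? ≠ a.focus?)
    (hp : a.isPositive = true → ∀ b ∈ u, b.justifies a → b ∈ view u)
    (ho : a.isPositive = false → ∀ b ∈ u, b.justifies a → b.dual ∈ dview u) :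
    G ξ pos (u ++ [a]) where
  nod := by
    intro b hb
    rcases List.mem_append.1 hb with hb | hb
    · exact h.nod b hb
    · rw [List.mem_singleton.1 hb]; exact hd
  alt := by
    intro n x y hx hy
    rw [get_snoc] at hx hy
    rcases hx with hx | ⟨rfl, rfl⟩ <;> rcases hy with hy | ⟨hn, rfl⟩
    · exact h.alt n x y hx hy
    · apply halt
      rw [List.getLast?_eq_getElem?, ← hn]; simpa using hx
    · have := get_lt hy; omega
    · omega
  head := by
    intro x hx
    rw [get_snoc] at hx
    rcases hx with hx | ⟨hn, rfl⟩
    · exact h.head x hx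
    · exact h0 (List.length_eq_zero_iff.1 hn.symm)
  just := by
    intro n x hx hn
    rw [get_snoc] at hx
    rcases hx with hx | ⟨rfl, rfl⟩
    · obtain ⟨j, b, hj, hb, hba⟩ := h.just n x hx hn
      exact ⟨j, b, hj, get_snoc.2 (Or.inl hb), hba⟩
    · obtain ⟨b, hb, hba⟩ := hj (by rintro rfl; simp at hn)
      obtain ⟨m, hm⟩ := List.mem_iff_getElem?.1 hb
      exact ⟨m, b, get_lt hm, get_snoc.2 (Or.inl hm), hba⟩
  lin := by
    intro i j x y hx hy hxy
    rw [get_snoc] at hx hy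
    rcases hx with hx | ⟨rfl, rfl⟩ <;> rcases hy with hy | ⟨hn, rfl⟩
    · exact h.lin i j x y hx hy hxy
    · exact absurd hxy (hl x (get_mem hx))
    · exact absurd hxy.symm (hl y (get_mem hy))
    · omega
  pvis := by
    intro n x j y hx hpx hjn hy hyx
    rw [get_snoc] at hx hy
    rcases hx with hx | ⟨rfl, rfl⟩ <;> rcases hy with hy | ⟨rfl, rfl⟩
    · rw [take_append_le (get_lt hx).le]; exact h.pvis n x j y hx hpx hjn hy hyx
    · have := get_lt hx; omega
    · rw [take_append_le le_rfl, List.take_length]; exact hp hpx y (get_mem hy) hyx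
    · omega
  ovis := by
    intro n x j y hx hpx hjn hy hyx
    rw [get_snoc] at hx hy
    rcases hx with hx | ⟨rfl, rfl⟩ <;> rcases hy with hy | ⟨rfl, rfl⟩
    · rw [take_append_le (get_lt hx).le]; exact h.ovis n x j y hx hpx hjn hy hyx
    · have := get_lt hx; omega
    · rw [take_append_le le_rfl, List.take_length]; exact ho hpx y (get_mem hy) hyx
    · omega

theorem G.nil {ξ pos} : G ξ pos [] := by
  constructor <;> simp

/-! ### Closing a play with a daimon -/

def turn (pos : Bool) (u : List Action) : Bool :=
  match u.getLast? with
  | none => pos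
  | some a => !a.isPositive

def close (pos : Bool) (u : List Action) : List Action :=
  if turn pos u then u ++ [.daimon] else u

theorem turn_nil (pos) : turn pos [] = pos := rfl
theorem turn_snoc (pos u a) : turn pos (u ++ [a]) = !a.isPositive := by simp [turn]

theorem dualSeq_snoc_daimon (u) : dualSeq (u ++ [.daimon]) = u.map Action.dual := by
  simp [dualSeq]

theorem dualSeq_nodai {u : List Action} (h : ∀ a ∈ u, a ≠ .daimon) :
    dualSeq u = u.map Action.dual ++ [.daimon] := by
  rw [dualSeq, if_neg]
  intro h'
  exact h _ (List.mem_of_getLast? h') rfl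

theorem turn_dual {pos} {u : List Action} (h : ∀ a ∈ u, a ≠ .daimon) :
    turn (!pos) (u.map Action.dual) = !turn pos u := by
  rcases List.eq_nil_or_concat u with rfl | ⟨w, a, rfl⟩
  · rfl
  · rw [List.concat_eq_append] at *
    rw [List.map_append, List.map_singleton, turn_snoc, turn_snoc, dual_pos (h a (by simp))]

theorem dualSeq_close {pos} {u : List Action} (h : ∀ a ∈ u, a ≠ .daimon) :
    dualSeq (close pos u) = close (!pos) (u.map Action.dual) := by
  unfold close
  rw [turn_dual h]
  cases turn pos u
  · simp [dualSeq_nodai h]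
  · simp [dualSeq_snoc_daimon]

theorem prefix_close {pos u q} (h : q <+: close pos u) :
    q <+: u ∨ (turn pos u = true ∧ q = u ++ [.daimon]) := by
  unfold close at h
  split at h
  · rcases List.prefix_concat_iff.1 h with rfl | h
    · right; simp_all
    · exact Or.inl h
  · exact Or.inl h

theorem u_prefix_close {pos u} : u <+: close pos u := by
  unfold close; split
  · exact List.prefix_append _ _
  · exact List.prefix_rfl

theorem isChain_iff_get {R : Action → Action → Prop} {l : List Action} :
    l.IsChain R ↔ ∀ n a b, l[n]? = some a → l[n+1]? = some b → R a b := by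
  rw [List.isChain_iff_getElem]
  constructor
  · intro h n a b ha hb
    obtain ⟨h1, rfl⟩ := List.getElem?_eq_some_iff.1 ha
    obtain ⟨h2, rfl⟩ := List.getElem?_eq_some_iff.1 hb
    exact h n h2
  · intro h n hn
    exact h n _ _ (List.getElem?_eq_getElem _) (List.getElem?_eq_getElem _)

theorem nodup_foc_iff {u : List Action} (hn : ∀ a ∈ u, a ≠ .daimon) :
    (u.filterMap Action.focus?).Nodup ↔
    ∀ (i j : ℕ) (a b : Action), u[i]? = some a → u[j]? = some b → a.focus? = b.focus? → i = j := by
  induction u using List.reverseRecOn with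
  | nil => simp
  | append_singleton u x ih =>
    have hx : x ≠ .daimon := hn x (by simp)
    obtain ⟨f, hf⟩ : ∃ f, x.focus? = some f := by
      cases h : x.focus? with
      | none => exact absurd (focus_none.1 h) hx
      | some f => exact ⟨f, rfl⟩
    rw [List.filterMap_append, List.nodup_append]
    rw [ih (fun a ha => hn a (by simp [ha]))]
    constructor
    · rintro ⟨h1, -, h3⟩ i j a b ha hb hab
      rw [get_snoc] at ha hb
      have key : ∀ (i : ℕ) (a : Action), u[i]? = some a → a.focus? ≠ x.focus? := by
        intro i a ha he
        refine h3 f ?_ f ?_ rfl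
        · exact List.mem_filterMap.2 ⟨a, get_mem ha, by rw [he, hf]⟩
        · simp [hf]
      rcases ha with ha | ⟨rfl, rfl⟩ <;> rcases hb with hb | ⟨hn, rfl⟩
      · exact h1 i j a b ha hb hab
      · exact absurd hab (key _ _ ha)
      · exact absurd hab.symm (key _ _ hb)
      · omega
    · intro h
      refine ⟨fun i j a b ha hb => h i j a b (get_snoc.2 (Or.inl ha)) (get_snoc.2 (Or.inl hb)),
        by simp [hf], ?_⟩
      intro y hy z hz hyz
      simp [hf] at hz
      subst hyz
      obtain ⟨a, ha, hay⟩ := List.mem_filterMap.1 hy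
      obtain ⟨n, hn⟩ := List.mem_iff_getElem?.1 ha
      have := h n u.length a x (get_snoc.2 (Or.inl hn)) (get_snoc.2 (Or.inr ⟨rfl, rfl⟩)) (by rw [hay, hf, hz])
      have := get_lt hn
      omega

theorem pre_close_proper {pos u w a} (h : w ++ [a] <+: close pos u) (ha : a ≠ .daimon) :
    w = u.take w.length ∧ u[w.length]? = some a := by
  rcases prefix_close h with h | ⟨-, h⟩
  · exact get_of_pre h
  · exact absurd (List.append_inj' h rfl).2 (by simpa using ha)

theorem G.isPath {ξ pos u} (h : G ξ pos u) : IsPath (simpleBase ξ pos) (close pos u) where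
  alternating := by
    show List.IsChain _ _
    have h1 : u.IsChain (fun a b => a.isPositive ≠ b.isPositive) := isChain_iff_get.2 h.alt
    unfold close
    split
    · rename_i ht
      rw [List.isChain_append]
      refine ⟨h1, by simp, ?_⟩
      intro x hx y hy
      simp at hy; subst hy
      rw [turn, Option.mem_def.1 hx] at ht
      simp_all [Action.isPositive]
    · exact h1
  justified := by
    intro w a hw ha
    obtain ⟨h1, h2⟩ := pre_close_proper hw ha
    rcases Nat.eq_zero_or_pos w.length with h0 | h0
    · left
      rw [h0] at h2
      exact initial_iff.2 (h.head a h2)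
    · right
      obtain ⟨j, b, hj, hb, hba⟩ := h.just _ a h2 h0
      refine ⟨b, ?_, hba⟩
      rw [h1]
      exact get_mem (get_take.2 ⟨hj, hb⟩)
  negJump := by
    intro w a b hw hp hb hba
    obtain ⟨h1, h2⟩ := pre_close_proper hw (justifies_ne_daimon hba).1
    obtain ⟨j, hj⟩ := List.mem_iff_getElem?.1 hb
    have hjl := get_lt hj
    rw [h1] at hj ⊢
    exact h.pvis _ a j b h2 hp hjl (get_take.1 hj).2 hba
  posJump := by
    intro w a hw hp ha σ hσ hf
    obtain ⟨h1, h2⟩ := pre_close_proper hw ha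
    obtain ⟨f, hf, hfr⟩ := hf
    left
    cases pos
    · simp [simpleBase] at hσ; subst hσ; simp at hfr
    · simp [simpleBase] at hσ; subst hσ; simp at hfr
      subst hfr
      refine ⟨?_, rfl⟩
      by_contra hw0
      have h0 : 0 < w.length := List.length_pos_iff.2 hw0
      obtain ⟨j, b, hj, hb, hba⟩ := h.just _ a h2 h0
      exact h.not_just (get_mem hb) hf hba
  linearity := by
    have h1 := (nodup_foc_iff h.nod).2 h.lin
    unfold close
    split
    · rw [List.filterMap_append]
      have h2 : List.filterMap Action.focus? [Action.daimon] = [] := rfl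
      rw [h2, List.append_nil]; exact h1
    · exact h1
  daimonLast := by
    intro w hw
    rcases prefix_close hw with h1 | ⟨h1, h2⟩
    · exact absurd rfl (h.nod _ (h1.subset (by simp)))
    · rw [h2, close, if_pos h1]
  daimonFirst := by
    intro hd
    rw [base_pos]
    cases u with
    | nil =>
      by_contra hp
      simp [close, turn_nil, hp] at hd
    | cons a u =>
      have := h.nod a (by simp)
      obtain ⟨t, ht⟩ := u_prefix_close (pos := pos) (u := a :: u)
      rw [← ht] at hd
      simp at hd
      exact absurd hd this
  totality := by
    intro hb
    rw [base_pos] at hb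
    subst hb
    cases u with
    | nil => exact ⟨.daimon, [], rfl, Or.inl rfl⟩
    | cons a u =>
      obtain ⟨t, ht⟩ := u_prefix_close (pos := true) (u := a :: u)
      have := h.head a rfl
      exact ⟨a, u ++ t, by rw [← ht]; rfl, Or.inr ⟨this.1, initial_iff.2 this⟩⟩



theorem path_lin {β : Base} {p u : List Action} (hp : IsPath β p) (hu : u <+: p) (hn : ∀ a ∈ u, a ≠ .daimon) :
    ∀ (i j : ℕ) (a b : Action), u[i]? = some a → u[j]? = some b → a.focus? = b.focus? → i = j := by
  refine (nodup_foc_iff hn).1 ?_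
  obtain ⟨t, rfl⟩ := hu
  have := hp.linearity
  rw [List.filterMap_append] at this
  exact this.of_append_left

theorem G_of_path {ξ : Address} {pos : Bool} {p u : List Action} (hp : IsPath (simpleBase ξ pos) p)
    (hu : u <+: p) (hn : ∀ a ∈ u, a ≠ .daimon)
    (ov : ∀ (n : ℕ) (a : Action) (j : ℕ) (b : Action), u[n]? = some a → a.isPositive = false → j < n → u[j]? = some b →
      b.justifies a → b.dual ∈ dview (u.take n)) : G ξ pos u := by
  have hl := path_lin hp hu hn
  have hpre : ∀ {n : ℕ} {a : Action}, u[n]? = some a → u.take n ++ [a] <+: p := fun h => (pre_of_get h).trans hu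
  have h0 : ∀ a : Action, u[0]? = some a → a.isPositive = pos ∧ a.focus? = some ξ := by
    intro a ha
    rcases hp.justified _ a (hpre ha) (hn a (get_mem ha)) with h | ⟨b, hb, -⟩
    · exact initial_iff.1 h
    · simp at hb
  refine ⟨hn, ?_, h0, ?_, hl, ?_, ov⟩
  · intro n a b ha hb
    have h1 : u.IsChain _ := List.IsChain.prefix hp.alternating hu
    exact isChain_iff_get.1 h1 n a b ha hb
  · intro n a ha hn0
    rcases hp.justified _ a (hpre ha) (hn a (get_mem ha)) with h | ⟨b, hb, hba⟩
    · have h1 := (initial_iff.1 h).2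
      have : ∃ x : Action, u[0]? = some x := by
        have := get_lt ha
        exact ⟨u[0]'(by omega), List.getElem?_eq_getElem _⟩
      obtain ⟨x, hx⟩ := this
      have := hl 0 n x a hx ha (by rw [(h0 x hx).2, h1])
      omega
    · obtain ⟨j, hj⟩ := List.mem_iff_getElem?.1 hb
      rw [get_take] at hj
      exact ⟨j, b, hj.1, hj.2, hba⟩
  · intro n a j b ha hap hj hb hba
    exact hp.negJump _ a b (hpre ha) hap (get_mem (get_take.2 ⟨hj, hb⟩)) hba

theorem close_core {ξ : Address} {pos : Bool} {p : List Action} (hp : IsPath (simpleBase ξ pos) p)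
    (he : ∀ a, p.getLast? = some a → a.isPositive = true) :
    ∃ u, u <+: p ∧ (∀ a ∈ u, a ≠ .daimon) ∧ p = close pos u := by
  have key : ∀ w, w ++ [Action.daimon] <+: p → w ++ [Action.daimon] = p := hp.daimonLast
  have nd : ∀ w : List Action, w <+: p → w ≠ p → ∀ a ∈ w, a ≠ .daimon := by
    intro w hw hne a ha had
    subst had
    obtain ⟨w1, w2, rfl⟩ := List.append_of_mem ha
    have h1 : w1 ++ [Action.daimon] <+: w1 ++ Action.daimon :: w2 := ⟨w2, by simp⟩
    have h2 := key w1 (h1.trans hw)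
    rw [← h2] at hw
    have h3 := hw.eq_of_length_le (by simp)
    exact hne (h3.trans h2)
  rcases List.eq_nil_or_concat p with rfl | ⟨w, a, rfl⟩
  · refine ⟨[], List.nil_prefix, by simp, ?_⟩
    cases pos
    · rfl
    · obtain ⟨a, t, h, -⟩ := hp.totality (base_pos.2 rfl)
      simp at h
  · rw [List.concat_eq_append] at *
    have hwn := nd w (List.prefix_append _ _) (by simp)
    have hap : a.isPositive = true := he a (by simp)
    by_cases had : a = .daimon
    · subst had
      refine ⟨w, List.prefix_append _ _, hwn, ?_⟩
      rw [close, if_pos]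
      rcases List.eq_nil_or_concat w with rfl | ⟨w', b, rfl⟩
      · rw [turn_nil]; exact base_pos.1 (hp.daimonFirst rfl)
      · rw [List.concat_eq_append] at *
        rw [turn_snoc]
        have := isChain_iff_get.1 hp.alternating w'.length b .daimon (by simp) (by simp)
        simpa [Action.isPositive] using this
    · refine ⟨w ++ [a], List.prefix_rfl, ?_, ?_⟩
      · intro x hx
        rcases List.mem_append.1 hx with h | h
        · exact hwn x h
        · simp at h; rw [h]; exact had
      · rw [close, if_neg]
        rw [turn_snoc]; simp [hap]

theorem map_prefix_dualSeq {p u : List Action} (hu : u <+: p) (hn : ∀ a ∈ u, a ≠ .daimon) :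
    u.map Action.dual <+: dualSeq p := by
  rcases List.eq_nil_or_concat p with rfl | ⟨w, a, rfl⟩
  · simp at hu; subst hu; simp
  · rw [List.concat_eq_append] at *
    by_cases had : a = .daimon
    · subst had
      rw [dualSeq_snoc_daimon]
      rcases List.prefix_concat_iff.1 hu with rfl | h
      · exact absurd rfl (hn .daimon (by simp))
      · exact h.map _
    · rw [dualSeq, if_neg (by simpa using had)]
      exact (hu.map _).trans (List.prefix_append _ _)

theorem PG {ξ : Address} {pos pos' : Bool} {p : List Action} (hp : IsPath (simpleBase ξ pos) p)
    (hq : IsPath (simpleBase ξ pos') (dualSeq p)) : ∃ u, G ξ pos u ∧ p = close pos u := by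
  have he : ∀ a, p.getLast? = some a → a.isPositive = true := by
    intro a ha
    by_contra hap
    simp at hap
    have had := neg_ne_daimon hap
    rw [List.getLast?_eq_some_iff] at ha
    obtain ⟨w, rfl⟩ := ha
    rw [dualSeq, if_neg (by simpa using had)] at hq
    have := isChain_iff_get.1 hq.alternating w.length a.dual .daimon (by simp) (by simp)
    rw [dual_pos had, hap] at this
    exact this rfl
  obtain ⟨u, hu, hn, e⟩ := close_core hp he
  refine ⟨u, G_of_path hp hu hn ?_, e⟩
  intro n a j b ha hap hj hb hba
  have h1 : (u.map Action.dual)[n]? = some a.dual := get_map_dual.2 (by simpa using ha)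
  have h2 := (pre_of_get h1).trans (map_prefix_dualSeq hu hn)
  have := hq.negJump _ a.dual b.dual h2 (by rw [dual_pos (neg_ne_daimon hap), hap]; rfl)
    (by rw [← List.map_take]; exact List.mem_map_of_mem (get_mem (get_take.2 ⟨hj, hb⟩))) (by simpa using hba)
  rw [← List.map_take] at this
  exact this

theorem dual_last_mem {u : List Action} {b : Action} (h : u.getLast? = some b) : b.dual ∈ dview u := by
  rw [List.getLast?_eq_some_iff] at h
  obtain ⟨w, rfl⟩ := h
  rw [dview, List.map_append]
  exact mem_view_last _ _

theorem chron_G {ξ : Address} {pos : Bool} {c : List Action} (hc : IsChronicle (simpleBase ξ pos) c)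
    {u : List Action} (hu : u <+: c) (hn : ∀ a ∈ u, a ≠ .daimon) : G ξ pos u := by
  obtain ⟨hp, h0, hj⟩ := hc
  have hl := path_lin hp hu hn
  refine G_of_path hp hu hn ?_
  intro n a j b ha hap hjn hb hba
  have hpre : ∀ {n : ℕ} {a : Action}, u[n]? = some a → u.take n ++ [a] <+: c := fun h => (pre_of_get h).trans hu
  obtain ⟨m, rfl⟩ : ∃ m, n = m + 1 := ⟨n-1, by omega⟩
  have hm : ∃ x : Action, u[m]? = some x := by
    have := get_lt ha
    exact ⟨u[m]'(by omega), List.getElem?_eq_getElem _⟩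
  obtain ⟨x, hx⟩ := hm
  have hxa : x.justifies a := by
    have h1 := hpre ha
    rw [take_snoc hx] at h1
    rcases hj (u.take m) x a (by simpa using h1) hap with h | h
    · exfalso
      -- initial at position > 0
      have h2 := (initial_iff.1 h).2
      have : ∃ x : Action, u[0]? = some x := by
        have := get_lt ha
        exact ⟨u[0]'(by omega), List.getElem?_eq_getElem _⟩
      obtain ⟨y, hy⟩ := this
      rcases hp.justified _ y (hpre hy) (hn y (get_mem hy)) with h3 | ⟨b, hb, -⟩
      · have := hl 0 (m+1) y a hy ha (by rw [(initial_iff.1 h3).2, h2])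
        omega
      · simp at hb
    · exact h
  have := hl m j x b hx hb (justifies_focus hxa hba)
  subst this
  rw [hx] at hb
  cases hb
  apply dual_last_mem
  rw [take_snoc hx]; simp

theorem chron_close {ξ : Address} {pos : Bool} {c : List Action} (hc : IsChronicle (simpleBase ξ pos) c)
    (he : ∃ a, c.getLast? = some a ∧ a.isPositive = true) : ∃ u, G ξ pos u ∧ c = close pos u := by
  obtain ⟨a, ha, hap⟩ := he
  obtain ⟨u, hu, hn, e⟩ := close_core hc.1 (by rw [ha]; rintro _ ⟨⟩; exact hap)
  exact ⟨u, chron_G hc hu hn, e⟩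

theorem G.isPath_dual {ξ : Address} {pos : Bool} {u : List Action} (h : G ξ pos u) :
    IsPath (simpleBase ξ (!pos)) (dualSeq (close pos u)) := by
  rw [dualSeq_close h.nod]; exact h.dual.isPath

theorem dualSeq_dualSeq {pos : Bool} {u : List Action} (h : ∀ a ∈ u, a ≠ .daimon) :
    dualSeq (dualSeq (close pos u)) = close pos u := by
  rw [dualSeq_close h, dualSeq_close]
  · rw [map_dual_dual, Bool.not_not]
  · intro a ha
    obtain ⟨b, hb, rfl⟩ := List.mem_map.1 ha
    simpa using h b hb



@[simp] theorem dual_comp_dual : Action.dual ∘ Action.dual = id := by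
  funext a; simp

theorem compare (l1 l2 : List Action) : l1 <+: l2 ∨ l2 <+: l1 ∨
    ∃ w x y, w ++ [x] <+: l1 ∧ w ++ [y] <+: l2 ∧ x ≠ y := by
  induction l1 generalizing l2 with
  | nil => left; exact List.nil_prefix
  | cons a l1 ih =>
    cases l2 with
    | nil => right; left; exact List.nil_prefix
    | cons b l2 =>
      by_cases hab : a = b
      · subst hab
        rcases ih l2 with h | h | ⟨w, x, y, h1, h2, h3⟩
        · left; simpa using h
        · right; left; simpa using h
        · right; right
          exact ⟨a :: w, x, y, by simpa using h1, by simpa using h2, h3⟩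
      · right; right
        exact ⟨[], a, b, by simp, by simp, hab⟩

theorem view_snoc_last (w : List Action) (a : Action) : (view (w ++ [a])).getLast? = some a := by
  obtain ⟨w', -, h⟩ := view_shape w a
  rw [h]; simp

theorem prefix_snoc_ne {w l : List Action} {x a : Action} (h : w ++ [x] <+: l ++ [a]) (hx : x ≠ a) :
    ∃ w1, l ++ [a] = w ++ x :: w1 ++ [a] ∧ x ∈ l := by
  rcases List.prefix_concat_iff.1 h with h | ⟨t, rfl⟩
  · exact absurd (List.append_inj' h rfl).2 (by simpa using hx)
  · exact ⟨t, by simp, by simp⟩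

theorem nod_view {u : List Action} (h : ∀ a ∈ u, a ≠ .daimon) : ∀ a ∈ view u, a ≠ .daimon :=
  fun a ha => h a (view_subset u a ha)

theorem G.last_alt {ξ : Address} {pos : Bool} {l : List Action} {x a : Action} (h : G ξ pos (l ++ [a]))
    (hx : l.getLast? = some x) : x.isPositive ≠ a.isPositive := by
  rw [List.getLast?_eq_some_iff] at hx
  obtain ⟨w, rfl⟩ := hx
  exact h.alt w.length x a (by simp) (by simp)

theorem G.last_fresh {ξ : Address} {pos : Bool} {l : List Action} {x a : Action} (h : G ξ pos (l ++ [a]))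
    (hx : x ∈ l) : x.focus? ≠ a.focus? := by
  intro e
  obtain ⟨j, hj⟩ := List.mem_iff_getElem?.1 hx
  have := h.lin j l.length x a (get_snoc.2 (Or.inl hj)) (by simp) e
  have := get_lt hj
  omega

theorem G.last_just {ξ : Address} {pos : Bool} {l : List Action} {a : Action} (h : G ξ pos (l ++ [a]))
    (hl : l ≠ []) : ∃ b ∈ l, b.justifies a := by
  obtain ⟨j, b, hj, hb, hba⟩ := h.just l.length a (by simp) (List.length_pos_iff.2 hl)
  rcases get_snoc.1 hb with h | ⟨h, -⟩
  · exact ⟨b, get_mem h, hba⟩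
  · omega

theorem T_step {ξ : Address} {pos : Bool} {D E : Set (List Action)} (hD : IsDesign (simpleBase ξ pos) D)
    (hE : IsDesign (simpleBase ξ (!pos)) E) {u : List Action} {a : Action} (hu : u ≠ [])
    (ha : a ≠ .daimon) (hap : a.isPositive = true) (hG : G ξ pos u) (hP : Pol u)
    (hv : ∀ q, q <+: u ++ [a] → q ≠ [] → view q ∈ D) (hv' : dview (u ++ [a]) ∈ E) :
    G ξ pos (u ++ [a]) ∧ Pol (u ++ [a]) := by
  have hc : view u ++ [a] ∈ D := by rw [← view_pos hap]; exact hv _ List.prefix_rfl (by simp)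
  have hvu : view u ≠ [] := fun h => hu (view_eq_nil h)
  have nd : ∀ x ∈ u ++ [a], x ≠ .daimon := by
    intro x hx
    rcases List.mem_append.1 hx with h | h
    · exact hG.nod x h
    · simp at h; rw [h]; exact ha
  have Gc : G ξ pos (view u ++ [a]) := by
    refine chron_G (hD.chron _ hc) List.prefix_rfl ?_
    rw [← view_pos hap]; exact nod_view nd
  obtain ⟨b, hb, hba⟩ := Gc.last_just hvu
  have hbu := view_subset u b hb
  have ub : ∀ b' ∈ u, b'.justifies a → b' = b := fun b' hb' h =>
    hG.linm hb' hbu (justifies_focus h hba)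
  obtain ⟨w0, y, hy⟩ : ∃ w0 y, u = w0 ++ [y] := by
    rcases List.eq_nil_or_concat u with rfl | ⟨w, a, rfl⟩
    · exact absurd rfl hu
    · exact ⟨w, a, List.concat_eq_append⟩
  have hlast : (view u).getLast? = some y := by rw [hy]; exact view_snoc_last _ _
  have hbn : b.isPositive = false := by
    obtain ⟨j, hj⟩ := List.mem_iff_getElem?.1 hbu
    obtain ⟨w2, e, h2⟩ := split_at (get_lt hj) hj
    rw [List.take_length] at e
    have e2 : dview (u ++ [a]) = view ((u.take j).map Action.dual ++ [b.dual]) ++ [a.dual] := by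
      have e3 : (u ++ [a]).map Action.dual = ((u.take j ++ b :: w2) ++ [a]).map Action.dual := by rw [← e]
      rw [dview, e3]
      simp only [List.map_append, List.map_cons, List.map_nil]
      refine view_neg ?_ (by simpa using hba) ?_
      · rw [dual_pos ha, hap]; rfl
      · intro c hc hca
        obtain ⟨c', hc', rfl⟩ := List.mem_map.1 hc
        obtain ⟨i, hi, hi', hci⟩ := h2 c' hc'
        have hca' : c'.justifies a := by simpa using hca
        have := hG.lin i j c' b hci hj (justifies_focus hca' hba)
        omega
    have Gd : G ξ (!pos) (view ((u.take j).map Action.dual ++ [b.dual]) ++ [a.dual]) := by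
      rw [e2] at hv'
      refine chron_G (hE.chron _ hv') List.prefix_rfl ?_
      rw [← e2]
      apply nod_view
      intro x hx
      obtain ⟨x', hx', rfl⟩ := List.mem_map.1 hx
      simpa using nd x' hx'
    have := Gd.last_alt (view_snoc_last _ _)
    rw [dual_pos ha, dual_pos (hG.nod b hbu), hap] at this
    simpa using this
  have haf : a.focus? ≠ some ξ := fun h => Gc.not_just (List.mem_append_left _ hb) h hba
  have fresh : ∀ a' ∈ u, a'.focus? ≠ a.focus? := by
    intro a' ha' e
    obtain ⟨i, hi⟩ := List.mem_iff_getElem?.1 ha'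
    have hil := get_lt hi
    rcases Nat.eq_zero_or_pos i with rfl | hi0
    · exact haf (by rw [← e]; exact (hG.head a' hi).2)
    obtain ⟨j, b', hj, hb', hba'⟩ := hG.just i a' hi hi0
    have hbb : b' = b := hG.linm (get_mem hb') hbu (justifies_focus' hba' hba e)
    subst hbb
    have hap' : a'.isPositive = true := by
      have := hP a' ha' b' (get_mem hb') hba'
      rw [hbn] at this; simpa using this
    have hc1 : view (u.take i) ++ [a'] ∈ D := by
      rw [← view_pos' hi hap']
      refine hv _ ((List.take_prefix _ _).trans (List.prefix_append _ _)) ?_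
      intro h
      have := congrArg List.length h
      rw [List.length_take, List.length_nil] at this; omega
    have Gc1 : G ξ pos (view (u.take i) ++ [a']) := by
      refine chron_G (hD.chron _ hc1) List.prefix_rfl ?_
      rw [← view_pos' hi hap']; exact nod_view (fun x hx => hG.nod x (List.mem_of_mem_take hx))
    rcases compare (view (u.take i) ++ [a']) (view u ++ [a]) with h | h | ⟨w, x, y', h1, h2, h3⟩
    · rcases List.prefix_concat_iff.1 h with h | h
      · have h1 : view (u.take i) = view u := (List.append_inj' h rfl).1
        obtain ⟨m, rfl⟩ : ∃ m, i = m + 1 := ⟨i-1, by omega⟩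
        have hx : u[m]? = some (u[m]'(by omega)) := List.getElem?_eq_getElem _
        rw [take_snoc hx] at h1
        have h2 := view_snoc_last (u.take m) (u[m]'(by omega))
        rw [h1, hlast] at h2
        have h3 : y = u[m]'(by omega) := Option.some.inj h2
        have h4 : u[w0.length]? = some y := by rw [hy]; simp
        have := hG.lin m w0.length _ y hx h4 (by rw [h3])
        rw [hy] at hil; simp at hil; omega
      · exact Gc.last_fresh (h.subset (by simp)) e
    · rcases List.prefix_concat_iff.1 h with h | h
      · have h1 : view u = view (u.take i) := (List.append_inj' h rfl).1
        obtain ⟨m, rfl⟩ : ∃ m, i = m + 1 := ⟨i-1, by omega⟩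
        have hx : u[m]? = some (u[m]'(by omega)) := List.getElem?_eq_getElem _
        rw [take_snoc hx] at h1
        have h2 := view_snoc_last (u.take m) (u[m]'(by omega))
        rw [← h1, hlast] at h2
        have h3 : y = u[m]'(by omega) := Option.some.inj h2
        have h4 : u[w0.length]? = some y := by rw [hy]; simp
        have := hG.lin m w0.length _ y hx h4 (by rw [h3])
        rw [hy] at hil; simp at hil; omega
      · exact Gc1.last_fresh (h.subset (by simp : a ∈ view u ++ [a])) e.symm
    · obtain ⟨hco1, hco2⟩ := hD.coherent _ hc1 _ hc
      rcases hco1 w x y' h1 h2 with h | ⟨hx, hy'⟩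
      · exact h3 h
      obtain ⟨w1, e1, hx1⟩ := prefix_snoc_ne h1 (by rintro rfl; rw [hap'] at hx; simp at hx)
      obtain ⟨w2, e2, hy1⟩ := prefix_snoc_ne h2 (by rintro rfl; rw [hap] at hy'; simp at hy')
      have hxu : x ∈ u := List.mem_of_mem_take (view_subset _ _ hx1)
      have hyu : y' ∈ u := view_subset _ _ hy1
      have hfx : x.focus? ≠ y'.focus? := fun h => h3 (hG.linm hxu hyu h)
      cases x with
      | daimon => simp [Action.isPositive] at hx
      | proper px ξ1 I1 =>
      cases y' with
      | daimon => simp [Action.isPositive] at hy'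
      | proper py ξ2 I2 =>
        simp only [Action.isPositive] at hx hy'
        subst hx; subst hy'
        obtain ⟨l, hl⟩ := Gc.foc_mem (a := a) (by simp)
        refine hco2 w ξ1 I1 w1 a' ξ2 I2 w2 a ?_ ?_ ?_ _ (e.trans hl) hl
        · rw [e1]
        · rw [e2]
        · simpa [Action.focus?] using hfx
  constructor
  · refine hG.snoc ha (fun h => absurd h hu) (fun _ => ⟨b, hbu, hba⟩) ?_ fresh ?_ ?_
    · intro x hx
      rw [hy] at hx
      simp at hx
      subst hx
      exact Gc.last_alt hlast
    · intro _ b' hb' h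
      rw [ub b' hb' h]; exact hb
    · intro h; rw [hap] at h; simp at h
  · intro x hx z hz hzx
    rcases List.mem_append.1 hx with hxu | hx <;> rcases List.mem_append.1 hz with hzu | hz
    · exact hP x hxu z hzu hzx
    · exfalso
      simp at hz; subst hz
      obtain ⟨i, hi⟩ := List.mem_iff_getElem?.1 hxu
      rcases Nat.eq_zero_or_pos i with rfl | hi0
      · exact Gc.not_just (by simp) (hG.head x hi).2 hzx
      · obtain ⟨j, b', hj, hb', hba'⟩ := hG.just i x hi hi0
        exact fresh b' (get_mem hb') (justifies_focus hba' hzx)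
    · simp at hx; subst hx
      rw [ub z hzu hzx, hbn, hap]; simp
    · simp at hx hz; subst hx; subst hz
      exact absurd rfl (justifies_ne_focus hzx)

theorem T {ξ : Address} {pos : Bool} {D E : Set (List Action)} (hD : IsDesign (simpleBase ξ pos) D)
    (hE : IsDesign (simpleBase ξ (!pos)) E) {u : List Action} (nd : ∀ a ∈ u, a ≠ .daimon)
    (hv : ∀ q, q <+: u → q ≠ [] → view q ∈ D) (hv' : ∀ q, q <+: u → q ≠ [] → dview q ∈ E) :
    G ξ pos u ∧ Pol u := by
  induction u using List.reverseRecOn with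
  | nil => exact ⟨G.nil, by intro a ha; simp at ha⟩
  | append_singleton u a ih =>
    have hpre : u <+: u ++ [a] := List.prefix_append _ _
    obtain ⟨hG, hP⟩ := ih (fun x hx => nd x (by simp [hx])) (fun q hq => hv q (hq.trans hpre))
      (fun q hq => hv' q (hq.trans hpre))
    have ha : a ≠ .daimon := nd a (by simp)
    by_cases hu : u = []
    · subst hu
      constructor
      · have h1 := hv [a] List.prefix_rfl (by simp)
        have e : view [a] = [a] := by
          obtain ⟨w', h, e⟩ := view_shape [] a
          simp at h; subst h; exact e
        rw [e] at h1
        exact chron_G (hD.chron _ h1) List.prefix_rfl nd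
      · intro x hx z hz h
        simp at hx hz; subst hx; subst hz
        exact absurd rfl (justifies_ne_focus h)
    · cases hap : a.isPositive with
      | true => exact T_step hD hE hu ha hap hG hP hv (hv' _ List.prefix_rfl (by simp))
      | false =>
        have := T_step (pos := !pos) (u := u.map Action.dual) (a := a.dual) hE (by simpa using hD) (by simpa using hu)
          (by simpa using ha) (by rw [dual_pos ha, hap]; rfl) hG.dual hP.dual ?_ ?_
        · obtain ⟨h1, h2⟩ := this
          have h1 := h1.dual
          have h2 := h2.dual
          simp only [List.map_append, map_dual_dual, List.map_cons, List.map_nil, dual_dual, Bool.not_not] at h1 h2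
          exact ⟨h1, h2⟩
        · intro q hq hq0
          have := hv' (q.map Action.dual) (by simpa using hq.map Action.dual) (by simpa using hq0)
          simpa [dview] using this
        · have := hv (u ++ [a]) List.prefix_rfl (by simp)
          simpa [dview] using this



/-- `u` is the daimon-free trace of the interaction of `D` and `E`. -/
structure Run (pos : Bool) (D E : Set (List Action)) (u : List Action) : Prop where
  nod : ∀ a ∈ u, a ≠ .daimon
  vD : ∀ q, q <+: u → q ≠ [] → view q ∈ D
  vE : ∀ q, q <+: u → q ≠ [] → dview q ∈ E
  dD : turn pos u = true → view u ++ [.daimon] ∈ D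
  dE : turn pos u = false → dview u ++ [.daimon] ∈ E

theorem nod_dual {u : List Action} (h : ∀ a ∈ u, a ≠ .daimon) : ∀ a ∈ u.map Action.dual, a ≠ .daimon := by
  intro a ha
  obtain ⟨b, hb, rfl⟩ := List.mem_map.1 ha
  simpa using h b hb

theorem Run.symm {pos : Bool} {D E : Set (List Action)} {u : List Action} (h : Run pos D E u) :
    Run (!pos) E D (u.map Action.dual) where
  nod := nod_dual h.nod
  vD q hq h0 := by
    have := h.vE (q.map Action.dual) (by simpa using hq.map Action.dual) (by simpa using h0)
    simpa [dview] using this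
  vE q hq h0 := h.vD (q.map Action.dual) (by simpa using hq.map Action.dual) (by simpa using h0)
  dD ht := by
    rw [turn_dual h.nod] at ht
    exact h.dE (by simpa using ht)
  dE ht := by
    rw [turn_dual h.nod] at ht
    have := h.dD (by simpa using ht)
    simpa [dview] using this

theorem Run.symm' {pos : Bool} {D E : Set (List Action)} {u : List Action} (h : Run (!pos) D E u) :
    Run pos E D (u.map Action.dual) := by
  have := h.symm
  rwa [Bool.not_not] at this

theorem Run.G {ξ : Address} {pos : Bool} {D E : Set (List Action)} {u : List Action} (h : Run pos D E u)
    (hD : IsDesign (simpleBase ξ pos) D) (hE : IsDesign (simpleBase ξ (!pos)) E) : G ξ pos u :=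
  (T hD hE h.nod h.vD h.vE).1

theorem Run.Pol {ξ : Address} {pos : Bool} {D E : Set (List Action)} {u : List Action} (h : Run pos D E u)
    (hD : IsDesign (simpleBase ξ pos) D) (hE : IsDesign (simpleBase ξ (!pos)) E) : Pol u :=
  (T hD hE h.nod h.vD h.vE).2

theorem view_snoc_dai (u : List Action) : view (u ++ [.daimon]) = view u ++ [.daimon] := view_pos rfl

theorem Run.pathOf {ξ : Address} {pos : Bool} {D E : Set (List Action)} {u : List Action} (h : Run pos D E u)
    (hG : Ludics.G ξ pos u) : PathOf (simpleBase ξ pos) D (close pos u) := by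
  refine ⟨hG.isPath, ?_⟩
  intro q hq h0
  rcases prefix_close hq with h1 | ⟨h1, rfl⟩
  · exact h.vD q h1 h0
  · rw [view_snoc_dai]; exact h.dD h1

theorem run_iff {ξ : Address} {pos : Bool} {D E : Set (List Action)} {p : List Action}
    (hD : IsDesign (simpleBase ξ pos) D) (hE : IsDesign (simpleBase ξ (!pos)) E) :
    (PathOf (simpleBase ξ pos) D p ∧ PathOf (simpleBase ξ (!pos)) E (dualSeq p)) ↔
    ∃ u, Run pos D E u ∧ p = close pos u := by
  constructor
  · rintro ⟨⟨h1, h2⟩, h3, h4⟩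
    obtain ⟨u, hG, rfl⟩ := PG h1 h3
    refine ⟨u, ⟨hG.nod, ?_, ?_, ?_, ?_⟩, rfl⟩
    · exact fun q hq h0 => h2 q (hq.trans u_prefix_close) h0
    · intro q hq h0
      rw [dualSeq_close hG.nod] at h4
      exact h4 _ ((hq.map _).trans u_prefix_close) (by simpa using h0)
    · intro ht
      rw [← view_snoc_dai]
      exact h2 _ (by rw [close, if_pos ht]) (by simp)
    · intro ht
      rw [dview, ← view_snoc_dai]
      refine h4 _ ?_ (by simp)
      rw [dualSeq_close hG.nod, close, turn_dual hG.nod, if_pos (by simp [ht])]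
  · rintro ⟨u, h, rfl⟩
    have hG := h.G hD hE
    refine ⟨h.pathOf hG, ?_⟩
    rw [dualSeq_close hG.nod]
    exact h.symm.pathOf hG.dual

theorem G.turn {ξ : Address} {pos : Bool} {u w : List Action} {a : Action} (h : G ξ pos u) (hw : w ++ [a] <+: u) :
    turn pos w = a.isPositive := by
  obtain ⟨h1, h2⟩ := get_of_pre hw
  rcases List.eq_nil_or_concat w with rfl | ⟨w', b, rfl⟩
  · rw [turn_nil]; exact (h.head a h2).1.symm
  · rw [List.concat_eq_append] at *
    rw [turn_snoc]
    have : u[w'.length]? = some b := by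
      obtain ⟨t, rfl⟩ := hw
      simp
    have := h.alt w'.length b a this (by simpa using h2)
    revert this; generalize b.isPositive = x; generalize a.isPositive = y; revert x y; decide

theorem turnD_iff {s : List Action} : TurnD True s ↔ turn true s = true := by
  unfold TurnD turn
  cases s.getLast? <;> simp

theorem conv_iff {ξ : Address} {D E : Set (List Action)}
    (hD : IsDesign (simpleBase ξ true) D) (hE : IsDesign (simpleBase ξ false) E) :
    Conv D E True [] ↔ ∃ u, Run true D E u := by
  constructor
  · intro h
    have key : ∀ s, Conv D E True s → (∀ a ∈ s, a ≠ .daimon) → (∀ q, q <+: s → q ≠ [] → view q ∈ D) →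
        (∀ q, q <+: s → q ≠ [] → dview q ∈ E) → ∃ u, Run true D E u := by
      intro s hs
      induction hs with
      | @daiD s ht hv =>
        intro h1 h2 h3
        rw [turnD_iff] at ht
        refine ⟨s, h1, h2, h3, fun _ => ?_, fun h => ?_⟩
        · rw [← view_snoc_dai]; exact hv
        · rw [ht] at h; simp at h
      | @daiR s ht hv =>
        intro h1 h2 h3
        rw [turnD_iff] at ht
        refine ⟨s, h1, h2, h3, fun h => absurd h ht, fun _ => ?_⟩
        rw [dview, ← view_snoc_dai]; exact hv
      | @stepD s κ ht hp hd hv hv' _ ih =>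
        intro h1 h2 h3
        refine ih ?_ ?_ ?_
        · intro a ha
          rcases List.mem_append.1 ha with h | h
          · exact h1 a h
          · simp at h; rw [h]; exact hd
        · intro q hq h0
          rcases List.prefix_concat_iff.1 hq with rfl | h
          · exact hv
          · exact h2 q h h0
        · intro q hq h0
          rcases List.prefix_concat_iff.1 hq with rfl | h
          · exact hv'
          · exact h3 q h h0
      | @stepR s κ ht hp hv' hv _ ih =>
        intro h1 h2 h3
        refine ih ?_ ?_ ?_
        · intro a ha
          rcases List.mem_append.1 ha with h | h
          · exact h1 a h
          · simp at h; rw [h]; exact neg_ne_daimon hp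
        · intro q hq h0
          rcases List.prefix_concat_iff.1 hq with rfl | h
          · exact hv
          · exact h2 q h h0
        · intro q hq h0
          rcases List.prefix_concat_iff.1 hq with rfl | h
          · exact hv'
          · exact h3 q h h0
    exact key [] h (by simp) (by intro q hq h0; simp at hq; exact absurd hq h0)
      (by intro q hq h0; simp at hq; exact absurd hq h0)
  · rintro ⟨u, h⟩
    have hG := h.G hD hE
    have key : ∀ t s, s ++ t = u → Conv D E True s := by
      intro t
      induction t with
      | nil =>
        intro s hs
        simp at hs; subst hs
        by_cases ht : turn true s = true
        · exact Conv.daiD (turnD_iff.2 ht) (by rw [view_snoc_dai]; exact h.dD ht)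
        · exact Conv.daiR (fun h => ht (turnD_iff.1 h)) (by rw [view_snoc_dai]; exact h.dE (by simpa using ht))
      | cons κ t ih =>
        intro s hs
        have hpre : s ++ [κ] <+: u := ⟨t, by simpa using hs⟩
        have ht := hG.turn hpre
        have hc := ih (s ++ [κ]) (by simpa using hs)
        have h1 := h.vD _ hpre (by simp)
        have h2 := h.vE _ hpre (by simp)
        cases hp : κ.isPositive with
        | true =>
          exact Conv.stepD (turnD_iff.2 (ht.trans hp)) hp (h.nod _ (hpre.subset (by simp))) h1 h2 hc
        | false =>
          exact Conv.stepR (fun h => by rw [turnD_iff, ht, hp] at h; simp at h) hp h2 h1 hc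
    exact key u [] rfl

theorem orth_iff {ξ : Address} {pos : Bool} {D E : Set (List Action)}
    (hD : IsDesign (simpleBase ξ pos) D) (hE : IsDesign (simpleBase ξ (!pos)) E) :
    (if pos then Conv D E True [] else Conv E D True []) ↔ ∃ u, Run pos D E u := by
  cases pos with
  | true => simpa using conv_iff hD hE
  | false =>
    have := conv_iff hE hD
    simp only [Bool.false_eq_true, if_false]
    rw [this]
    exact ⟨fun ⟨u, h⟩ => ⟨_, h.symm⟩, fun ⟨u, h⟩ => ⟨_, h.symm⟩⟩

theorem design_det {β : Base} {D : Set (List Action)} (hD : IsDesign β D) {c : List Action} {x y : Action}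
    (hx : c ++ [x] ∈ D) (hy : c ++ [y] ∈ D) (hp : x.isPositive = true) : x = y := by
  rcases (hD.coherent _ hx _ hy).1 c x y List.prefix_rfl List.prefix_rfl with h | ⟨h, -⟩
  · exact h
  · rw [hp] at h; simp at h

theorem Run.ext1 {ξ : Address} {pos : Bool} {D E : Set (List Action)} {u u' : List Action} {a : Action}
    (hD : IsDesign (simpleBase ξ pos) D) (hE : IsDesign (simpleBase ξ (!pos)) E)
    (h : Run pos D E u) (h' : Run pos D E u') (ht : Ludics.turn pos u = true) (hp : u ++ [a] <+: u') : False := by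
  have h1 := (h'.G hD hE).turn hp
  have h2 := h'.vD _ hp (by simp)
  rw [view_pos (by rw [← h1, ht])] at h2
  have h3 := design_det hD (h.dD ht) h2 rfl
  exact h'.nod a (hp.subset (by simp)) h3.symm

theorem Run.ext2 {ξ : Address} {pos : Bool} {D E : Set (List Action)} {u u' : List Action} {a : Action}
    (hD : IsDesign (simpleBase ξ pos) D) (hE : IsDesign (simpleBase ξ (!pos)) E)
    (h : Run pos D E u) (h' : Run pos D E u') (hp : u ++ [a] <+: u') : False := by
  cases ht : Ludics.turn pos u with
  | true => exact h.ext1 hD hE h' ht hp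
  | false =>
    refine h.symm.ext1 hE (by simpa using hD) h'.symm (a := a.dual) ?_ (by simpa using hp.map Action.dual)
    rw [turn_dual h.nod, ht]; rfl

theorem Run.div1 {ξ : Address} {pos : Bool} {D E : Set (List Action)} {u u' w : List Action} {a b : Action}
    (hD : IsDesign (simpleBase ξ pos) D) (hE : IsDesign (simpleBase ξ (!pos)) E)
    (h : Run pos D E u) (h' : Run pos D E u') (hp : w ++ [a] <+: u) (hp' : w ++ [b] <+: u')
    (ht : Ludics.turn pos w = true) : a = b := by
  have h1 := (h.G hD hE).turn hp
  have h1' := (h'.G hD hE).turn hp'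
  have h2 := h.vD _ hp (by simp)
  have h2' := h'.vD _ hp' (by simp)
  rw [view_pos (by rw [← h1, ht])] at h2
  rw [view_pos (by rw [← h1', ht])] at h2'
  exact design_det hD h2 h2' (by rw [← h1, ht])

theorem Run.det {ξ : Address} {pos : Bool} {D E : Set (List Action)} {u u' : List Action}
    (hD : IsDesign (simpleBase ξ pos) D) (hE : IsDesign (simpleBase ξ (!pos)) E)
    (h : Run pos D E u) (h' : Run pos D E u') : u = u' := by
  rcases compare u u' with ⟨t, ht⟩ | ⟨t, ht⟩ | ⟨w, x, y, h1, h2, h3⟩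
  · cases t with
    | nil => simpa using ht
    | cons a t => exact (h.ext2 hD hE h' (a := a) ⟨t, by simpa using ht⟩).elim
  · cases t with
    | nil => simpa using ht.symm
    | cons a t => exact (h'.ext2 hD hE h (a := a) ⟨t, by simpa using ht⟩).elim
  · exfalso
    cases ht : Ludics.turn pos w with
    | true => exact h3 (h.div1 hD hE h' h1 h2 ht)
    | false =>
      have := h.symm.div1 hE (by simpa using hD) h'.symm (w := w.map Action.dual) (a := x.dual) (b := y.dual)
        (by simpa using h1.map Action.dual) (by simpa using h2.map Action.dual)
        (by rw [turn_dual (fun a ha => h.nod a (h1.subset (by simp [ha]))), ht]; rfl)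
      exact h3 (dual_inj this)



theorem IsPath.pre {β : Base} {p q : List Action} (h : IsPath β p) (hq : q <+: p) (h0 : q ≠ []) : IsPath β q where
  alternating := List.IsChain.prefix h.alternating hq
  justified w a hw := h.justified w a (hw.trans hq)
  negJump w a b hw := h.negJump w a b (hw.trans hq)
  posJump w a hw := h.posJump w a (hw.trans hq)
  linearity := by
    obtain ⟨t, rfl⟩ := hq
    have := h.linearity
    rw [List.filterMap_append] at this
    exact this.of_append_left
  daimonLast w hw := by
    have := h.daimonLast w (hw.trans hq)
    rw [← this] at hq
    exact hw.eq_of_length_le hq.length_le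
  daimonFirst hd := by
    apply h.daimonFirst
    obtain ⟨t, rfl⟩ := hq
    cases q with
    | nil => simp at hd
    | cons a q => simpa using hd
  totality hb := by
    obtain ⟨a, t, h1, h2⟩ := h.totality hb
    cases q with
    | nil => exact absurd rfl h0
    | cons x q =>
      obtain ⟨t', rfl⟩ := hq
      simp at h1
      exact ⟨x, q, rfl, by rw [h1.1]; exact h2⟩

theorem IsChronicle.pre {β : Base} {p q : List Action} (h : IsChronicle β p) (hq : q <+: p) (h0 : q ≠ []) :
    IsChronicle β q :=
  ⟨h.1.pre hq h0, h0, fun w a b hw => h.2.2 w a b (hw.trans hq)⟩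

structure Pair0 (ξ : Address) (pos : Bool) (A B : Set (Set (List Action))) : Prop where
  desA : ∀ D ∈ A, IsDesign (simpleBase ξ pos) D
  desB : ∀ D ∈ B, IsDesign (simpleBase ξ (!pos)) D
  memA : ∀ D, IsDesign (simpleBase ξ pos) D → (∀ E ∈ B, ∃ u, Run pos D E u) → D ∈ A
  memB : ∀ E, IsDesign (simpleBase ξ (!pos)) E → (∀ D ∈ A, ∃ u, Run pos D E u) → E ∈ B
  run : ∀ D ∈ A, ∀ E ∈ B, ∃ u, Run pos D E u

theorem Pair0.symm {ξ : Address} {pos : Bool} {A B : Set (Set (List Action))} (h : Pair0 ξ pos A B) :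
    Pair0 ξ (!pos) B A where
  desA := h.desB
  desB := by simpa using h.desA
  memA E hE hr := h.memB E hE fun D hD => by
    obtain ⟨u, hu⟩ := hr D hD
    exact ⟨_, hu.symm'⟩
  memB D hD hr := h.memA D (by simpa using hD) fun E hE => by
    obtain ⟨u, hu⟩ := hr E hE
    exact ⟨_, hu.symm'⟩
  run E hE D hD := by
    obtain ⟨u, hu⟩ := h.run D hD E hE
    exact ⟨_, hu.symm⟩

theorem pair_of {ξ : Address} {pos : Bool} (A : Behaviour ξ pos) (B : Behaviour ξ (!pos))
    (hB : B.designs = orthSet ξ pos A.designs) : Pair0 ξ pos A.designs B.designs := by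
  have hA : A.designs = orthSet ξ (!pos) B.designs := by rw [hB]; exact A.closed
  refine ⟨A.isDesign, B.isDesign, ?_, ?_, ?_⟩
  · intro D hD hr
    rw [hA]
    refine ⟨by simpa using hD, fun E hE => ?_⟩
    refine (orth_iff (pos := !pos) (B.isDesign E hE) (by simpa using hD)).2 ?_
    obtain ⟨u, hu⟩ := hr E hE
    exact ⟨_, hu.symm⟩
  · intro E hE hr
    rw [hB]
    refine ⟨hE, fun D hD => ?_⟩
    exact (orth_iff (A.isDesign D hD) hE).2 (hr D hD)
  · intro D hD E hE
    refine (orth_iff (A.isDesign D hD) (B.isDesign E hE)).1 ?_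
    rw [hB] at hE
    exact hE.2 D hD

def Vis (pos : Bool) (A B : Set (Set (List Action))) (u : List Action) : Prop :=
  ∃ D ∈ A, ∃ E ∈ B, Run pos D E u

theorem Vis.symm {pos : Bool} {A B : Set (Set (List Action))} {u : List Action} (h : Vis pos A B u) :
    Vis (!pos) B A (u.map Action.dual) := by
  obtain ⟨D, hD, E, hE, h⟩ := h
  exact ⟨E, hE, D, hD, h.symm⟩

theorem Vis.symm' {pos : Bool} {A B : Set (Set (List Action))} {u : List Action} (h : Vis (!pos) B A u) :
    Vis pos A B (u.map Action.dual) := by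
  have := h.symm
  rwa [Bool.not_not] at this

theorem visitable_iff {ξ : Address} {pos : Bool} (A : Behaviour ξ pos) {B : Set (Set (List Action))}
    (hB : B = orthSet ξ pos A.designs) (p : List Action) :
    Visitable A p ↔ ∃ u, Vis pos A.designs B u ∧ p = close pos u := by
  unfold Visitable VisitableSet Vis
  rw [← hB]
  have hE : ∀ E ∈ B, IsDesign (simpleBase ξ (!pos)) E := fun E h => by rw [hB] at h; exact h.1
  constructor
  · rintro ⟨D, hD, E, hE', h⟩
    obtain ⟨u, h1, h2⟩ := (run_iff (A.isDesign D hD) (hE E hE')).1 h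
    exact ⟨u, ⟨D, hD, E, hE', h1⟩, h2⟩
  · rintro ⟨u, ⟨D, hD, E, hE', h1⟩, h2⟩
    exact ⟨D, hD, E, hE', (run_iff (A.isDesign D hD) (hE E hE')).2 ⟨u, h1, h2⟩⟩

theorem close_inj {pos : Bool} {u v : List Action} (hu : ∀ a ∈ u, a ≠ .daimon) (hv : ∀ a ∈ v, a ≠ .daimon)
    (h : close pos u = close pos v) : u = v := by
  unfold close at h
  split at h <;> split at h
  · exact (List.append_inj' h rfl).1
  · exact absurd rfl (hv .daimon (by rw [← h]; simp))
  · exact absurd rfl (hu .daimon (by rw [h]; simp))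
  · exact h

/-! nonemptiness -/

theorem chron_of_G_dai {ξ : Address} {pos : Bool} : IsChronicle (simpleBase ξ true) [.daimon] := by
  refine ⟨?_, by simp, ?_⟩
  · have := (G.nil (ξ := ξ) (pos := true)).isPath
    exact this
  · intro w a b hw
    have := hw.length_le
    simp at this

theorem dai_design {ξ : Address} : IsDesign (simpleBase ξ true) DaiDesign where
  chron := by rintro c rfl; exact chron_of_G_dai (pos := true)
  prefixClosed := by
    rintro c rfl d hd h0
    rcases List.prefix_concat_iff (l₂ := []).1 hd with h | h
    · exact h
    · simp at h; exact absurd h h0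
  coherent := by
    rintro c rfl d rfl
    constructor
    · intro w a b ha hb
      left
      have h1 := ha.eq_of_length_le (by simp)
      have h2 := hb.eq_of_length_le (by simp)
      simpa using (List.append_inj' (h1.trans h2.symm) rfl).2
    · intro w _ _ w1 _ _ _ _ _ h
      have := h.length_le
      simp at this; omega
  maxPos := by rintro c rfl _; exact ⟨.daimon, rfl, rfl⟩
  posNonempty := fun _ => ⟨_, rfl⟩

def E0 (ξ : Address) : Set (List Action) :=
  {c | c ≠ [] ∧ ∃ I, c <+: [Action.proper false ξ I, .daimon]}

theorem E0_chron {ξ : Address} (I : Finset ℕ) : IsChronicle (simpleBase ξ false) [Action.proper false ξ I, .daimon] := by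
  refine ⟨?_, by simp, ?_⟩
  · have h : G ξ false ([] ++ [Action.proper false ξ I]) := by
      refine G.nil.snoc (by simp) (fun _ => ⟨rfl, rfl⟩) (fun h => absurd rfl h) ?_ ?_ ?_ ?_ <;> simp
    have := h.isPath
    simpa [close, turn, Action.isPositive] using this
  · intro w a b hw hb
    have := hw.eq_of_length_le (by simp)
    have := (List.append_inj' (s₁ := []) this.symm rfl).2
    simp at this
    rw [← this.2] at hb; simp [Action.isPositive] at hb

theorem E0_design {ξ : Address} : IsDesign (simpleBase ξ false) (E0 ξ) where
  chron := by rintro c ⟨h0, I, hc⟩; exact (E0_chron I).pre hc h0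
  prefixClosed := by rintro c ⟨h0, I, hc⟩ d hd h0; exact ⟨h0, I, hd.trans hc⟩
  coherent := by
    rintro c ⟨h0, I, hc⟩ d ⟨h0', J, hd⟩
    constructor
    · intro w a b ha hb
      have ha := ha.trans hc
      have hb := hb.trans hd
      rcases w with _ | ⟨x, _ | ⟨y, w⟩⟩
      · right
        simp at ha hb
        subst ha; subst hb; exact ⟨rfl, rfl⟩
      · left
        simp at ha hb
        rw [ha.2, hb.2]
      · have := ha.length_le
        simp at this
    · intro w x1 I1 w1 s1 x2 I2 w2 s2 h1 h2 hne
      exfalso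
      apply hne
      have h1 := h1.trans hc
      have h2 := h2.trans hd
      rcases w with _ | ⟨x, w⟩
      · simp at h1 h2
        rw [h1.1.1, h2.1.1]
      · have := h1.length_le
        simp at this; omega
  maxPos := by
    rintro c ⟨h0, I, hc⟩ hm
    rcases c with _ | ⟨x, _ | ⟨y, c⟩⟩
    · exact absurd rfl h0
    · exfalso
      simp at hc; subst hc
      exact hm .daimon ⟨by simp, I, by simp⟩
    · have := hc.eq_of_length_le (by simp)
      rw [this]
      exact ⟨.daimon, rfl, rfl⟩
  posNonempty := fun h => by rw [base_pos] at h; simp at h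

theorem view_single (a : Action) : view [a] = [a] := by
  obtain ⟨w', h, e⟩ := view_shape [] a
  simp at h; subst h; exact e

theorem Pair0.ne {ξ : Address} {A B : Set (Set (List Action))} (h : Pair0 ξ true A B) :
    A.Nonempty ∧ B.Nonempty := by
  constructor
  · refine ⟨DaiDesign, h.memA _ dai_design fun E hE => ⟨[], ?_⟩⟩
    refine ⟨by simp, ?_, ?_, ?_, ?_⟩
    · intro q hq h0; simp at hq; exact absurd hq h0
    · intro q hq h0; simp at hq; exact absurd hq h0
    · intro _; rfl
    · intro h; simp [turn] at h
  · refine ⟨E0 ξ, h.memB _ E0_design fun D hD => ?_⟩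
    have hD := h.desA D hD
    obtain ⟨c, hc⟩ := hD.posNonempty (base_pos.2 rfl)
    obtain ⟨a, t, rfl, ha⟩ := (hD.chron c hc).1.totality (base_pos.2 rfl)
    have ha1 : [a] ∈ D := hD.prefixClosed _ hc [a] (by simp) (by simp)
    rcases ha with rfl | ⟨-, ha⟩
    · refine ⟨[], by simp, ?_, ?_, ?_, ?_⟩
      · intro q hq h0; simp at hq; exact absurd hq h0
      · intro q hq h0; simp at hq; exact absurd hq h0
      · intro _; exact ha1
      · intro h; simp [turn] at h
    · obtain ⟨hp, hf⟩ := initial_iff.1 ha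
      cases a with
      | daimon => simp [Action.focus?] at hf
      | proper p x I =>
        simp [Action.focus?, Action.isPositive] at hp hf
        subst hp; subst hf
        have one : ∀ q, q <+: [Action.proper true x I] → q ≠ [] → q = [Action.proper true x I] := by
          intro q hq h0
          rcases List.prefix_concat_iff (l₂ := []).1 hq with h | h
          · exact h
          · simp at h; exact absurd h h0
        refine ⟨[Action.proper true x I], by simp, ?_, ?_, ?_, ?_⟩
        · intro q hq h0; rw [one q hq h0, view_single]; exact ha1
        · intro q hq h0; rw [one q hq h0, dview]
          simp only [List.map_cons, List.map_nil]
          rw [view_single]; exact ⟨by simp, I, by simp [Action.dual]⟩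
        · intro h; simp [turn, Action.isPositive] at h
        · intro _
          rw [dview]
          simp only [List.map_cons, List.map_nil]
          rw [view_single]; exact ⟨by simp, I, by simp [Action.dual]⟩

structure Pair (ξ : Address) (pos : Bool) (A B : Set (Set (List Action))) : Prop extends Pair0 ξ pos A B where
  neA : A.Nonempty
  neB : B.Nonempty

theorem Pair.symm {ξ : Address} {pos : Bool} {A B : Set (Set (List Action))} (h : Pair ξ pos A B) :
    Pair ξ (!pos) B A := ⟨h.toPair0.symm, h.neB, h.neA⟩

theorem Pair0.toPair {ξ : Address} {pos : Bool} {A B : Set (Set (List Action))} (h : Pair0 ξ pos A B) :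
    Pair ξ pos A B := by
  cases pos with
  | true => exact ⟨h, h.ne.1, h.ne.2⟩
  | false => exact ⟨h, h.symm.ne.2, h.symm.ne.1⟩

/-- the empty play is visitable -/
theorem Pair.vis_nil {ξ : Address} {pos : Bool} {A B : Set (Set (List Action))} (h : Pair ξ pos A B) :
    Vis pos A B [] := by
  have key : ∀ {A B : Set (Set (List Action))}, Pair ξ true A B → Vis true A B [] := by
    intro A B h
    obtain ⟨E, hE⟩ := h.neB
    refine ⟨DaiDesign, h.memA _ dai_design fun E hE => ⟨[], ?_⟩, E, hE, ?_⟩ <;>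
    · refine ⟨by simp, ?_, ?_, ?_, ?_⟩
      · intro q hq h0; simp at hq; exact absurd hq h0
      · intro q hq h0; simp at hq; exact absurd hq h0
      · intro _; rfl
      · intro h; simp [turn] at h
  cases pos with
  | true => exact key h
  | false => exact (key h.symm).symm

/-! incarnation -/

def inc (pos : Bool) (B : Set (Set (List Action))) (D : Set (List Action)) : Set (List Action) :=
  {c | ∃ E ∈ B, ∃ u, Run pos D E u ∧ ∃ q, q <+: close pos u ∧ q ≠ [] ∧ c = view q}

theorem close_next {ξ : Address} {pos : Bool} {u w : List Action} {a : Action} (h : G ξ pos u)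
    (hw : w ++ [a] <+: close pos u) (ha : a.isPositive = false) :
    ∃ x, x.isPositive = true ∧ w ++ [a] ++ [x] <+: close pos u := by
  rcases prefix_close hw with ⟨t, ht⟩ | ⟨-, h1⟩
  · cases t with
    | nil =>
      simp at ht
      refine ⟨.daimon, rfl, ?_⟩
      rw [close, if_pos, ht]
      rw [← ht, turn_snoc, ha]; rfl
    | cons x t =>
      have hp : w ++ [a] ++ [x] <+: u := ⟨t, by simpa using ht⟩
      refine ⟨x, ?_, hp.trans u_prefix_close⟩
      rw [← h.turn hp, turn_snoc, ha]; rfl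
  · have := (List.append_inj' h1 rfl).2
    simp at this; subst this; simp [Action.isPositive] at ha

section
variable {ξ : Address} {pos : Bool} {A B : Set (Set (List Action))}

theorem inc_sub (h : Pair ξ pos A B) {D : Set (List Action)} (hD : D ∈ A) : inc pos B D ⊆ D := by
  rintro c ⟨E, hE, u, hu, q, hq, h0, rfl⟩
  exact (hu.pathOf (hu.G (h.desA D hD) (h.desB E hE))).2 q hq h0

theorem inc_design (h : Pair ξ pos A B) {D : Set (List Action)} (hD : D ∈ A) :
    IsDesign (simpleBase ξ pos) (inc pos B D) where
  chron c hc := (h.desA D hD).chron c (inc_sub h hD hc)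
  prefixClosed := by
    rintro c ⟨E, hE, u, hu, q, hq, h0, rfl⟩ d hd hd0
    obtain ⟨q', hq', rfl⟩ := view_prefix q d hd
    refine ⟨E, hE, u, hu, q', hq'.trans hq, ?_, rfl⟩
    rintro rfl; exact hd0 rfl
  coherent c hc d hd := (h.desA D hD).coherent c (inc_sub h hD hc) d (inc_sub h hD hd)
  maxPos := by
    rintro c ⟨E, hE, u, hu, q, hq, h0, rfl⟩ hm
    rcases List.eq_nil_or_concat q with rfl | ⟨w, a, rfl⟩
    · exact absurd rfl h0
    rw [List.concat_eq_append] at *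
    refine ⟨a, view_snoc_last _ _, ?_⟩
    by_contra ha
    simp at ha
    obtain ⟨x, hx, hp⟩ := close_next (hu.G (h.desA D hD) (h.desB E hE)) hq ha
    refine hm x ⟨E, hE, u, hu, _, hp, by simp, ?_⟩
    rw [view_pos hx]
  posNonempty hb := by
    rw [base_pos] at hb; subst hb
    obtain ⟨E, hE⟩ := h.neB
    obtain ⟨u, hu⟩ := h.run D hD E hE
    refine ⟨_, E, hE, u, hu, _, List.prefix_rfl, ?_, rfl⟩
    unfold close
    split
    · simp
    · rintro rfl; simp [turn] at *

theorem inc_run (h : Pair ξ pos A B) {D E : Set (List Action)} (hE : E ∈ B) {u : List Action}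
    (hu : Run pos D E u) : Run pos (inc pos B D) E u where
  nod := hu.nod
  vD q hq h0 := ⟨E, hE, u, hu, q, hq.trans u_prefix_close, h0, rfl⟩
  vE := hu.vE
  dD ht := ⟨E, hE, u, hu, u ++ [.daimon], by rw [close, if_pos ht], by simp, (view_snoc_dai u).symm⟩
  dE := hu.dE

theorem inc_mem (h : Pair ξ pos A B) {D : Set (List Action)} (hD : D ∈ A) : inc pos B D ∈ A := by
  refine h.memA _ (inc_design h hD) fun E hE => ?_
  obtain ⟨u, hu⟩ := h.run D hD E hE
  exact ⟨u, inc_run h hE hu⟩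

theorem Run.mono {D D' E : Set (List Action)} {u : List Action} (h : Run pos D E u) (hD : D ⊆ D') : Run pos D' E u :=
  ⟨h.nod, fun q hq h0 => hD (h.vD q hq h0), h.vE, fun ht => hD (h.dD ht), h.dE⟩

/-- minimal designs -/
def Mat (A : Set (Set (List Action))) (D : Set (List Action)) : Prop :=
  D ∈ A ∧ ∀ E ∈ A, E ⊆ D → E = D

theorem inc_mat (h : Pair ξ pos A B) {D : Set (List Action)} (hD : D ∈ A) : Mat A (inc pos B D) := by
  refine ⟨inc_mem h hD, fun D' hD' hs => Set.Subset.antisymm hs ?_⟩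
  rintro c ⟨E, hE, u, hu, q, hq, h0, rfl⟩
  obtain ⟨u', hu'⟩ := h.run D' hD' E hE
  have := (hu'.mono (hs.trans (inc_sub h hD))).det (h.desA D hD) (h.desB E hE) hu
  subst this
  exact (hu'.pathOf (hu'.G (h.desA D' hD') (h.desB E hE))).2 q hq h0

theorem Mat.visited (h : Pair ξ pos A B) {D : Set (List Action)} (hD : Mat A D) {c : List Action} (hc : c ∈ D) :
    ∃ E ∈ B, ∃ u, Run pos D E u ∧ ∃ q, q <+: close pos u ∧ q ≠ [] ∧ c = view q := by
  have := hD.2 _ (inc_mem h hD.1) (inc_sub h hD.1)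
  rw [← this] at hc
  exact hc

theorem Vis.mat (h : Pair ξ pos A B) {u : List Action} (hu : Vis pos A B u) :
    ∃ D, Mat A D ∧ ∀ q, q <+: close pos u → q ≠ [] → view q ∈ D := by
  obtain ⟨D, hD, E, hE, hu⟩ := hu
  exact ⟨_, inc_mat h hD, fun q hq h0 => ⟨E, hE, u, hu, q, hq, h0, rfl⟩⟩

theorem Vis.G (h : Pair ξ pos A B) {u : List Action} (hu : Vis pos A B u) : Ludics.G ξ pos u ∧ Pol u := by
  obtain ⟨D, hD, E, hE, hu⟩ := hu
  exact ⟨hu.G (h.desA D hD) (h.desB E hE), hu.Pol (h.desA D hD) (h.desB E hE)⟩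
end



section
variable {ξ : Address} {pos : Bool}

theorem JustChain.mem {β : Base} {p s : List Action} (h : JustChain β p s) : ∀ x ∈ s, x ∈ p := by
  induction h with
  | init h _ => intro x hx; simp at hx; rw [hx]; exact h
  | cons _ h _ ih =>
    intro x hx
    simp at hx
    rcases hx with hx | rfl | rfl
    · exact ih x (by simp [hx])
    · exact ih x (by simp)
    · exact h

theorem JustChain.mono {β : Base} {p p' s : List Action} (h : JustChain β p s) (hm : ∀ x ∈ s, x ∈ p') :
    JustChain β p' s := by
  induction h with
  | init h hi => exact JustChain.init (hm _ (by simp)) hi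
  | cons _ h hj ih =>
    refine JustChain.cons (ih fun x hx => hm x ?_) (hm _ (by simp)) hj
    simp at hx ⊢; tauto

theorem JustChain.last {β : Base} {p s : List Action} (h : JustChain β p s) : ∃ s0 κ, s = s0 ++ [κ] := by
  cases h with
  | init => exact ⟨[], _, rfl⟩
  | @cons s κ κ' => exact ⟨s ++ [κ], κ', by simp⟩

theorem JustChain.foc {p s : List Action} (h : JustChain (simpleBase ξ pos) p s) :
    ∀ x ∈ s, ∃ l, x.focus? = some (ξ ++ l) := by
  induction h with
  | init h hi => intro x hx; simp at hx; rw [hx]; exact ⟨[], by rw [(initial_iff.1 hi).2]; simp⟩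
  | @cons s κ κ' _ h hj ih =>
    intro x hx
    simp at hx
    rcases hx with hx | rfl | rfl
    · exact ih x (by simp [hx])
    · exact ih x (by simp)
    · obtain ⟨l, hl⟩ := ih κ (by simp)
      obtain ⟨f, i, h1, h2, -⟩ := justifies_iff.1 hj
      rw [hl] at h1
      cases h1
      exact ⟨l ++ [i], by rw [h2]; simp⟩

theorem JustChain.nod {p s : List Action} (h : JustChain (simpleBase ξ pos) p s) :
    ∀ x ∈ s, x ≠ .daimon := by
  intro x hx hd
  obtain ⟨l, hl⟩ := h.foc x hx
  rw [hd] at hl; simp [Action.focus?] at hl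

theorem JustChain.dual {p p' s : List Action} (h : JustChain (simpleBase ξ pos) p s)
    (hm : ∀ x ∈ s, x.dual ∈ p') : JustChain (simpleBase ξ (!pos)) p' (s.map Action.dual) := by
  induction h with
  | @init κ h hi =>
    refine JustChain.init (hm _ (by simp)) ?_
    rw [initial_iff] at hi ⊢
    rw [dual_focus, dual_pos, hi.1]
    · exact ⟨rfl, hi.2⟩
    · rintro rfl; simp [Action.focus?] at hi
  | @cons s κ κ' _ h hj ih =>
    have := JustChain.cons (β := simpleBase ξ (!pos)) (p := p') (s := s.map Action.dual) (κ := κ.dual) (κ' := κ'.dual) ?_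
      (hm _ (by simp)) (by simpa using hj)
    · simpa using this
    · have := ih fun x hx => hm x (by simp at hx ⊢; tauto)
      simpa using this

theorem not_just_foc {b a : Action} {l : Address} (hb : b.focus? = some (ξ ++ l)) (ha : a.focus? = some ξ) :
    ¬ b.justifies a := by
  intro h
  obtain ⟨f, i, h1, h2, -⟩ := justifies_iff.1 h
  rw [hb] at h1; rw [ha] at h2
  cases h1
  have := congrArg List.length (Option.some.inj h2)
  simp at this

theorem JustChain.unique {p s : List Action} (h : JustChain (simpleBase ξ pos) p s) :
    ∀ {p' s' : List Action}, JustChain (simpleBase ξ pos) p' s' →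
    (∀ x ∈ s, ∀ y ∈ s', x.focus? = y.focus? → x = y) → s.getLast? = s'.getLast? → s = s' := by
  induction h with
  | @init κ h hi =>
    intro p' s' h' hl hla
    cases h' with
    | init => simpa using hla
    | @cons t κ1 κ2 h1 h2 h3 =>
      exfalso
      simp at hla; subst hla
      obtain ⟨l, hl⟩ := h1.foc κ1 (by simp)
      exact not_just_foc hl (initial_iff.1 hi).2 h3
  | @cons t κ1 κ2 h1 h2 h3 ih =>
    intro p' s' h' hl hla
    cases h' with
    | init h hi =>
      exfalso
      simp at hla; subst hla
      obtain ⟨l, hl⟩ := h1.foc κ1 (by simp)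
      exact not_just_foc hl (initial_iff.1 hi).2 h3
    | @cons t' κ1' κ2' h1' h2' h3' =>
      simp at hla; subst hla
      have := hl κ1 (by simp) κ1' (by simp) (justifies_focus h3 h3')
      subst this
      have := ih h1' (fun x hx y hy => hl x (by simp at hx ⊢; tauto) y (by simp at hy ⊢; tauto)) (by simp)
      have := (List.append_inj' this rfl).1
      rw [this]

theorem G.chain {u : List Action} (h : G ξ pos u) : ∀ (n : ℕ) (a : Action), u[n]? = some a →
    ∃ s, JustChain (simpleBase ξ pos) u s ∧ s.getLast? = some a := by
  intro n
  induction n using Nat.strong_induction_on with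
  | _ n ih =>
    intro a ha
    rcases Nat.eq_zero_or_pos n with rfl | hn
    · exact ⟨[a], JustChain.init (get_mem ha) (initial_iff.2 (h.head a ha)), rfl⟩
    · obtain ⟨j, b, hj, hb, hba⟩ := h.just n a ha hn
      obtain ⟨s, hs, hl⟩ := ih j hj b hb
      rw [List.getLast?_eq_some_iff] at hl
      obtain ⟨s0, rfl⟩ := hl
      exact ⟨_, JustChain.cons hs (get_mem ha) hba, by simp⟩

theorem G.chain_mem {u : List Action} (h : G ξ pos u) {a : Action} (ha : a ∈ u) :
    ∃ s, JustChain (simpleBase ξ pos) u s ∧ s.getLast? = some a := by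
  obtain ⟨n, hn⟩ := List.mem_iff_getElem?.1 ha
  exact h.chain n a hn

def Triv (ξ : Address) (pos : Bool) (A : Set (Set (List Action))) (s : List Action) : Prop :=
  ∃ D, Mat A D ∧ ∃ c ∈ D, JustChain (simpleBase ξ pos) c s

variable {A B : Set (Set (List Action))}

theorem VT (h : Pair ξ pos A B) {u p s : List Action} (hu : Vis pos A B u)
    (hs : JustChain (simpleBase ξ pos) p s) (hm : ∀ x ∈ s, x ∈ u) : Triv ξ pos A s := by
  obtain ⟨D, hD, hv⟩ := hu.mat h
  obtain ⟨hG, -⟩ := hu.G h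
  obtain ⟨s0, κ, rfl⟩ := hs.last
  obtain ⟨n, hn⟩ := List.mem_iff_getElem?.1 (hm κ (by simp))
  have hpre : u.take n ++ [κ] <+: u := pre_of_get hn
  have hc := hv _ (hpre.trans u_prefix_close) (by simp)
  have hsub : ∀ x ∈ view (u.take n ++ [κ]), x ∈ u := fun x hx => hpre.subset (view_subset _ _ hx)
  have Gc : Ludics.G ξ pos (view (u.take n ++ [κ])) :=
    chron_G ((h.desA D hD.1).chron _ hc) List.prefix_rfl (fun x hx => hG.nod x (hsub x hx))
  obtain ⟨s', hs', hl⟩ := Gc.chain_mem (mem_view_last _ _)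
  have := hs'.unique hs (fun x hx y hy e => hG.linm (hsub x (hs'.mem x hx)) (hm y hy) e) (by rw [hl]; simp)
  rw [this] at hs'
  exact ⟨D, hD, _, hc, hs'⟩

theorem mem_close {u : List Action} {x : Action} (h : x ∈ close pos u) (hx : x ≠ .daimon) : x ∈ u := by
  unfold close at h
  split at h
  · simp at h; rcases h with h | h
    · exact h
    · exact absurd h hx
  · exact h

theorem Triv.vis (h : Pair ξ pos A B) {s : List Action} (hs : Triv ξ pos A s) :
    ∃ u, Vis pos A B u ∧ ∀ x ∈ s, x ∈ u := by
  obtain ⟨D, hD, c, hc, hs⟩ := hs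
  obtain ⟨E, hE, u, hu, q, hq, h0, rfl⟩ := hD.visited h hc
  refine ⟨u, ⟨D, hD.1, E, hE, hu⟩, fun x hx => ?_⟩
  exact mem_close (hq.subset (view_subset _ _ (hs.mem x hx))) (hs.nod x hx)

theorem TD (h : Pair ξ pos A B) {s : List Action} (hs : Triv ξ pos A s) : Triv ξ (!pos) B (s.map Action.dual) := by
  obtain ⟨u, hu, hm⟩ := hs.vis h
  obtain ⟨D, hD, c, hc, hs⟩ := hs
  have hm' : ∀ x ∈ s, x.dual ∈ u.map Action.dual := fun x hx => List.mem_map_of_mem (hm x hx)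
  refine VT h.symm hu.symm (hs.dual hm') ?_
  intro x hx
  obtain ⟨y, hy, rfl⟩ := List.mem_map.1 hx
  exact hm' y hy

structure RegU (ξ : Address) (pos : Bool) (A : Set (Set (List Action))) (u : List Action) : Prop where
  G : G ξ pos u
  triv : ∀ κ ∈ u, ∃ s, JustChain (simpleBase ξ pos) u s ∧ s.getLast? = some κ ∧ Triv ξ pos A s

theorem RegU.dual (h : Pair ξ pos A B) {u : List Action} (hu : RegU ξ pos A u) :
    RegU ξ (!pos) B (u.map Action.dual) := by
  refine ⟨hu.G.dual, ?_⟩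
  intro κ hκ
  obtain ⟨y, hy, rfl⟩ := List.mem_map.1 hκ
  obtain ⟨s, h1, h2, h3⟩ := hu.triv y hy
  refine ⟨s.map Action.dual, h1.dual fun x hx => List.mem_map_of_mem (h1.mem x hx), ?_, TD h h3⟩
  rw [List.getLast?_map, h2]; rfl

theorem regularPath_iff (A : Behaviour ξ pos) (p : List Action) :
    RegularPath A p ↔ ∃ u, RegU ξ pos A.designs u ∧ p = close pos u := by
  constructor
  · rintro ⟨h1, h2, h3⟩
    obtain ⟨u, hG, rfl⟩ := PG h1 h2
    refine ⟨u, ⟨hG, ?_⟩, rfl⟩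
    intro κ hκ
    obtain ⟨s, hs, hl, ht⟩ := h3 κ (u_prefix_close.subset hκ) (hG.nod κ hκ)
    exact ⟨s, hs.mono fun x hx => mem_close (hs.mem x hx) (hs.nod x hx), hl, ht⟩
  · rintro ⟨u, h, rfl⟩
    refine ⟨h.G.isPath, h.G.isPath_dual, ?_⟩
    intro κ hκ hd
    obtain ⟨s, hs, hl, ht⟩ := h.triv κ (mem_close hκ hd)
    exact ⟨s, hs.mono fun x hx => u_prefix_close.subset (hs.mem x hx), hl, ht⟩

theorem regular_iff (A : Behaviour ξ pos) {B : Set (Set (List Action))}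
    (hB : B = orthSet ξ pos A.designs) :
    Regular A ↔ ∀ u, RegU ξ pos A.designs u → Vis pos A.designs B u := by
  constructor
  · intro h u hu
    obtain ⟨v, hv, e⟩ := (visitable_iff A hB _).1 (h _ ((regularPath_iff A _).2 ⟨u, hu, rfl⟩))
    have hn : ∀ a ∈ v, a ≠ .daimon := by
      obtain ⟨D, hD, E, hE, hv⟩ := hv
      exact hv.nod
    rw [close_inj hu.G.nod hn e]; exact hv
  · intro h p hp
    obtain ⟨u, hu, rfl⟩ := (regularPath_iff A p).1 hp
    exact (visitable_iff A hB _).2 ⟨u, h u hu, rfl⟩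

theorem regU_chron (h : Pair ξ pos A B) {D : Set (List Action)} (hD : Mat A D) {c : List Action} (hc : c ∈ D)
    (he : ∃ a, c.getLast? = some a ∧ a.isPositive = true) : ∃ u, RegU ξ pos A u ∧ c = close pos u := by
  obtain ⟨u, hG, rfl⟩ := chron_close ((h.desA D hD.1).chron c hc) he
  refine ⟨u, ⟨hG, ?_⟩, rfl⟩
  intro κ hκ
  obtain ⟨s, hs, hl⟩ := hG.chain_mem hκ
  exact ⟨s, hs, hl, D, hD, _, hc, hs.mono fun x hx => u_prefix_close.subset (hs.mem x hx)⟩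

theorem zip_mem {x : Action} : ∀ {ps qs : List (List Action)}, ps.length = qs.length →
    (x ∈ (List.zipWith (· ++ ·) ps qs).flatten ↔ x ∈ ps.flatten ∨ x ∈ qs.flatten) := by
  intro ps
  induction ps with
  | nil => intro qs h; cases qs <;> simp at h ⊢
  | cons a ps ih =>
    intro qs h
    cases qs with
    | nil => simp at h
    | cons b qs =>
      simp only [List.length_cons, Nat.add_right_cancel_iff] at h
      simp only [List.zipWith_cons_cons, List.flatten_cons, List.mem_append, ih h]
      tauto

theorem shuffle_mem {p q r : List Action} (h : Shuffle p q r) : ∀ κ ∈ r,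
    (∃ p', p' <+: p ∧ κ ∈ p' ∧ ∀ x ∈ p', x ∈ r) ∨ (∃ p', p' <+: q ∧ κ ∈ p' ∧ ∀ x ∈ p', x ∈ r) := by
  induction h with
  | base h =>
    obtain ⟨ps, qs, hl, -, -, rfl, rfl, rfl, -⟩ := h
    intro κ hκ
    rcases (zip_mem hl).1 hκ with h | h
    · left; exact ⟨_, List.prefix_rfl, h, fun x hx => (zip_mem hl).2 (Or.inl hx)⟩
    · right; exact ⟨_, List.prefix_rfl, h, fun x hx => (zip_mem hl).2 (Or.inr hx)⟩
  | daiLeft _ ih =>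
    intro κ hκ
    rcases ih κ hκ with h | ⟨p', h1, h2⟩
    · left; exact h
    · right; exact ⟨p', h1.trans (List.prefix_append _ _), h2⟩
  | daiRight _ ih =>
    intro κ hκ
    rcases ih κ hκ with ⟨p', h1, h2⟩ | h
    · left; exact ⟨p', h1.trans (List.prefix_append _ _), h2⟩
    · right; exact h
  | @pre s p q r _ _ _ ih =>
    intro κ hκ
    rcases List.mem_append.1 hκ with h | h
    · left; exact ⟨s, List.prefix_append _ _, h, fun x hx => by simp [hx]⟩
    · rcases ih κ h with ⟨p', h1, h2, h3⟩ | ⟨p', h1, h2, h3⟩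
      · left
        refine ⟨s ++ p', by simpa using h1, by simp [h2], fun x hx => ?_⟩
        rcases List.mem_append.1 hx with h | h
        · simp [h]
        · simp [h3 x h]
      · right
        refine ⟨s ++ p', by simpa using h1, by simp [h2], fun x hx => ?_⟩
        rcases List.mem_append.1 hx with h | h
        · simp [h]
        · simp [h3 x h]

theorem vis_prefix_triv (h : Pair ξ pos A B) {u v p' : List Action} (hu : Vis pos A B u) (hv : G ξ pos v)
    (hp : p' <+: close pos u) {κ : Action} (hκ : κ ∈ p') (hd : κ ≠ .daimon) (hm : ∀ x ∈ p', x ∈ close pos v) :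
    ∃ s, JustChain (simpleBase ξ pos) v s ∧ s.getLast? = some κ ∧ Triv ξ pos A s := by
  obtain ⟨hG, -⟩ := hu.G h
  obtain ⟨n, hn⟩ := List.mem_iff_getElem?.1 hκ
  have h1 := pre_of_get hn
  obtain ⟨h2, h3⟩ := pre_close_proper (h1.trans hp) hd
  have h4 := pre_of_get h3
  rw [← h2] at h4
  have hG' : G ξ pos (p'.take n ++ [κ]) := by
    have := hG.take (p'.take n ++ [κ]).length
    rwa [← List.prefix_iff_eq_take.1 h4] at this
  obtain ⟨s, hs, hl⟩ := hG'.chain_mem (a := κ) (by simp)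
  refine ⟨s, hs.mono fun x hx => mem_close (hm x (h1.subset (hs.mem x hx))) (hs.nod x hx), hl, ?_⟩
  exact VT h hu hs fun x hx => h4.subset (hs.mem x hx)

theorem regU_shuffle (h : Pair ξ pos A B) {u v r : List Action} (hu : Vis pos A B u) (hv : Vis pos A B v)
    (hs : Shuffle (close pos u) (close pos v) r) (h1 : IsPath (simpleBase ξ pos) r)
    (h2 : IsPath (simpleBase ξ (!pos)) (dualSeq r)) : ∃ w, RegU ξ pos A w ∧ r = close pos w := by
  obtain ⟨w, hG, rfl⟩ := PG h1 h2
  refine ⟨w, ⟨hG, ?_⟩, rfl⟩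
  intro κ hκ
  rcases shuffle_mem hs κ (u_prefix_close.subset hκ) with ⟨p', h1, h2, h3⟩ | ⟨p', h1, h2, h3⟩
  · exact vis_prefix_triv h hu hG h1 h2 (hG.nod κ hκ) h3
  · exact vis_prefix_triv h hv hG h1 h2 (hG.nod κ hκ) h3

end


structure FS (ξ : Address) (pos : Bool) (u : List Action) (N : ℕ) (K : Action → Bool) : Prop where
  hG : G ξ pos u
  hP : Pol u
  hN : 0 < N
  hNu : N ≤ u.length
  hk : ∀ a : Action, u[N-1]? = some a → a.isPositive = true
  inv : ∀ (n : ℕ) (a : Action) (j : ℕ) (b : Action), u[n]? = some a → a.isPositive = false → N ≤ n →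
    u[j]? = some b → j < n → b.justifies a → N ≤ j + 1
  K1 : ∀ (n : ℕ) (a : Action), n < N → u[n]? = some a → K a = true
  K2 : ∀ (n : ℕ) (a : Action) (j : ℕ) (b : Action), u[n]? = some a → a.isPositive = false → N ≤ n →
    u[j]? = some b → j < n → N ≤ j → b.justifies a → K a = K b
  K3 : ∀ (n : ℕ) (a b : Action), N ≤ n → u[n]? = some a → u[n+1]? = some b → a.isPositive = false → K a = K b

section
variable {ξ : Address} {pos : Bool} {u : List Action} {N : ℕ} {K : Action → Bool}

def F (K : Action → Bool) (u : List Action) (n : ℕ) : List Action := (u.take n).filter K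

theorem F_keep {n : ℕ} {a : Action} (ha : u[n]? = some a) (hK : K a = true) : F K u (n+1) = F K u n ++ [a] := by
  rw [F, take_snoc ha, List.filter_append, List.filter_cons_of_pos hK]; rfl

theorem F_drop {n : ℕ} {a : Action} (ha : u[n]? = some a) (hK : K a = false) : F K u (n+1) = F K u n := by
  rw [F, take_snoc ha, List.filter_append, List.filter_cons_of_neg (by simp [hK])]; simp [F]

theorem F_mem {n : ℕ} {a : Action} : a ∈ F K u n ↔ K a = true ∧ ∃ i, i < n ∧ u[i]? = some a := by
  rw [F, List.mem_filter, List.mem_iff_getElem?]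
  simp only [get_take]
  tauto

theorem F_split {j n : ℕ} {b : Action} (hj : j < n) (hb : u[j]? = some b) (hK : K b = true) :
    ∃ w2, F K u n = F K u j ++ b :: w2 ∧ ∀ c ∈ w2, ∃ i, j < i ∧ i < n ∧ u[i]? = some c := by
  obtain ⟨w2, e, h⟩ := split_at hj hb
  refine ⟨w2.filter K, ?_, fun c hc => h c (List.mem_filter.1 hc).1⟩
  rw [F, e, List.filter_append, List.filter_cons_of_pos hK]; rfl

theorem viewF_neg (hG : G ξ pos u) {n j : ℕ} {a b : Action} (ha : u[n]? = some a) (hKa : K a = true)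
    (hn : a.isPositive = false) (hj : j < n) (hb : u[j]? = some b) (hKb : K b = true) (hba : b.justifies a) :
    view (F K u (n+1)) = view (F K u (j+1)) ++ [a] := by
  obtain ⟨w2, e, h2⟩ := F_split hj hb hKb
  rw [F_keep ha hKa, e, F_keep hb hKb]
  refine Ludics.view_neg hn hba ?_
  intro c hc hca
  obtain ⟨i, hi, hi', hci⟩ := h2 c hc
  have := hG.lin i j c b hci hb (justifies_focus hca hba)
  omega

theorem dviewF_pos (hG : G ξ pos u) {n j : ℕ} {a b : Action} (ha : u[n]? = some a) (hKa : K a = true)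
    (hn : a.isPositive = true) (hj : j < n) (hb : u[j]? = some b) (hKb : K b = true) (hba : b.justifies a) :
    dview (F K u (n+1)) = dview (F K u (j+1)) ++ [a.dual] := by
  obtain ⟨w2, e, h2⟩ := F_split hj hb hKb
  rw [F_keep ha hKa, e, F_keep hb hKb]
  simp only [dview, List.map_append, List.map_cons, List.map_nil]
  refine Ludics.view_neg ?_ (by simpa using hba) ?_
  · rw [dual_pos (hG.nod a (get_mem ha)), hn]; rfl
  intro c hc hca
  obtain ⟨c, hc', rfl⟩ := List.mem_map.1 hc
  have hca : c.justifies a := by simpa using hca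
  obtain ⟨i, hi, hi', hci⟩ := h2 c hc'
  have := hG.lin i j c b hci hb (justifies_focus hca hba)
  omega

theorem dviewF_neg {n : ℕ} {a : Action} (ha : u[n]? = some a) (hKa : K a = true)
    (hn : a.isPositive = false) : dview (F K u (n+1)) = dview (F K u n) ++ [a.dual] := by
  rw [F_keep ha hKa]
  simp only [dview, List.map_append, List.map_cons, List.map_nil]
  rw [view_pos]
  rw [dual_pos (neg_ne_daimon hn), hn]; rfl

theorem get_ex {n : ℕ} (h : n < u.length) : ∃ a : Action, u[n]? = some a := ⟨u[n], List.getElem?_eq_getElem h⟩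

theorem G.prev (hG : G ξ pos u) {n : ℕ} {b : Action} (hb : u[n+1]? = some b) :
    ∃ a : Action, u[n]? = some a ∧ a.isPositive = !b.isPositive := by
  have := get_lt hb
  obtain ⟨a, ha⟩ := get_ex (u := u) (n := n) (by omega)
  refine ⟨a, ha, ?_⟩
  have := hG.alt n a b ha hb
  revert this; generalize b.isPositive = x; generalize a.isPositive = y; revert x y; decide

/-- element of `t` which is positive is preceded by a negative element of `t` -/
theorem FS.pos_prev (h : FS ξ pos u N K) {n : ℕ} {b : Action} (hb : u[n]? = some b) (hN : N ≤ n)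
    (hp : b.isPositive = true) : ∃ m a, n = m + 1 ∧ N ≤ m ∧ u[m]? = some a ∧ a.isPositive = false ∧ K a = K b := by
  have h0 := h.hN
  obtain ⟨m, rfl⟩ : ∃ m, n = m + 1 := ⟨n-1, by omega⟩
  obtain ⟨a, ha, hap⟩ := h.hG.prev hb
  rw [hp] at hap
  have hm : N ≤ m := by
    by_contra hlt
    have e : m = N - 1 := by omega
    have := h.hk a (by rw [← e]; exact ha)
    rw [this] at hap; simp at hap
  exact ⟨m, a, rfl, hm, ha, by simpa using hap, h.K3 m a b hm ha hb (by simpa using hap)⟩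

theorem FS.neg_just (h : FS ξ pos u N K) {n : ℕ} {a : Action} (ha : u[n]? = some a) (hN : N ≤ n)
    (hn : a.isPositive = false) : ∃ j b, j < n ∧ N ≤ j + 1 ∧ u[j]? = some b ∧ b.justifies a ∧
      b.isPositive = true ∧ (K a = true → K b = true) ∧ (N ≤ j → K a = K b) := by
  have h0 := h.hN
  obtain ⟨j, b, hj, hb, hba⟩ := h.hG.just n a ha (by omega)
  refine ⟨j, b, hj, h.inv n a j b ha hn hN hb hj hba, hb, hba, ?_, ?_, ?_⟩
  · have := h.hP a (get_mem ha) b (get_mem hb) hba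
    rw [hn] at this; simpa using this
  · intro hK
    by_cases hjN : j < N
    · exact h.K1 j b hjN hb
    · rw [← h.K2 n a j b ha hn hN hb hj (by omega) hba]; exact hK
  · intro hjN
    exact h.K2 n a j b ha hn hN hb hj hjN hba

theorem FS.F_low (h : FS ξ pos u N K) {n : ℕ} (hn : n ≤ N) : F K u n = u.take n := by
  rw [F, List.filter_eq_self]
  intro a ha
  obtain ⟨i, hi⟩ := List.mem_iff_getElem?.1 ha
  rw [get_take] at hi
  exact h.K1 i a (by omega) hi.2

theorem FS.VF (h : FS ξ pos u N K) : ∀ (n : ℕ) (e : Action), u[n]? = some e → K e = true →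
    view (F K u (n+1)) = view (u.take (n+1)) := by
  intro n
  induction n using Nat.strong_induction_on with
  | _ n ih =>
    intro e he hK
    by_cases hn : n < N
    · rw [h.F_low (by omega)]
    · cases hp : e.isPositive with
      | false =>
        obtain ⟨j, b, hj, -, hb, hba, -, hKb, -⟩ := h.neg_just he (by omega) hp
        rw [viewF_neg h.hG he hK hp hj hb (hKb hK) hba, ih j hj b hb (hKb hK), h.hG.view_neg he hp hj hb hba]
      | true =>
        obtain ⟨m, a, rfl, hm, ha, hap, hKa⟩ := h.pos_prev he (by omega) hp
        rw [F_keep he hK, view_pos hp, view_pos' he hp, ih m (by omega) a ha (hKa.trans hK)]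

theorem FS.VF' (h : FS ξ pos u N K) {n : ℕ} {e : Action} (he : u[n]? = some e) (hK : K e = true)
    (hp : e.isPositive = true) : view (F K u n) = view (u.take n) := by
  have := h.VF n e he hK
  rw [F_keep he hK, view_pos hp, view_pos' he hp] at this
  exact (List.append_inj' this rfl).1

theorem FS.K4 (h : FS ξ pos u N K) {n m : ℕ} {e a : Action} (he : u[n]? = some e) (hK : K e = true)
    (hp : e.isPositive = true) (ha : u[m]? = some a) (hm : m < n) (hae : a.justifies e) : K a = true := by
  have h1 := h.hG.pvis n e m a he hp hm ha hae
  rw [← h.VF' he hK hp] at h1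
  exact (F_mem.1 (view_subset _ _ h1)).1

theorem mem_dview_take (hG : G ξ pos u) {n i : ℕ} {b : Action} (hb : u[i]? = some b) (h : b.dual ∈ dview (u.take n)) :
    i < n := by
  have := view_subset _ _ h
  obtain ⟨b', hb', e⟩ := List.mem_map.1 this
  have := dual_inj e; subst this
  obtain ⟨j, hj⟩ := List.mem_iff_getElem?.1 hb'
  rw [get_take] at hj
  rw [hG.lin i j _ _ hb hj.2 rfl]; exact hj.1

theorem mem_view_take (hG : G ξ pos u) {n i : ℕ} {b : Action} (hb : u[i]? = some b) (h : b ∈ view (u.take n)) :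
    i < n := by
  have hb' := view_subset _ _ h
  obtain ⟨j, hj⟩ := List.mem_iff_getElem?.1 hb'
  rw [get_take] at hj
  rw [hG.lin i j _ _ hb hj.2 rfl]; exact hj.1

theorem FS.QP (h : FS ξ pos u N K) : ∀ n : ℕ,
    (∀ (e : Action) (m : ℕ) (a : Action), u[n]? = some e → e.isPositive = true → K e = false →
      u[m]? = some a → a.isPositive = false → N ≤ m → a ∈ view (u.take (n+1)) →
      ∀ x ∈ dview (F K u m), x ∈ dview (F K u (n+1))) ∧
    (∀ (y : Action) (i : ℕ) (b : Action), u[n]? = some y → y.isPositive = true → u[i]? = some b →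
      b.isPositive = true → b.dual ∈ dview (u.take (n+1)) → N ≤ i + 1 →
      ∀ x ∈ dview (F K u (i+1)), x ∈ dview (F K u (n+1))) := by
  have h0 := h.hN
  have hG := h.hG
  intro n
  induction n using Nat.strong_induction_on with
  | _ n ih =>
    have hPn : ∀ (e : Action) (m : ℕ) (a : Action), u[n]? = some e → e.isPositive = true → K e = false →
      u[m]? = some a → a.isPositive = false → N ≤ m → a ∈ view (u.take (n+1)) →
      ∀ x ∈ dview (F K u m), x ∈ dview (F K u (n+1)) := by
      intro e m a he hp hK ha han hNm hav x hx
      have hNn : N ≤ n := by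
        by_contra hlt
        rw [h.K1 n e (by omega) he] at hK; simp at hK
      obtain ⟨n', a', rfl, hNn', ha', hap', hKa'⟩ := h.pos_prev he hNn hp
      have hea : a ≠ e := by rintro rfl; rw [hp] at han; simp at han
      rw [view_pos' he hp, List.mem_append] at hav
      have hav : a ∈ view (u.take (n'+1)) := by
        rcases hav with h | h
        · exact h
        · simp at h; exact absurd h hea
      rw [F_drop he hK, F_drop ha' (hKa'.trans hK)]
      obtain ⟨i', b', hi', -, hb', hba', hbp', -, hKb'⟩ := h.neg_just ha' hNn' hap'
      rw [hG.view_neg ha' hap' hi' hb' hba', List.mem_append] at hav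
      rcases hav with hav | hav
      · have him := mem_view_take hG ha hav
        have hKb'' : K b' = false := by rw [← hKb' (by omega), hKa', hK]
        have h1 := (ih i' (by omega)).1 b' m a hb' hbp' hKb'' ha han hNm hav x hx
        obtain ⟨n'', rfl⟩ : ∃ n'', n' = n'' + 1 := ⟨n'-1, by omega⟩
        obtain ⟨z, hz, hzp⟩ := hG.prev ha'
        rw [hap'] at hzp
        exact (ih n'' (by omega)).2 z i' b' hz (by simpa using hzp) hb' hbp'
          (hG.ovis _ a' i' b' ha' hap' hi' hb' hba') (by omega) x h1
      · simp at hav; subst hav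
        rw [hG.lin n' m a a ha' ha rfl]; exact hx
    refine ⟨hPn, ?_⟩
    intro y i b hy hyp hb hbp hbv hNi x hx
    by_cases hin : i = n
    · rw [← hin]; exact hx
    have hilt : i < n := by
      have := mem_dview_take hG hb hbv; omega
    obtain ⟨m, a, hm, ha, hay⟩ := hG.just n y hy (by omega)
    have han : a.isPositive = false := by
      have := h.hP y (get_mem hy) a (get_mem ha) hay
      rw [hyp] at this; simpa using this
    rw [hG.dview_pos hy hyp hm ha hay, dview_neg ha han] at hbv
    have hbv : b.dual ∈ dview (u.take m) := by
      simp only [List.mem_append, List.mem_singleton] at hbv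
      rcases hbv with (h | h) | h
      · exact h
      · have := dual_inj h; subst this; rw [hbp] at han; simp at han
      · have := dual_inj h; subst this
        exact absurd (hG.lin i n _ _ hb hy rfl) hin
    have him := mem_dview_take hG hb hbv
    obtain ⟨m', rfl⟩ : ∃ m', m = m' + 1 := ⟨m-1, by omega⟩
    obtain ⟨z, hz, hzp⟩ := hG.prev ha
    rw [han] at hzp
    have h1 := (ih m' (by omega)).2 z i b hz (by simpa using hzp) hb hbp hbv hNi x hx
    cases hK : K y with
    | true =>
      have hKa := h.K4 hy hK hyp ha hm hay
      rw [dviewF_pos hG hy hK hyp hm ha hKa hay, dviewF_neg ha hKa han]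
      simp [h1]
    | false =>
      refine hPn y (m'+1) a hy hyp hK ha han (by omega) ?_ x h1
      rw [view_pos' hy hyp]
      exact List.mem_append_left _ (hG.pvis n y _ a hy hyp hm ha hay)

theorem FS.F_pos (h : FS ξ pos u N K) : ∀ (n : ℕ) (y : Action), N ≤ n + 1 → u[n]? = some y → y.isPositive = true →
    ∀ z, (F K u (n+1)).getLast? = some z → z.isPositive = true := by
  intro n
  induction n using Nat.strong_induction_on with
  | _ n ih =>
    intro y hn hy hyp z hz
    have h0 := h.hN
    by_cases hK : K y = true
    · rw [F_keep hy hK] at hz; simp at hz; rw [← hz]; exact hyp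
    · simp at hK
      have hNn : N ≤ n := by
        by_contra hlt
        rw [h.K1 n y (by omega) hy] at hK; simp at hK
      obtain ⟨n', a', rfl, hNn', ha', hap', hKa'⟩ := h.pos_prev hy hNn hyp
      rw [F_drop hy hK, F_drop ha' (hKa'.trans hK)] at hz
      obtain ⟨n'', rfl⟩ : ∃ n'', n' = n'' + 1 := ⟨n'-1, by omega⟩
      obtain ⟨w, hw, hwp⟩ := h.hG.prev ha'
      rw [hap'] at hwp
      exact ih n'' (by omega) w (by omega) hw (by simpa using hwp) z hz

theorem FS.GF (h : FS ξ pos u N K) : ∀ n : ℕ, n ≤ u.length → G ξ pos (F K u n) := by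
  have h0 := h.hN
  have hG := h.hG
  intro n
  induction n with
  | zero => intro _; simpa [F] using G.nil
  | succ n ih =>
    intro hn
    by_cases hnN : n < N
    · rw [h.F_low (by omega)]; exact hG.take _
    have ih := ih (by omega)
    obtain ⟨e, he⟩ := get_ex (u := u) (n := n) (by omega)
    cases hK : K e with
    | false => rw [F_drop he hK]; exact ih
    | true =>
    have just : ∀ b ∈ F K u n, b.justifies e → ∃ i, i < n ∧ u[i]? = some b := fun b hb _ => (F_mem.1 hb).2
    rw [F_keep he hK]
    refine ih.snoc (hG.nod e (get_mem he)) ?_ ?_ ?_ ?_ ?_ ?_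
    · intro hF
      exfalso
      obtain ⟨x, hx⟩ := get_ex (u := u) (n := 0) (by omega)
      have : x ∈ F K u n := F_mem.2 ⟨h.K1 0 x h0 hx, 0, by omega, hx⟩
      rw [hF] at this; simp at this
    · intro _
      obtain ⟨j, b, hj, hb, hbe⟩ := hG.just n e he (by omega)
      refine ⟨b, F_mem.2 ⟨?_, j, hj, hb⟩, hbe⟩
      cases hp : e.isPositive with
      | true => exact h.K4 he hK hp hb hj hbe
      | false =>
        obtain ⟨j', b', hj', -, hb', hbe', -, hKb, -⟩ := h.neg_just he (by omega) hp
        rw [hG.linm (get_mem hb) (get_mem hb') (justifies_focus hbe hbe')]; exact hKb hK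
    · intro b hb
      cases hp : e.isPositive with
      | true =>
        obtain ⟨m, a, rfl, hm, ha, hap, hKa⟩ := h.pos_prev he (by omega) hp
        rw [F_keep ha (hKa.trans hK)] at hb
        simp at hb; rw [← hb, hap]; simp
      | false =>
        obtain ⟨m, rfl⟩ : ∃ m, n = m + 1 := ⟨n-1, by omega⟩
        obtain ⟨w, hw, hwp⟩ := hG.prev he
        rw [hp] at hwp
        rw [h.F_pos m w (by omega) hw (by simpa using hwp) b hb]; simp
    · intro b hb e'
      obtain ⟨-, i, hi, hbi⟩ := F_mem.1 hb
      have := hG.lin i n b e hbi he e'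
      omega
    · intro hp b hb hbe
      obtain ⟨i, hi, hbi⟩ := just b hb hbe
      rw [h.VF' he hK hp]
      exact hG.pvis n e i b he hp hi hbi hbe
    · intro hp b hb hbe
      obtain ⟨i, hi, hbi⟩ := just b hb hbe
      obtain ⟨m, rfl⟩ : ∃ m, n = m + 1 := ⟨n-1, by omega⟩
      obtain ⟨w, hw, hwp⟩ := hG.prev he
      rw [hp] at hwp
      have hbp : b.isPositive = true := by
        have := h.hP e (get_mem he) b (get_mem hbi) hbe
        rw [hp] at this; simpa using this
      refine (h.QP m).2 w i b hw (by simpa using hwp) hbi hbp (hG.ovis _ e i b he hp hi hbi hbe)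
        (h.inv _ e i b he hp (by omega) hbi hi hbe) _ ?_
      apply dual_last_mem
      rw [F_keep hbi (F_mem.1 hb).1]; simp

theorem FS.GFu (h : FS ξ pos u N K) : G ξ pos (u.filter K) := by
  have := h.GF u.length le_rfl
  rwa [F, List.take_length] at this

theorem filter_prefix {w : List Action} {e : Action} (h : w ++ [e] <+: u.filter K) :
    ∃ n : ℕ, u[n]? = some e ∧ K e = true ∧ w ++ [e] = F K u (n+1) := by
  obtain ⟨t, ht⟩ := h
  have h1 : u.filter K = w ++ e :: t := by rw [← ht]; simp
  obtain ⟨u1, u2, rfl, h2, h3⟩ := List.filter_eq_append_iff.1 h1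
  obtain ⟨l1, l2, rfl, h4, h5, h6⟩ := List.filter_eq_cons_iff.1 h3
  have hget : (u1 ++ (l1 ++ e :: l2))[(u1 ++ l1).length]? = some e := by
    rw [← List.append_assoc, List.getElem?_append_right le_rfl]; simp
  refine ⟨(u1 ++ l1).length, hget, h5, ?_⟩
  rw [F_keep hget h5]
  congr 1
  rw [F, ← List.append_assoc, List.take_left, List.filter_append, h2]
  rw [List.filter_eq_nil_iff.2 (fun a ha => h4 a ha)]; simp

theorem FS.views (h : FS ξ pos u N K) {V : List Action → Prop}
    (hV : ∀ w a, w ++ [a] <+: close pos u → a.isPositive = true → V (view (w ++ [a]))) :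
    ∀ w a, w ++ [a] <+: close pos (u.filter K) → a.isPositive = true → V (view (w ++ [a])) := by
  have h0 := h.hN
  have hNu := h.hNu
  intro w a hw hap
  rcases prefix_close hw with hw | ⟨ht, hw⟩
  · obtain ⟨n, hn, hK, e⟩ := filter_prefix hw
    rw [e, h.VF n a hn hK, take_snoc hn]
    refine hV _ _ ((pre_of_get hn).trans u_prefix_close) hap
  · rw [hw, view_snoc_dai]
    rcases List.eq_nil_or_concat (u.filter K) with h1 | ⟨w', e, h1⟩
    · exfalso
      obtain ⟨x, hx⟩ := get_ex (u := u) (n := 0) (by omega)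
      have : x ∈ u.filter K := List.mem_filter.2 ⟨get_mem hx, h.K1 0 x h0 hx⟩
      rw [h1] at this; simp at this
    rw [List.concat_eq_append] at h1
    rw [h1, turn_snoc] at ht
    simp at ht
    obtain ⟨n, hn, hK, e'⟩ := filter_prefix (K := K) (u := u) (w := w') (e := e) (by rw [h1])
    have hlast : ∀ (m : ℕ) (x : Action), u[m]? = some x → K x = true → m ≤ n := by
      intro m x hx hKx
      have : x ∈ u.filter K := List.mem_filter.2 ⟨get_mem hx, hKx⟩
      rw [h1, e'] at this
      obtain ⟨-, i, hi, hxi⟩ := F_mem.1 this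
      rw [h.hG.lin m i x x hx hxi rfl]; omega
    have hNn : N ≤ n := by
      by_contra hlt
      obtain ⟨k, hk⟩ := get_ex (u := u) (n := N-1) (by omega)
      have h2 := hlast (N-1) k hk (h.K1 _ k (by omega) hk)
      have h3 : n = N-1 := by omega
      rw [h3] at hn
      rw [h.hk e hn] at ht; simp at ht
    have hend : u.length = n + 1 := by
      by_contra hne
      have := get_lt hn
      obtain ⟨x, hx⟩ := get_ex (u := u) (n := n+1) (by omega)
      have := hlast (n+1) x hx (by rw [← h.K3 n e x hNn hn hx ht]; exact hK)
      omega
    have hu : u.take (n+1) = u := by rw [← hend, List.take_length]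
    have hvw : view (u.filter K) = view u := by
      rw [h1, e', h.VF n e hn hK, hu]
    rw [hvw, ← view_snoc_dai]
    refine hV u .daimon ?_ rfl
    rw [close, if_pos]
    rw [← hu, take_snoc hn, turn_snoc, ht]; rfl

end


theorem close_append {pos : Bool} {s l : List Action} {k : Action} (hk : k.isPositive = true) :
    close pos (s ++ [k] ++ l) = s ++ [k] ++ close false l := by
  rcases List.eq_nil_or_concat l with rfl | ⟨l, a, rfl⟩
  · simp only [List.append_nil, close, turn_snoc, hk, turn_nil]; simp
  · rw [List.concat_eq_append, ← List.append_assoc]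
    simp only [close, turn_snoc]
    split <;> simp

def blk (b : List Action) : Prop := b = [] ∨ NegBlock b

theorem SN_cons {p q r b b' : List Action} (h : ShuffleNeg p q r) (hb : b = [] ∨ NegBlock b)
    (hb' : b' = [] ∨ NegBlock b') (h0 : b = [] ∨ b' = []) : ShuffleNeg (b ++ p) (b' ++ q) (b ++ b' ++ r) := by
  obtain ⟨ps, qs, h1, h2, h3, h4, h5, h6, h7⟩ := h
  refine ⟨b :: ps, b' :: qs, by simp [h1], ?_, ?_, by simp [h4], by simp [h5], by simp [h6], ?_⟩
  · intro x hx
    rcases List.mem_cons.1 hx with rfl | hx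
    · exact hb
    · exact h2 x hx
  · intro x hx
    rcases List.mem_cons.1 hx with rfl | hx
    · exact hb'
    · exact h3 x hx
  · cases ps with
    | nil =>
      cases qs with
      | nil =>
        simp only [List.getLast?_singleton, Option.getD_some]
        rcases h0 with rfl | rfl
        · simp [EndsWithDaimon]
        · simp
      | cons y ys => simp at h1
    | cons x xs =>
      cases qs with
      | nil => simp at h1
      | cons y ys =>
        rw [List.getLast?_cons_cons, List.getLast?_cons_cons]; exact h7

theorem SN_nil : ShuffleNeg [] [] [] := ⟨[], [], by simp [EndsWithDaimon]⟩

theorem close_cons2 {c d : Action} {l : List Action} (hd : d.isPositive = true) :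
    close false (c :: d :: l) = [c, d] ++ close false l := by
  have := close_append (pos := false) (s := [c]) (l := l) hd
  simpa using this

theorem SN_aux (K K' : Action → Bool) : ∀ (n : ℕ) (t : List Action), t.length ≤ n →
    t.IsChain (fun a b => a.isPositive ≠ b.isPositive) →
    (∀ a : Action, t[0]? = some a → a.isPositive = false) →
    (∀ x ∈ t, K' x = !K x) →
    (∀ (n : ℕ) (a b : Action), t[n]? = some a → t[n+1]? = some b → a.isPositive = false → K a = K b) →
    ShuffleNeg (close false (t.filter K)) (close false (t.filter K')) (close false t) := by
  intro n
  induction n with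
  | zero =>
    intro t ht
    have : t = [] := by simpa using ht
    subst this
    intros
    exact SN_nil
  | succ n ih =>
    intro t ht hc h0 hK hK3
    match t, ht, hc, h0, hK, hK3 with
    | [], _, _, _, _, _ => exact SN_nil
    | [c], _, _, h0, hK, _ =>
      have hc : c.isPositive = false := h0 c rfl
      have hcl : close false [c] = [c, .daimon] := by simp [close, turn, hc]
      have hcn : close false [] = [] := rfl
      have hnb : NegBlock [c, Action.daimon] := by
        refine ⟨by simp, ?_, ?_⟩
        · simp [hc]
        · simp [Action.isPositive]
      have h2 := hK c (by simp)
      cases hKc : K c with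
      | true =>
        rw [hKc] at h2
        simp only [List.filter_cons, hKc, h2, List.filter_nil, if_true, Bool.not_true, Bool.false_eq_true, if_false, hcl, hcn]
        simpa using SN_cons SN_nil (Or.inr hnb) (Or.inl rfl) (Or.inr rfl)
      | false =>
        rw [hKc] at h2
        simp only [List.filter_cons, hKc, h2, List.filter_nil, if_true, Bool.not_false, Bool.false_eq_true, if_false, hcl, hcn]
        simpa using SN_cons SN_nil (Or.inl rfl) (Or.inr hnb) (Or.inl rfl)
    | c :: d :: t', ht, hch, h0, hK, hK3 =>
      have hc : c.isPositive = false := h0 c rfl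
      have hcd := (List.isChain_cons_cons.1 hch).1
      have hd : d.isPositive = true := by rw [hc] at hcd; simpa using hcd.symm
      have hnb : NegBlock [c, d] := by
        refine ⟨by simp, ?_, ?_⟩
        · simp [hc]
        · simp [hd]
      have hch2 := (List.isChain_cons_cons.1 hch).2
      have hKd : K c = K d := hK3 0 c d rfl rfl hc
      have IH := ih t' (by simp at ht; omega) hch2.tail (by
        intro a ha
        have := isChain_iff_get.1 hch2 0 d a rfl (by simpa using ha)
        rw [hd] at this; simpa using this.symm) (fun x hx => hK x (by simp [hx]))
        (fun m a b ha hb => hK3 (m+2) a b (by simpa using ha) (by simpa using hb))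
      have h2 := hK c (by simp)
      have h3 := hK d (by simp)
      rw [close_cons2 hd]
      cases hKc : K c with
      | true =>
        rw [hKc] at h2 hKd
        rw [← hKd] at h3
        simp only [List.filter_cons, hKc, h2, h3, ← hKd, if_true, Bool.not_true, Bool.false_eq_true, if_false]
        rw [close_cons2 hd]
        simpa using SN_cons IH (Or.inr hnb) (Or.inl rfl) (Or.inr rfl)
      | false =>
        rw [hKc] at h2 hKd
        rw [← hKd] at h3
        simp only [List.filter_cons, hKc, h2, h3, ← hKd, if_true, Bool.not_false, Bool.false_eq_true, if_false]
        rw [close_cons2 hd]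
        simpa using SN_cons IH (Or.inl rfl) (Or.inr hnb) (Or.inl rfl)

section
variable {ξ : Address} {pos : Bool} {u : List Action} {N : ℕ} {K K' : Action → Bool}

theorem FS.decomp (h : FS ξ pos u N K) : ∃ s k, k.isPositive = true ∧ u.take N = s ++ [k] ∧
    u.filter K = s ++ [k] ++ (u.drop N).filter K := by
  have h0 := h.hN
  have hNu := h.hNu
  obtain ⟨k, hk⟩ := get_ex (u := u) (n := N-1) (by omega)
  have e : u.take N = u.take (N-1) ++ [k] := by
    rw [← take_snoc hk]; congr 1; omega
  refine ⟨u.take (N-1), k, h.hk k hk, e, ?_⟩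
  rw [← e]
  conv_lhs => rw [← List.take_append_drop N u]
  rw [List.filter_append]
  congr 1
  exact h.F_low le_rfl

theorem FS.shuffle (h : FS ξ pos u N K) (h' : FS ξ pos u N K')
    (hKK : ∀ (n : ℕ) (a : Action), u[n]? = some a → N ≤ n → K' a = !K a) :
    Shuffle (close pos (u.filter K)) (close pos (u.filter K')) (close pos u) := by
  obtain ⟨s, k, hk, e, e1⟩ := h.decomp
  obtain ⟨s', k', hk', e', e2⟩ := h'.decomp
  have h0 := h.hN
  have hNu := h.hNu
  obtain ⟨k1, hk1⟩ := get_ex (u := u) (n := N-1) (by omega)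
  have es : s' ++ [k'] = s ++ [k] := by rw [← e, e']
  have e3 : u = s ++ [k] ++ u.drop N := by rw [← e, List.take_append_drop]
  rw [e1, e2, es]
  conv => arg 3; rw [e3]
  rw [close_append hk, close_append hk, close_append hk]
  have hdg : ∀ (n : ℕ), (u.drop N)[n]? = u[N+n]? := fun n => List.getElem?_drop
  refine Shuffle.pre (by simp) (Or.inr ⟨k, by simp, hk⟩) (Shuffle.base ?_)
  refine SN_aux K K' _ _ le_rfl ?_ ?_ ?_ ?_
  · rw [isChain_iff_get]
    intro n a b ha hb
    rw [hdg] at ha hb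
    exact h.hG.alt _ a b ha hb
  · intro a ha
    rw [hdg] at ha
    have := h.hG.alt (N-1) k1 a hk1 (by rw [← ha]; congr 1; omega)
    rw [h.hk k1 hk1] at this; simpa using this.symm
  · intro x hx
    obtain ⟨n, hn⟩ := List.mem_iff_getElem?.1 hx
    rw [hdg] at hn
    exact hKK _ x hn (by omega)
  · intro n a b ha hb
    rw [hdg] at ha hb
    exact h.K3 _ a b (by omega) ha hb

theorem L_aux {V : List Action → Prop}
    (st : ∀ p q u, V p → V q → Shuffle p q (close pos u) → G ξ pos u → V (close pos u)) :
    ∀ (m : ℕ) (u : List Action), u.length ≤ m → G ξ pos u → Pol u →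
    (∀ w a, w ++ [a] <+: close pos u → a.isPositive = true → V (view (w ++ [a]))) →
    ∀ (l N : ℕ), u.length - N ≤ l → 0 < N → N ≤ u.length →
    (∀ a : Action, u[N-1]? = some a → a.isPositive = true) →
    view (u.take N) = u.take N →
    (∀ (n : ℕ) (a : Action) (j : ℕ) (b : Action), u[n]? = some a → a.isPositive = false → N ≤ n →
      u[j]? = some b → j < n → b.justifies a → N ≤ j + 1) → V (close pos u) := by
  intro m
  induction m with
  | zero => intro u hu _ _ _ l N; omega
  | succ m ihm =>
    intro u hum hG hP hV l
    induction l with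
    | zero =>
      intro N hl h0 hNu hk hvw inv
      have e : N = u.length := by omega
      rw [e, List.take_length] at hvw
      obtain ⟨k, hk1⟩ := get_ex (u := u) (n := N-1) (by omega)
      have hkp := hk k hk1
      have e2 : u = u.take (N-1) ++ [k] := by
        rw [← take_snoc hk1]
        rw [show N-1+1 = u.length by omega, List.take_length]
      have hcl : close pos u = u := by
        rw [close, if_neg]; rw [e2, turn_snoc, hkp]; simp
      have := hV (u.take (N-1)) k (by rw [hcl, ← e2]) hkp
      rw [← e2, hvw] at this
      rwa [hcl]
    | succ l ihl =>
      intro N hl h0 hNu hk hvw inv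
      by_cases hNl : u.length - N ≤ l
      · exact ihl N hNl h0 hNu hk hvw inv
      obtain ⟨k, hk1⟩ := get_ex (u := u) (n := N-1) (by omega)
      have hkp := hk k hk1
      obtain ⟨c, hc⟩ := get_ex (u := u) (n := N) (by omega)
      have hcn : c.isPositive = false := by
        have := hG.alt (N-1) k c hk1 (by rw [← hc]; congr 1; omega)
        rw [hkp] at this; simpa using this.symm
      obtain ⟨j, b, hj, hb, hbc⟩ := hG.just N c hc h0
      have hjN : j + 1 = N := by
        have := inv N c j b hc hcn le_rfl hb hj hbc; omega
      have hv1 : view (u.take (N+1)) = u.take (N+1) := by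
        rw [hG.view_neg hc hcn hj hb hbc, hjN, hvw, take_snoc hc]
      by_cases hlen : u.length = N + 1
      · rw [← hlen, List.take_length] at hv1
        have hu : u = u.take N ++ [c] := by
          rw [← take_snoc hc, ← hlen, List.take_length]
        have hcl : close pos u = u ++ [.daimon] := by
          rw [close, if_pos]; rw [hu, turn_snoc, hcn]; rfl
        have := hV u .daimon (by rw [hcl]) rfl
        rw [view_snoc_dai, hv1] at this
        rwa [hcl]
      obtain ⟨d, hd⟩ := get_ex (u := u) (n := N+1) (by omega)
      have hdp : d.isPositive = true := by
        have := hG.alt N c d hc hd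
        rw [hcn] at this; simpa using this.symm
      by_cases hex : ∃ (n : ℕ) (a : Action), N + 1 < n ∧ u[n]? = some a ∧ a.isPositive = false ∧ k.justifies a
      · obtain ⟨n0, a0, hn0, ha0, ha0n, hka0⟩ := hex
        classical
        let K : Action → Bool := fun e => decide (∃ n : ℕ, u[n]? = some e ∧ (n < N ∨ c ∈ view (u.take (n+1))))
        let K' : Action → Bool := fun e => decide (∃ n : ℕ, u[n]? = some e ∧ (n < N ∨ c ∉ view (u.take (n+1))))
        have K_iff : ∀ (n : ℕ) (e : Action), u[n]? = some e → (K e = true ↔ n < N ∨ c ∈ view (u.take (n+1))) := by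
          intro n e he
          simp only [K, decide_eq_true_eq]
          constructor
          · rintro ⟨i, hi, h⟩
            rwa [hG.lin n i e e he hi rfl]
          · intro h; exact ⟨n, he, h⟩
        have K'_iff : ∀ (n : ℕ) (e : Action), u[n]? = some e → (K' e = true ↔ n < N ∨ c ∉ view (u.take (n+1))) := by
          intro n e he
          simp only [K', decide_eq_true_eq]
          constructor
          · rintro ⟨i, hi, h⟩
            rwa [hG.lin n i e e he hi rfl]
          · intro h; exact ⟨n, he, h⟩
        have C2 : ∀ (n : ℕ) (a : Action) (j : ℕ) (b : Action), u[n]? = some a → a.isPositive = false → N ≤ n →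
            u[j]? = some b → j < n → N ≤ j → b.justifies a →
            (c ∈ view (u.take (n+1)) ↔ c ∈ view (u.take (j+1))) := by
          intro n a j b ha han hn hb hj hNj hba
          rw [hG.view_neg ha han hj hb hba, List.mem_append, List.mem_singleton]
          constructor
          · rintro (h | rfl)
            · exact h
            · have := hG.lin N n c c hc ha rfl; omega
          · exact Or.inl
        have C3 : ∀ (n : ℕ) (a b : Action), N ≤ n → u[n]? = some a → u[n+1]? = some b → a.isPositive = false →
            (c ∈ view (u.take (n+1)) ↔ c ∈ view (u.take (n+1+1))) := by
          intro n a b hn ha hb han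
          have hbp : b.isPositive = true := by
            have := hG.alt n a b ha hb
            rw [han] at this; simpa using this.symm
          rw [view_pos' hb hbp, List.mem_append, List.mem_singleton]
          constructor
          · exact Or.inl
          · rintro (h | rfl)
            · exact h
            · rw [hcn] at hbp; simp at hbp
        have fs : FS ξ pos u N K := by
          refine ⟨hG, hP, h0, hNu, hk, inv, ?_, ?_, ?_⟩
          · intro n a hn ha; exact (K_iff n a ha).2 (Or.inl hn)
          · intro n a j b ha han hn hb hj hNj hba
            rw [Bool.eq_iff_iff, K_iff n a ha, K_iff j b hb, C2 n a j b ha han hn hb hj hNj hba]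
            simp [show ¬ n < N by omega, show ¬ j < N by omega]
          · intro n a b hn ha hb han
            rw [Bool.eq_iff_iff, K_iff n a ha, K_iff (n+1) b hb, C3 n a b hn ha hb han]
            simp [show ¬ n < N by omega, show ¬ n + 1 < N by omega]
        have fs' : FS ξ pos u N K' := by
          refine ⟨hG, hP, h0, hNu, hk, inv, ?_, ?_, ?_⟩
          · intro n a hn ha; exact (K'_iff n a ha).2 (Or.inl hn)
          · intro n a j b ha han hn hb hj hNj hba
            rw [Bool.eq_iff_iff, K'_iff n a ha, K'_iff j b hb, C2 n a j b ha han hn hb hj hNj hba]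
            simp [show ¬ n < N by omega, show ¬ j < N by omega]
          · intro n a b hn ha hb han
            rw [Bool.eq_iff_iff, K'_iff n a ha, K'_iff (n+1) b hb, C3 n a b hn ha hb han]
            simp [show ¬ n < N by omega, show ¬ n + 1 < N by omega]
        have hKa : ¬ K a0 = true := by
          rw [K_iff n0 a0 ha0]
          rw [hG.view_neg ha0 ha0n (j := N-1) (by omega) hk1 hka0, show N - 1 + 1 = N by omega, hvw]
          rintro (h | h)
          · omega
          · rw [List.mem_append, List.mem_singleton] at h
            rcases h with h | rfl
            · obtain ⟨i, hi⟩ := List.mem_iff_getElem?.1 h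
              rw [get_take] at hi
              have := hG.lin N i c c hc hi.2 rfl
              omega
            · have := hG.lin N n0 c c hc ha0 rfl; omega
        have hK'c : ¬ K' c = true := by
          rw [K'_iff N c hc]
          rintro (h | h)
          · omega
          · apply h; rw [take_snoc hc]; exact mem_view_last _ _
        have step : ∀ Q : Action → Bool, FS ξ pos u N Q → (∃ x ∈ u, ¬ Q x = true) → V (close pos (u.filter Q)) := by
          intro Q hQ hx
          have hlt : (u.filter Q).length < u.length := List.length_filter_lt_length_iff_exists.2 hx
          have hlow : (u.filter Q).take N = u.take N := by
            obtain ⟨s, k, -, e1, e2⟩ := hQ.decomp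
            rw [e2, ← e1]
            rw [List.take_append_of_le_length (by simp; omega)]
            simp
          have hlenQ : N ≤ (u.filter Q).length := by
            have := congrArg List.length hlow
            simp at this; omega
          have hgl : ∀ (i : ℕ) (x : Action), i < N → ((u.filter Q)[i]? = some x ↔ u[i]? = some x) := by
            intro i x hi
            have h1 : ((u.filter Q).take N)[i]? = (u.take N)[i]? := by rw [hlow]
            rw [List.getElem?_take, List.getElem?_take, if_pos hi, if_pos hi] at h1
            rw [h1]
          refine ihm (u.filter Q) (by omega) hQ.GFu (hP.mono (fun a ha => (List.mem_filter.1 ha).1)) (hQ.views hV)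
            _ N le_rfl h0 hlenQ ?_ (by rw [hlow]; exact hvw) ?_
          · intro a ha
            exact hk a ((hgl _ a (by omega)).1 ha)
          · intro n a j b ha han hn hb hj hba
            by_contra hlt2
            have hb' := (hgl j b (by omega)).1 hb
            obtain ⟨i, hi⟩ := List.mem_iff_getElem?.1 ((List.mem_filter.1 (get_mem ha)).1)
            have hiN : N ≤ i := by
              by_contra hh
              have := hQ.GFu.lin n i a a ha ((hgl i a (by omega)).2 hi) rfl
              omega
            have := inv i a j b hi han hiN hb' (by omega) hba
            omega
        refine st _ _ u (step K fs ⟨a0, get_mem ha0, hKa⟩) (step K' fs' ⟨c, get_mem hc, hK'c⟩)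
          (fs.shuffle fs' ?_) hG
        intro n a ha hn
        have h1 := K_iff n a ha
        have h2 := K'_iff n a ha
        simp only [show ¬ n < N by omega, false_or] at h1 h2
        cases hh : K a with
        | true =>
          rw [hh] at h1
          have := h1.1 rfl
          cases hh' : K' a with
          | true => exact absurd this (h2.1 hh')
          | false => rfl
        | false =>
          rw [hh] at h1
          exact h2.2 (fun h => by simpa using h1.2 h)
      · refine ihl (N+2) (by omega) (by omega) (by omega) ?_ ?_ ?_
        · intro a ha
          rw [show N + 2 - 1 = N + 1 by omega, hd] at ha
          cases ha; exact hdp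
        · rw [view_pos' hd hdp, hv1, take_snoc hd]
        · intro n a j b ha han hn hb hj hba
          have h1 := inv n a j b ha han (by omega) hb hj hba
          have h2 : j ≠ N := by
            rintro rfl
            rw [hc] at hb; cases hb
            exact hP a (get_mem ha) c (get_mem hc) hba (by rw [han, hcn])
          have h3 : j ≠ N - 1 := by
            rintro rfl
            rw [hk1] at hb; cases hb
            exact hex ⟨n, a, by omega, ha, han, hba⟩
          omega

theorem L_main {V : List Action → Prop}
    (st : ∀ p q u, V p → V q → Shuffle p q (close pos u) → G ξ pos u → V (close pos u))
    (hG : G ξ pos u) (hP : Pol u) (hne : u ≠ [])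
    (hV : ∀ w a, w ++ [a] <+: close pos u → a.isPositive = true → V (view (w ++ [a]))) : V (close pos u) := by
  have hl : 0 < u.length := List.length_pos_iff.2 hne
  obtain ⟨x, hx⟩ := get_ex (u := u) (n := 0) hl
  have hxp := (hG.head x hx).1
  cases pos with
  | true =>
    refine L_aux st _ u le_rfl hG hP hV _ 1 le_rfl one_pos hl ?_ ?_ ?_
    · intro a ha; rw [show (1-1 : ℕ) = 0 from rfl, hx] at ha; cases ha; exact hxp
    · rw [take_snoc hx, view_pos hxp]; simp [view_nil]
    · intros; omega
  | false =>
    by_cases h1 : u.length = 1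
    · have hu : u = [x] := by
        rw [← List.take_length (l := u), h1, take_snoc hx]; simp
      have hcl : close false u = u ++ [.daimon] := by
        rw [close, if_pos]; rw [hu]; simp [turn, hxp]
      have := hV u .daimon (by rw [hcl]) rfl
      rw [view_snoc_dai] at this
      rw [hcl]
      have e : view u = u := by
        rw [hu]; exact view_neg_none (w := []) hxp (by simp)
      rwa [e] at this
    · obtain ⟨y, hy⟩ := get_ex (u := u) (n := 1) (by omega)
      have hyp : y.isPositive = true := by
        have := hG.alt 0 x y hx hy
        rw [hxp] at this; simpa using this.symm
      refine L_aux st _ u le_rfl hG hP hV _ 2 le_rfl two_pos (by omega) ?_ ?_ ?_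
      · intro a ha; rw [show (2-1 : ℕ) = 1 from rfl, hy] at ha; cases ha; exact hyp
      · rw [view_pos' hy hyp, take_snoc hy, take_snoc hx]
        congr 1
        exact view_neg_none (w := []) hxp (by simp)
      · intro n a j b ha han hn hb hj hba
        by_contra hh
        have : j = 0 := by omega
        subst this
        rw [hx] at hb; cases hb
        exact hP a (get_mem ha) x (get_mem hx) hba (by rw [han, hxp])

end


section
variable {ξ : Address} {pos : Bool} {A B : Set (Set (List Action))}

theorem JustChain.snoc {β : Base} {p s : List Action} {a b : Action} (h : JustChain β p s)
    (hl : s.getLast? = some b) (ha : a ∈ p) (hba : b.justifies a) : JustChain β p (s ++ [a]) := by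
  obtain ⟨s0, rfl⟩ := List.getLast?_eq_some_iff.1 hl
  have := JustChain.cons h ha hba
  simpa using this

/-- negative actions are justified by their predecessor -/
def VC (v : List Action) : Prop :=
  ∀ (n : ℕ) (a b : Action), v[n]? = some a → v[n+1]? = some b → b.isPositive = false → a.justifies b

theorem VC.snoc {v : List Action} {a : Action} (h : VC v)
    (ha : a.isPositive = false → ∀ b, v.getLast? = some b → b.justifies a) : VC (v ++ [a]) := by
  intro n x y hx hy hyn
  rw [get_snoc] at hx hy
  rcases hx with hx | ⟨hx, rfl⟩
  · rcases hy with hy | ⟨hy, rfl⟩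
    · exact h n x y hx hy hyn
    · apply ha hyn
      rw [List.getLast?_eq_getElem?, ← hy]; simpa using hx
  · rcases hy with hy | ⟨hy, rfl⟩
    · have := get_lt hy; omega
    · omega

theorem chainView {v : List Action} (hG : G ξ pos v) (hv : VC v) : ∀ (n : ℕ) (κ : Action), v[n]? = some κ →
    ∃ s, JustChain (simpleBase ξ pos) v s ∧ s.getLast? = some κ ∧ dview (v.take (n+1)) = s.map Action.dual := by
  intro n
  induction n using Nat.strong_induction_on with
  | _ n ih =>
    intro κ hκ
    rcases Nat.eq_zero_or_pos n with rfl | hn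
    · refine ⟨[κ], .init (get_mem hκ) (initial_iff.2 (hG.head κ hκ)), rfl, ?_⟩
      rw [take_snoc hκ]
      simp [dview, view_single]
    · cases hp : κ.isPositive with
      | true =>
        obtain ⟨j, b, hj, hb, hbk⟩ := hG.just n κ hκ hn
        obtain ⟨s, h1, h2, h3⟩ := ih j hj b hb
        refine ⟨s ++ [κ], h1.snoc h2 (get_mem hκ) hbk, by simp, ?_⟩
        rw [hG.dview_pos hκ hp hj hb hbk, h3]; simp
      | false =>
        obtain ⟨m, rfl⟩ : ∃ m, n = m + 1 := ⟨n-1, by omega⟩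
        obtain ⟨b, hb, -⟩ := hG.prev hκ
        obtain ⟨s, h1, h2, h3⟩ := ih m (by omega) b hb
        refine ⟨s ++ [κ], h1.snoc h2 (get_mem hκ) (hv m b κ hb hκ hp), by simp, ?_⟩
        rw [dview_neg hκ hp, h3]; simp

/-- views of reversible plays -/
theorem G.viewG {u : List Action} (hG : G ξ pos u) (hP : Pol u) : ∀ n : ℕ, n ≤ u.length →
    G ξ pos (view (u.take n)) ∧ VC (view (u.take n)) ∧ view (view (u.take n)) = view (u.take n) := by
  intro n
  induction n using Nat.strong_induction_on with
  | _ n ih =>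
    intro hn
    rcases Nat.eq_zero_or_pos n with rfl | h0
    · simp only [List.take_zero, view_nil, and_true]
      exact ⟨G.nil, by intro n; simp⟩
    obtain ⟨m, rfl⟩ : ∃ m, n = m + 1 := ⟨n-1, by omega⟩
    obtain ⟨a, ha⟩ := get_ex (u := u) (n := m) (by omega)
    have fresh : ∀ i, i ≤ m → ∀ b ∈ view (u.take i), b.focus? ≠ a.focus? := by
      intro i hi b hb hf
      obtain ⟨k, hk⟩ := List.mem_iff_getElem?.1 (view_subset _ _ hb)
      rw [get_take] at hk
      have := hG.lin k m b a hk.2 ha hf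
      omega
    rcases Nat.eq_zero_or_pos m with rfl | hm
    · have e : view (u.take (0+1)) = [] ++ [a] := by
        rw [take_snoc ha]; simp [view_single]
      rw [e]
      refine ⟨G.nil.snoc (hG.nod a (get_mem ha)) (fun _ => hG.head a ha) (by simp) (by simp) (by simp) (by simp) (by simp), ?_, ?_⟩
      · exact VC.snoc (by intro n; simp) (by simp)
      · simp [view_single]
    · obtain ⟨j, b, hj, hb, hba⟩ := hG.just m a ha hm
      cases hp : a.isPositive with
      | true =>
        obtain ⟨h1, h2, h3⟩ := ih m (by omega) (by omega)
        obtain ⟨k, rfl⟩ : ∃ k, m = k + 1 := ⟨m-1, by omega⟩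
        obtain ⟨x, hx, hxp⟩ := hG.prev ha
        have hlast : (view (u.take (k+1))).getLast? = some x := by
          rw [take_snoc hx]; exact view_snoc_last _ _
        rw [view_pos' ha hp]
        refine ⟨h1.snoc (hG.nod a (get_mem ha)) ?_ ?_ ?_ (fresh _ le_rfl) ?_ ?_, ?_, ?_⟩
        · intro h; rw [h] at hlast; simp at hlast
        · intro _; exact ⟨b, hG.pvis _ a j b ha hp hj hb hba, hba⟩
        · rw [hlast]; rintro y ⟨⟩; rw [hxp]; simp
        · intro _ y hy _; rw [h3]; exact hy
        · intro h; rw [hp] at h; simp at h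
        · exact h2.snoc (by intro h; rw [hp] at h; simp at h)
        · rw [view_pos hp, h3]
      | false =>
        obtain ⟨h1, h2, h3⟩ := ih (j+1) (by omega) (by omega)
        have hlast : (view (u.take (j+1))).getLast? = some b := by
          rw [take_snoc hb]; exact view_snoc_last _ _
        rw [hG.view_neg ha hp hj hb hba]
        refine ⟨h1.snoc (hG.nod a (get_mem ha)) ?_ ?_ ?_ (fresh _ (by omega)) ?_ ?_, ?_, ?_⟩
        · intro h; rw [h] at hlast; simp at hlast
        · intro _; exact ⟨b, List.mem_of_getLast? hlast, hba⟩
        · rw [hlast]; rintro y ⟨⟩; exact hP a (get_mem ha) b (get_mem hb) hba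
        · intro h; rw [hp] at h; simp at h
        · intro _ y hy hya
          have := h1.linm hy (List.mem_of_getLast? hlast) (justifies_focus hya hba)
          rw [this]; exact dual_last_mem hlast
        · exact h2.snoc (by intro _; rw [hlast]; rintro y ⟨⟩; exact hba)
        · obtain ⟨s0, e⟩ := List.getLast?_eq_some_iff.1 hlast
          rw [e] at h3 ⊢
          have := Ludics.view_neg (w1 := s0) (w2 := []) hp hba (by simp)
          rw [h3] at this
          simpa using this

def VisP (pos : Bool) (A B : Set (Set (List Action))) (p : List Action) : Prop :=
  ∃ u, Vis pos A B u ∧ p = close pos u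

def Hyp (pos : Bool) (A B : Set (Set (List Action))) : Prop :=
  ∀ D, Mat A D → ∀ c ∈ D, (∃ a, c.getLast? = some a ∧ a.isPositive = true) → VisP pos A B c

theorem pre_nod_close {pos : Bool} {v y : List Action} (hv : ∀ a ∈ v, a ≠ .daimon) (h : v <+: close pos y) : v <+: y := by
  rcases prefix_close h with h | ⟨-, h⟩
  · exact h
  · exact absurd rfl (hv .daimon (by rw [h]; simp))

theorem nodup_focus_inj {l : List Action} (h : (l.filterMap Action.focus?).Nodup) {x y : Action}
    (hx : x ∈ l) (hy : y ∈ l) (hd : x ≠ .daimon) (e : x.focus? = y.focus?) : x = y := by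
  induction l with
  | nil => simp at hx
  | cons z l ih =>
    cases hz : z.focus? with
    | none =>
      have hz' := focus_none.1 hz
      rw [List.filterMap_cons_none hz] at h
      have hxz : x ≠ z := by rw [hz']; exact hd
      have hyz : y ≠ z := by
        rintro rfl
        rw [hz] at e
        exact hd (focus_none.1 e)
      exact ih h (by simpa [hxz] using hx) (by simpa [hyz] using hy)
    | some f =>
      rw [List.filterMap_cons_some hz, List.nodup_cons] at h
      rcases List.mem_cons.1 hx with rfl | hx1
      · rcases List.mem_cons.1 hy with rfl | hy1
        · rfl
        · exact absurd (List.mem_filterMap.2 ⟨y, hy1, e.symm.trans hz⟩) h.1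
      · rcases List.mem_cons.1 hy with rfl | hy1
        · exact absurd (List.mem_filterMap.2 ⟨x, hx1, e.trans hz⟩) h.1
        · exact ih h.2 hx1 hy1

theorem claimN (h : Pair ξ pos A B) (h1 : Hyp pos A B) (h2 : Hyp (!pos) B A) {s : List Action} (hs : Triv ξ pos A s)
    {κ : Action} (hκ : s.getLast? = some κ) :
    (κ.isPositive = false → VisP (!pos) B A (s.map Action.dual)) ∧
    (κ.isPositive = true → VisP (!pos) B A (s.map Action.dual ++ [.daimon])) := by
  obtain ⟨D, hD, c, hc, hs⟩ := hs
  have hDd : IsDesign (simpleBase ξ pos) D := h.desA D hD.1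
  have hch := hDd.chron c hc
  have hκc : κ ∈ c := hs.mem κ (List.mem_of_getLast? hκ)
  have hκd : κ ≠ .daimon := hs.nod κ (List.mem_of_getLast? hκ)
  obtain ⟨w, t, rfl⟩ := List.append_of_mem hκc
  have hpre : w ++ [κ] <+: w ++ κ :: t := ⟨t, by simp⟩
  have hvD : w ++ [κ] ∈ D := hDd.prefixClosed _ hc _ hpre (by simp)
  have hnod : ∀ a ∈ w ++ [κ], a ≠ .daimon := by
    rintro a ha rfl
    rcases List.mem_append.1 ha with ha | ha
    · obtain ⟨w1, w2, rfl⟩ := List.append_of_mem ha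
      have := hch.1.daimonLast w1 ⟨w2 ++ κ :: t, by simp⟩
      have := congrArg List.length this
      simp at this
    · exact hκd (List.mem_singleton.1 ha).symm
  have hG : G ξ pos (w ++ [κ]) := chron_G hch hpre hnod
  have hVC : VC (w ++ [κ]) := by
    intro n a b ha hb hbn
    have hp := pre_of_get hb
    rw [take_snoc ha] at hp
    rcases hch.2.2 ((w ++ [κ]).take n) a b (by simpa using hp.trans hpre) hbn with hi | hj
    · exfalso
      obtain ⟨y, hy⟩ := get_ex (u := w ++ [κ]) (n := 0) (by simp)
      have := hG.lin 0 (n+1) y b hy hb (by rw [(hG.head y hy).2, (initial_iff.1 hi).2])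
      omega
    · exact hj
  have hview : dview (w ++ [κ]) = s.map Action.dual := by
    obtain ⟨s', e1, e2, e3⟩ := chainView hG hVC w.length κ (by simp)
    have : s = s' := by
      refine hs.unique e1 ?_ (by rw [hκ, e2])
      intro x hx y hy hxy
      exact nodup_focus_inj hch.1.linearity (hs.mem x hx) (hpre.subset (e1.mem y hy)) (hs.nod x hx) hxy
    rw [this, ← e3]
    congr 1
    simp
  have hwd : (w ++ [κ]).map Action.dual = w.map Action.dual ++ [κ.dual] := by simp
  constructor
  · intro hn
    have hext : ∃ x, w ++ [κ] ++ [x] ∈ D := by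
      by_contra hno
      push Not at hno
      obtain ⟨a, ha, hap⟩ := hDd.maxPos _ hvD hno
      simp at ha; subst ha
      rw [hn] at hap; simp at hap
    obtain ⟨x, hx⟩ := hext
    have hxp : x.isPositive = true := by
      have := (hDd.chron _ hx).1.alternating
      have := isChain_iff_get.1 this w.length κ x (by simp) (by simp)
      rw [hn] at this; simpa using this.symm
    obtain ⟨y, hy, e⟩ := h1 D hD _ hx ⟨x, by simp, hxp⟩
    have hvy : w ++ [κ] <+: y := pre_nod_close (pos := pos) hnod (by rw [← e]; exact List.prefix_append _ _)
    obtain ⟨D', hD', hq⟩ := Vis.mat h.symm hy.symm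
    have h3 := hq ((w ++ [κ]).map Action.dual) ((hvy.map _).trans u_prefix_close) (by simp)
    have h4 : view ((w ++ [κ]).map Action.dual) = s.map Action.dual := hview
    rw [h4] at h3
    refine h2 D' hD' _ h3 ⟨κ.dual, by simp [List.getLast?_map, hκ], ?_⟩
    rw [dual_pos hκd, hn]; rfl
  · intro hp
    obtain ⟨y, hy, e⟩ := h1 D hD _ hvD ⟨κ, by simp, hp⟩
    have hvy : w ++ [κ] <+: y := pre_nod_close (pos := pos) hnod (by rw [← e])
    have hvy' : y = w ++ [κ] := by
      have h3 : y <+: w ++ [κ] := by rw [e]; exact u_prefix_close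
      exact h3.eq_of_length_le hvy.length_le
    obtain ⟨D', hD', hq⟩ := Vis.mat h.symm hy.symm
    have h3 := hq ((w ++ [κ]).map Action.dual ++ [.daimon]) (by
      rw [hvy', close, if_pos]; rw [hwd, turn_snoc, dual_pos hκd, hp]; rfl) (by simp)
    have h4 : view ((w ++ [κ]).map Action.dual) = s.map Action.dual := hview
    rw [view_snoc_dai, h4] at h3
    exact h2 D' hD' _ h3 ⟨.daimon, by simp, rfl⟩

theorem RegU.Pol (h : Pair ξ pos A B) {u : List Action} (hu : RegU ξ pos A u) : Pol u := by
  intro a ha b hb hba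
  obtain ⟨s, hs, hsl⟩ := hu.G.chain_mem hb
  have hs' := hs.snoc hsl ha hba
  obtain ⟨s2, h1, h2, h3⟩ := hu.triv a ha
  have e : s ++ [a] = s2 := hs'.unique h1 (fun x hx y hy => hu.G.linm (hs'.mem x hx) (h1.mem y hy)) (by simp [h2])
  obtain ⟨v, hv, hm⟩ := h3.vis h
  refine (Vis.G h hv).2 a (hm a (by rw [← e]; simp)) b (hm b ?_) hba
  rw [← e]; exact List.mem_append_left _ (List.mem_of_getLast? hsl)

def Stab (ξ : Address) (pos : Bool) (A B : Set (Set (List Action))) : Prop :=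
  ∀ p q u, VisP pos A B p → VisP pos A B q → Shuffle p q (close pos u) → G ξ pos u → VisP pos A B (close pos u)

theorem VisP.close {u : List Action} (h : Pair ξ pos A B) (hv : VisP pos A B (close pos u)) (hG : G ξ pos u) :
    Vis pos A B u := by
  obtain ⟨x, hx, e⟩ := hv
  rw [close_inj hG.nod (Vis.G h hx).1.nod e]; exact hx

theorem claimM (h : Pair ξ pos A B) (h1 : Hyp pos A B) (h2 : Hyp (!pos) B A) (st : Stab ξ (!pos) B A)
    {v : List Action} (hv : RegU ξ pos A v) (hVC : VC v) : Vis pos A B v := by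
  by_cases hne : v = []
  · rw [hne]; exact h.vis_nil
  have hG := hv.G
  have key : ∀ (n : ℕ) (κ : Action), v[n]? = some κ → ∃ s, s.getLast? = some κ ∧ Triv ξ pos A s ∧
      view ((v.take (n+1)).map Action.dual) = s.map Action.dual := by
    intro n κ hκ
    obtain ⟨s, h3, h4, h5⟩ := chainView hG hVC n κ hκ
    obtain ⟨s2, h6, h7, h8⟩ := hv.triv κ (get_mem hκ)
    have e : s = s2 := h3.unique h6 (fun x hx y hy => hG.linm (h3.mem x hx) (h6.mem y hy)) (by rw [h4, h7])
    refine ⟨s, h4, by rw [e]; exact h8, h5⟩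
  have hP := hv.Pol h
  have : VisP (!pos) B A (Ludics.close (!pos) (v.map Action.dual)) := by
    refine L_main st hG.dual (hv.dual h |>.Pol h.symm) (by simpa using hne) ?_
    intro w a hw hap
    rcases prefix_close hw with hw | ⟨ht, hw⟩
    · obtain ⟨e1, e2⟩ := get_of_pre hw
      have e3 := get_map_dual.1 e2
      obtain ⟨s, h3, h4, h5⟩ := key _ _ e3
      have e4 : w ++ [a] = (v.take (w.length+1)).map Action.dual := by
        rw [List.map_take, take_snoc e2, ← e1]
      rw [e4, h5]
      refine (claimN h h1 h2 h4 h3).1 ?_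
      rw [dual_pos (nod_dual hG.nod a (get_mem e2)), hap]; rfl
    · rw [hw, view_snoc_dai]
      obtain ⟨v0, κ, e⟩ := List.eq_nil_or_concat v |>.resolve_left hne
      rw [List.concat_eq_append] at e
      obtain ⟨s, h3, h4, h5⟩ := key v0.length κ (by rw [e]; simp)
      have e2 : v.take (v0.length+1) = v := by
        rw [e]; apply List.take_of_length_le; simp
      rw [e2] at h5
      rw [h5]
      refine (claimN h h1 h2 h4 h3).2 ?_
      rw [e, List.map_append, List.map_singleton, turn_snoc, dual_pos (hG.nod κ (by rw [e]; simp))] at ht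
      simpa using ht
  have := (VisP.close h.symm this hG.dual).symm'
  simpa using this

theorem main_if (h : Pair ξ pos A B) (h1 : Hyp pos A B) (h2 : Hyp (!pos) B A) (st : Stab ξ pos A B)
    (st' : Stab ξ (!pos) B A) {u : List Action} (hu : RegU ξ pos A u) : Vis pos A B u := by
  by_cases hne : u = []
  · rw [hne]; exact h.vis_nil
  have hG := hu.G
  have hP := hu.Pol h
  have key : ∀ n : ℕ, n ≤ u.length → Vis pos A B (view (u.take n)) := by
    intro n hn
    obtain ⟨g1, g2, g3⟩ := hG.viewG hP n hn
    have hsub : ∀ x ∈ view (u.take n), x ∈ u := fun x hx => List.mem_of_mem_take (view_subset _ _ hx)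
    refine claimM h h1 h2 st' ⟨g1, ?_⟩ g2
    intro κ hκ
    obtain ⟨s, h3, h4⟩ := g1.chain_mem hκ
    obtain ⟨s2, h6, h7, h8⟩ := hu.triv κ (hsub κ hκ)
    have e : s = s2 := h3.unique h6 (fun x hx y hy => hG.linm (hsub x (h3.mem x hx)) (h6.mem y hy)) (by rw [h4, h7])
    exact ⟨s, h3, h4, by rw [e]; exact h8⟩
  refine VisP.close h (L_main st hG hP hne ?_) hG
  intro w a hw hap
  rcases prefix_close hw with hw | ⟨ht, hw⟩
  · obtain ⟨e1, e2⟩ := get_of_pre hw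
    have e4 : w ++ [a] = u.take (w.length+1) := by rw [take_snoc e2, ← e1]
    refine ⟨_, key (w.length+1) (get_lt e2), ?_⟩
    rw [← e4, view_pos hap, close, if_neg]
    rw [turn_snoc, hap]; simp
  · refine ⟨_, key u.length le_rfl, ?_⟩
    rw [List.take_length, hw, view_snoc_dai, close, if_pos]
    obtain ⟨v0, κ, e⟩ := List.eq_nil_or_concat u |>.resolve_left hne
    rw [List.concat_eq_append] at e
    rw [e, turn_snoc] at ht
    have := view_snoc_last v0 κ
    rw [← e] at this
    rw [turn, this]; exact ht

end

theorem regular_iff_shuffleRegular' (ξ : Address) (pos : Bool)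
    (A : Behaviour ξ pos) (B : Behaviour ξ (!pos))
    (hB : B.designs = orthSet ξ pos A.designs) :
    Regular A ↔
      ((∀ D, Material A D → ∀ c ∈ D,
          (∃ a, c.getLast? = some a ∧ a.isPositive = true) → Visitable A c) ∧
       (∀ D, Material B D → ∀ c ∈ D,
          (∃ a, c.getLast? = some a ∧ a.isPositive = true) → Visitable B c) ∧
       (∀ p q r, Visitable A p → Visitable A q → Shuffle p q r →
          IsPath (simpleBase ξ pos) r →
          IsPath (simpleBase ξ (!pos)) (dualSeq r) → Visitable A r) ∧
       (∀ p q r, Visitable B p → Visitable B q → Shuffle p q r →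
          IsPath (simpleBase ξ (!pos)) r →
          IsPath (simpleBase ξ pos) (dualSeq r) → Visitable B r)) := by
  have hA : A.designs = orthSet ξ (!pos) B.designs := by rw [hB]; exact A.closed
  have h : Pair ξ pos A.designs B.designs := (pair_of A B hB).toPair
  have vA : ∀ p, Visitable A p ↔ VisP pos A.designs B.designs p := visitable_iff A hB
  have vB : ∀ p, Visitable B p ↔ VisP (!pos) B.designs A.designs p := visitable_iff B hA
  rw [regular_iff A hB]
  simp only [vA, vB]
  constructor
  · intro hr
    have hr' : ∀ u, RegU ξ (!pos) B.designs u → Vis (!pos) B.designs A.designs u := by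
      intro u hu
      have h1 := hu.dual h.symm
      rw [Bool.not_not] at h1
      have := (hr _ h1).symm
      simpa using this
    refine ⟨?_, ?_, ?_, ?_⟩
    · intro D hD c hc he
      obtain ⟨u, hu, e⟩ := regU_chron h hD hc he
      exact ⟨u, hr u hu, e⟩
    · intro D hD c hc he
      obtain ⟨u, hu, e⟩ := regU_chron h.symm hD hc he
      exact ⟨u, hr' u hu, e⟩
    · rintro p q r ⟨u, hu, rfl⟩ ⟨v, hv, rfl⟩ hs h1 h2
      obtain ⟨w, hw, e⟩ := regU_shuffle h hu hv hs h1 h2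
      exact ⟨w, hr w hw, e⟩
    · rintro p q r ⟨u, hu, rfl⟩ ⟨v, hv, rfl⟩ hs h1 h2
      obtain ⟨w, hw, e⟩ := regU_shuffle h.symm hu hv hs h1 (by rw [Bool.not_not]; exact h2)
      exact ⟨w, hr' w hw, e⟩
  · rintro ⟨h1, h2, h3, h4⟩ u hu
    refine main_if h h1 h2 ?_ ?_ hu
    · intro p q u hp hq hs hG
      exact h3 p q _ hp hq hs hG.isPath hG.isPath_dual
    · intro p q u hp hq hs hG
      refine h4 p q _ hp hq hs hG.isPath ?_
      have := hG.isPath_dual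
      rwa [Bool.not_not] at this


/-- a behaviour of simple base is regular iff it is
shuffle-regular: all positive-ended chronicles of `|A|` and `|A⊥|` are
visitable and the visitable paths of `A` and of `A⊥` are stable under
reversible shuffle. -/
theorem regular_iff_shuffleRegular (ξ : Address) (pos : Bool)
    (A : Behaviour ξ pos) (B : Behaviour ξ (!pos))
    (hB : B.designs = orthSet ξ pos A.designs) :
    Regular A ↔
      ((∀ D, Material A D → ∀ c ∈ D,
          (∃ a, c.getLast? = some a ∧ a.isPositive = true) → Visitable A c) ∧
       (∀ D, Material B D → ∀ c ∈ D,
          (∃ a, c.getLast? = some a ∧ a.isPositive = true) → Visitable B c) ∧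
       (∀ p q r, Visitable A p → Visitable A q → Shuffle p q r →
          IsPath (simpleBase ξ pos) r →
          IsPath (simpleBase ξ (!pos)) (dualSeq r) → Visitable A r) ∧
       (∀ p q r, Visitable B p → Visitable B q → Shuffle p q r →
          IsPath (simpleBase ξ (!pos)) r →
          IsPath (simpleBase ξ pos) (dualSeq r) → Visitable B r)) := by
  exact regular_iff_shuffleRegular' ξ pos A B hB

end Ludics
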